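/- arXiv:1708.02370 — 2 statements merged into one kernel-verified Lean document; each statement's English description precedes it below -/
import Mathlib

section
/- For every integer k ≥ 3, the clustered chromatic number of the class of graphs containing no k-fat star minor equals 4; that is, there exists an integer c such that every graph with no k-fat star minor is 4-colourable with clustering c, and for every integer c′ there exists a graph with no k-fat star minor that has no 3-colouring with clustering c′. -/
/-- `G` is `k`-colourable with clustering `c`: the vertices can be coloured with `k`
colours so that every monochromatic component has at most `c` vertices. -/
def ClusteredColourable {V : Type*} (G : SimpleGraph V) (k c : ℕ) : Prop :=
  ∃ f : V → Fin k, ∀ v : V,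
    ((G.induce {u | f u = f v}).connectedComponentMk ⟨v, rfl⟩).supp.ncard ≤ c

/-- `H` is a minor of `G`: there are pairwise disjoint connected branch sets in `G`,
one for each vertex of `H`, with an edge of `G` between the branch sets of any two
vertices adjacent in `H`. -/
def IsMinor {α : Type*} {β : Type*} (H : SimpleGraph α) (G : SimpleGraph β) : Prop :=
  ∃ X : α → Set β,
    (∀ a, (G.induce (X a)).Connected) ∧
    (Pairwise fun a b => Disjoint (X a) (X b)) ∧
    (∀ a b, H.Adj a b → ∃ x ∈ X a, ∃ y ∈ X b, G.Adj x y)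

/-- A copy of `H` is a subgraph of `G`. -/
def IsSubgraphEmb {α : Type*} {β : Type*} (H : SimpleGraph α) (G : SimpleGraph β) : Prop :=
  ∃ f : α → β, Function.Injective f ∧ ∀ a b, H.Adj a b → G.Adj (f a) (f b)

/-- `closureTree h k` is the closure `C(h,k)` of the complete `k`-ary tree of depth `h`:
vertices are the nodes of the tree (sequences over `Fin k` of length `< h`), and two
distinct nodes are adjacent iff one is an ancestor (i.e. a prefix) of the other. -/
def closureTree (h k : ℕ) : SimpleGraph {l : List (Fin k) // l.length < h} :=
  SimpleGraph.fromRel (fun u v => u.1 <+: v.1)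

/-- `weakClosureTree h k` is the weak closure `W(h,k)` of the complete `k`-ary tree of
depth `h`: two nodes are adjacent iff one is a leaf (a node of depth `h`, i.e. a sequence
of length `h - 1`) and the other is a proper ancestor (prefix) of it. -/
def weakClosureTree (h k : ℕ) : SimpleGraph {l : List (Fin k) // l.length < h} :=
  SimpleGraph.fromRel (fun u v => v.1.length = h - 1 ∧ u.1 <+: v.1)

/-- The connected tree-depth of a finite graph `H`: the least depth of a rooted tree
whose closure contains `H` as a subgraph.  (It suffices to consider complete `n`-ary
trees where `n` is the number of vertices of `H`.) -/
noncomputable def ctd {V : Type*} [Finite V] (H : SimpleGraph V) : ℕ :=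
  sInf {h : ℕ | IsSubgraphEmb H (closureTree h (Nat.card V))}

/-- The tree-depth of a finite graph `H`: the maximum over the connected components of
`H` of the connected tree-depth of that component. -/
noncomputable def treeDepth {V : Type*} [Finite V] (H : SimpleGraph V) : ℕ :=
  sSup {n : ℕ | ∃ C : H.ConnectedComponent, n = ctd (H.induce C.supp)}

/-- The `n`-fan: a path on `n` vertices plus one dominant vertex. -/
def fan (n : ℕ) : SimpleGraph (Option (Fin n)) :=
  SimpleGraph.fromRel (fun u v =>
    match u, v with
    | none, some _ => True
    | some i, some j => (i : ℕ) + 1 = (j : ℕ)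
    | _, _ => False)

/-- The `n`-fat star: a star with centre `Sum.inl ()` and `n` leaves, where for each
edge from the centre to leaf `i` there are `n` extra vertices `(i, j)` adjacent to both
the centre and leaf `i`. -/
def fatStar (n : ℕ) : SimpleGraph (Unit ⊕ Fin n ⊕ Fin n × Fin n) :=
  SimpleGraph.fromRel (fun u v =>
    match u, v with
    | Sum.inl _, Sum.inr _ => True
    | Sum.inr (Sum.inl i), Sum.inr (Sum.inr (i', _)) => i = i'
    | _, _ => False)

/-- The `n`-fat path: a path on `n` vertices, where for each edge `{e, e+1}` of the path
there are `n` extra vertices `(e, j)` adjacent to both endpoints of that edge. -/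
def fatPath (n : ℕ) : SimpleGraph (Fin n ⊕ Fin (n - 1) × Fin n) :=
  SimpleGraph.fromRel (fun u v =>
    match u, v with
    | Sum.inl i, Sum.inl j => (i : ℕ) + 1 = (j : ℕ)
    | Sum.inl i, Sum.inr (e, _) => (i : ℕ) = (e : ℕ) ∨ (i : ℕ) = (e : ℕ) + 1
    | _, _ => False)

/-- `G` has treewidth at most `w`: there is a tree decomposition of `G` all of whose
bags have at most `w + 1` vertices. -/
def HasTreewidthAtMost {V : Type*} (G : SimpleGraph V) (w : ℕ) : Prop :=
  ∃ (ι : Type) (T : SimpleGraph ι) (B : ι → Set V),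
    T.Connected ∧ T.IsAcyclic ∧
    (∀ v : V, ∃ t, v ∈ B t) ∧
    (∀ u v : V, G.Adj u v → ∃ t, u ∈ B t ∧ v ∈ B t) ∧
    (∀ v : V, (T.induce {t | v ∈ B t}).Connected) ∧
    (∀ t, (B t).ncard ≤ w + 1)

/-- A `k`-strong `H`-model in `G`: pairwise disjoint connected subgraphs `X a` of `G`,
one for each vertex `a` of `H`, such that for every edge `ab` of `H` at least `k`
vertices of `G` outside all the `X`'s have neighbours in both `X a` and `X b`. -/
def StrongModel {α : Type*} {β : Type*} (k : ℕ) (H : SimpleGraph α) (G : SimpleGraph β) : Prop :=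
  ∃ X : α → Set β,
    (∀ a, (G.induce (X a)).Connected) ∧
    (Pairwise fun a b => Disjoint (X a) (X b)) ∧
    (∀ a b, H.Adj a b →
      k ≤ {v : β | (∀ x, v ∉ X x) ∧ (∃ x ∈ X a, G.Adj v x) ∧ (∃ y ∈ X b, G.Adj v y)}.ncard)

namespace FatStar

open SimpleGraph

variable {V : Type*} {G : SimpleGraph V}

/-! ### Connected vertex sets -/

lemma connected_singleton (G : SimpleGraph V) (v : V) : (G.induce {v}).Connected := by
  have : Subsingleton ({v} : Set V) := by
    constructor
    rintro ⟨a, ha⟩ ⟨b, hb⟩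
    simp only [Set.mem_singleton_iff] at ha hb
    simp [ha, hb]
  have : Nonempty ({v} : Set V) := ⟨⟨v, rfl⟩⟩
  exact ⟨Preconnected.of_subsingleton⟩

/-- A property that propagates along the edges inside a connected set holds everywhere on it
as soon as it holds somewhere. -/
lemma connected_propagate {X : Set V} (h : (G.induce X).Connected) (P : V → Prop)
    (hP : ∀ x ∈ X, ∀ y ∈ X, G.Adj x y → P x → P y) {x y : V} (hx : x ∈ X) (hy : y ∈ X)
    (hPx : P x) : P y := by
  obtain ⟨p⟩ := h.preconnected ⟨x, hx⟩ ⟨y, hy⟩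
  have key : ∀ (a b : X) (_ : (G.induce X).Walk a b), P a → P b := by
    intro a b p
    induction p with
    | nil => exact id
    | cons hadj _ ih => exact fun ha => ih (hP _ (Subtype.prop _) _ (Subtype.prop _) hadj ha)
  exact key _ _ p hPx

/-- A set is connected if every vertex other than the root has a neighbour in the set on which
some rank function is smaller. -/
lemma connected_of_rank {X : Set V} {u : V} (hu : u ∈ X) (rank : V → ℕ)
    (h : ∀ v ∈ X, v ≠ u → ∃ w ∈ X, G.Adj v w ∧ rank w < rank v) : (G.induce X).Connected := by
  have key : ∀ n, ∀ v (hv : v ∈ X), rank v = n → (G.induce X).Reachable ⟨v, hv⟩ ⟨u, hu⟩ := by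
    intro n
    induction n using Nat.strong_induction_on with
    | _ n ih =>
      intro v hv hn
      by_cases hvu : v = u
      · subst hvu; exact Reachable.refl _
      · obtain ⟨w, hw, hadj, hlt⟩ := h v hv hvu
        have hadj' : (G.induce X).Adj ⟨v, hv⟩ ⟨w, hw⟩ := hadj
        exact hadj'.reachable.trans (ih _ (hn ▸ hlt) w hw rfl)
  have : Nonempty X := ⟨⟨u, hu⟩⟩
  exact ⟨fun a b => (key _ a.1 a.2 rfl).trans (key _ b.1 b.2 rfl).symm⟩

lemma connected_nonempty {X : Set V} (h : (G.induce X).Connected) : X.Nonempty := by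
  obtain ⟨x⟩ := h.nonempty
  exact ⟨x.1, x.2⟩

lemma connected_mono_graph {G' : SimpleGraph V} (hle : G ≤ G') {X : Set V}
    (h : (G.induce X).Connected) : (G'.induce X).Connected :=
  h.mono (fun _ _ hab => hle hab)

lemma connected_union {X Y : Set V} (hX : (G.induce X).Connected) (hY : (G.induce Y).Connected)
    {x y : V} (hx : x ∈ X) (hy : y ∈ Y) (h : G.Adj x y) : (G.induce (X ∪ Y)).Connected :=
  connected_induce_union hX.preconnected hY.preconnected hx hy h

/-! ### Minors -/

lemma isMinor_mono {α : Type*} {H : SimpleGraph α} {G' : SimpleGraph V} (hle : G ≤ G')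
    (h : IsMinor H G) : IsMinor H G' := by
  obtain ⟨X, hc, hd, he⟩ := h
  refine ⟨X, fun a => connected_mono_graph hle (hc a), hd, fun a b hab => ?_⟩
  obtain ⟨x, hx, y, hy, hxy⟩ := he a b hab
  exact ⟨x, hx, y, hy, hle hxy⟩

/-- Transitivity of the minor relation, where the branch sets of the isolated vertices of the
intermediate graph are irrelevant. -/
lemma isMinor_trans {α β : Type*} {H : SimpleGraph α} {G' : SimpleGraph β}
    (hH : ∀ a, ∃ b, H.Adj a b) (Y : β → Set V)
    (hc : ∀ x y, G'.Adj x y → (G.induce (Y x)).Connected)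
    (hd : ∀ x x' y y', G'.Adj x x' → G'.Adj y y' → x ≠ y → Disjoint (Y x) (Y y))
    (he : ∀ x y, G'.Adj x y → ∃ u ∈ Y x, ∃ v ∈ Y y, G.Adj u v)
    (h : IsMinor H G') : IsMinor H G := by
  obtain ⟨X, hXc, hXd, hXe⟩ := h
  have hnb : ∀ a, ∀ x ∈ X a, ∃ y, G'.Adj x y := by
    intro a x hx
    by_contra hno
    push Not at hno
    obtain ⟨b, hab⟩ := hH a
    obtain ⟨z, hz, w, _, hzw⟩ := hXe a b hab
    have : z = x := connected_propagate (hXc a) (fun t => t = x)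
      (fun s _ t _ hst hs => absurd (hs ▸ hst) (hno t)) hx hz rfl
    exact hno w (this ▸ hzw)
  refine ⟨fun a => ⋃ x ∈ X a, Y x, fun a => ?_, fun a b hab => ?_, fun a b hab => ?_⟩
  · obtain ⟨x₀, hx₀⟩ := connected_nonempty (hXc a)
    obtain ⟨y₀, hy₀⟩ := hnb a x₀ hx₀
    obtain ⟨z₀, hz₀⟩ := connected_nonempty (hc _ _ hy₀)
    have hsub : ∀ x ∈ X a, Y x ⊆ ⋃ x ∈ X a, Y x := fun x hx => Set.subset_biUnion_of_mem hx
    have hin : ∀ x (hx : x ∈ X a) u v (hu : u ∈ Y x) (hv : v ∈ Y x),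
        (G.induce (⋃ x ∈ X a, Y x)).Reachable ⟨u, hsub x hx hu⟩ ⟨v, hsub x hx hv⟩ := by
      intro x hx u v hu hv
      obtain ⟨y, hy⟩ := hnb a x hx
      exact ((hc _ _ hy).preconnected ⟨u, hu⟩ ⟨v, hv⟩).map
        (induceHomOfLE G (hsub x hx)).toHom
    have key : ∀ x ∈ X a, ∀ (hx : x ∈ X a) (z) (hz : z ∈ Y x),
        (G.induce (⋃ x ∈ X a, Y x)).Reachable ⟨z₀, hsub x₀ hx₀ hz₀⟩ ⟨z, hsub x hx hz⟩ := by
      intro x hx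
      refine connected_propagate (hXc a) (fun x => ∀ (hx : x ∈ X a) (z) (hz : z ∈ Y x),
        (G.induce (⋃ x ∈ X a, Y x)).Reachable ⟨z₀, hsub x₀ hx₀ hz₀⟩ ⟨z, hsub x hx hz⟩)
        ?_ hx₀ hx (fun _ z hz => hin x₀ hx₀ _ _ hz₀ hz)
      intro x hx y hy hxy ih _ z hz
      obtain ⟨u, hu, v, hv, huv⟩ := he x y hxy
      have hadj : (G.induce (⋃ x ∈ X a, Y x)).Adj ⟨u, hsub x hx hu⟩ ⟨v, hsub y hy hv⟩ := huv
      exact ((ih hx u hu).trans hadj.reachable).trans (hin y hy _ _ hv hz)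
    have : Nonempty (⋃ x ∈ X a, Y x : Set V) := ⟨⟨z₀, hsub x₀ hx₀ hz₀⟩⟩
    refine (connected_iff_exists_forall_reachable _).2 ⟨⟨z₀, hsub x₀ hx₀ hz₀⟩, ?_⟩
    rintro ⟨w, hw⟩
    obtain ⟨x, hx, hwx⟩ := Set.mem_iUnion₂.1 hw
    exact key x hx hx w hwx
  · refine Set.disjoint_iUnion₂_left.2 fun x hx => Set.disjoint_iUnion₂_right.2 fun y hy => ?_
    obtain ⟨x', hx'⟩ := hnb a x hx
    obtain ⟨y', hy'⟩ := hnb b y hy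
    refine hd x x' y y' hx' hy' ?_
    rintro rfl
    exact Set.disjoint_left.1 (hXd hab) hx hy
  · obtain ⟨x, hx, y, hy, hxy⟩ := hXe a b hab
    obtain ⟨u, hu, v, hv, huv⟩ := he x y hxy
    exact ⟨u, Set.mem_biUnion hx hu, v, Set.mem_biUnion hy hv, huv⟩

/-! ### Finding a fat star -/

lemma fatStar_no_isolated {k : ℕ} (hk : 0 < k) (a : Unit ⊕ Fin k ⊕ Fin k × Fin k) :
    ∃ b, (fatStar k).Adj a b := by
  rcases a with u | a
  · exact ⟨Sum.inr (Sum.inl ⟨0, hk⟩), by simp [fatStar]⟩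
  · exact ⟨Sum.inl (), by simp [fatStar]⟩

/-- A connected set `D` together with `k` disjoint connected hubs, each of which has many common
neighbours with `D` outside all these sets, yields a `k`-fat star minor. -/
lemma isMinor_fatStar_of_hubs [Finite V] {k : ℕ} (D : Set V) (H : Fin k → Set V)
    (hD : (G.induce D).Connected) (hH : ∀ i, (G.induce (H i)).Connected)
    (hdisj : Pairwise fun i j => Disjoint (H i) (H j)) (hDH : ∀ i, Disjoint D (H i))
    (hcommon : ∀ i, k * (k + 1) ≤ {z | z ∉ D ∧ (∀ j, z ∉ H j) ∧ (∃ x ∈ D, G.Adj x z) ∧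
      ∃ y ∈ H i, G.Adj y z}.ncard) :
    IsMinor (fatStar k) G := by
  classical
  set Z : Fin k → Set V := fun i => {z | z ∉ D ∧ (∀ j, z ∉ H j) ∧ (∃ x ∈ D, G.Adj x z) ∧
      ∃ y ∈ H i, G.Adj y z} with hZ
  have hall : ∃ f : Fin k × Fin (k + 1) → V, Function.Injective f ∧
      ∀ p, f p ∈ (Set.toFinite (Z p.1)).toFinset := by
    rw [← Finset.all_card_le_biUnion_card_iff_exists_injective]
    intro s
    rcases s.eq_empty_or_nonempty with rfl | ⟨p, hp⟩
    · simp
    · calc s.card ≤ Fintype.card (Fin k × Fin (k + 1)) := s.card_le_univ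
        _ = k * (k + 1) := by simp
        _ ≤ (Z p.1).ncard := hcommon p.1
        _ = (Set.toFinite (Z p.1)).toFinset.card := Set.ncard_eq_toFinset_card _ _
        _ ≤ _ := Finset.card_le_card
          (Finset.subset_biUnion_of_mem (fun p => (Set.toFinite (Z p.1)).toFinset) hp)
  obtain ⟨f, hinj, hf⟩ := hall
  simp only [Set.Finite.mem_toFinset] at hf
  have hfD : ∀ p, f p ∉ D := fun p => (hf p).1
  have hfH : ∀ p j, f p ∉ H j := fun p => (hf p).2.1
  let X : Unit ⊕ Fin k ⊕ Fin k × Fin k → Set V := fun a => match a with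
    | Sum.inl _ => D
    | Sum.inr (Sum.inl i) => H i ∪ {f (i, Fin.last k)}
    | Sum.inr (Sum.inr (i, j)) => {f (i, j.castSucc)}
  have hedge : ∀ a b, (match a, b with
      | Sum.inl _, Sum.inr _ => True
      | Sum.inr (Sum.inl i), Sum.inr (Sum.inr (i', _)) => i = i'
      | _, _ => False : Prop) → ∃ x ∈ X a, ∃ y ∈ X b, G.Adj x y := by
    rintro (u | i | ⟨i, j⟩) (u' | i' | ⟨i', j'⟩) hab
    · exact hab.elim
    · obtain ⟨x, hx, hxz⟩ := (hf (i', Fin.last k)).2.2.1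
      exact ⟨x, hx, _, Or.inr rfl, hxz⟩
    · obtain ⟨x, hx, hxz⟩ := (hf (i', j'.castSucc)).2.2.1
      exact ⟨x, hx, _, rfl, hxz⟩
    · exact hab.elim
    · exact hab.elim
    · obtain ⟨y, hy, hyz⟩ := (hf (i', j'.castSucc)).2.2.2
      obtain rfl : i = i' := hab
      exact ⟨y, Or.inl hy, _, rfl, hyz⟩
    all_goals exact hab.elim
  refine ⟨X, ?_, ?_, ?_⟩
  · rintro (u | i | ⟨i, j⟩)
    · exact hD
    · obtain ⟨y, hy, hyz⟩ := (hf (i, Fin.last k)).2.2.2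
      exact connected_union (hH i) (connected_singleton G _) hy rfl hyz
    · exact connected_singleton G _
  · have hlast : ∀ i i' (j : Fin k), f (i, Fin.last k) ≠ f (i', j.castSucc) := by
      intro i i' j h
      exact (Fin.castSucc_ne_last j) (Prod.ext_iff.1 (hinj h)).2.symm
    rintro (u | i | ⟨i, j⟩) (u' | i' | ⟨i', j'⟩) hab
    · exact (hab rfl).elim
    · exact Set.disjoint_union_right.2 ⟨hDH i', Set.disjoint_singleton_right.2 (hfD _)⟩
    · exact Set.disjoint_singleton_right.2 (hfD _)
    · exact Set.disjoint_union_left.2 ⟨(hDH i).symm, Set.disjoint_singleton_left.2 (hfD _)⟩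
    · have hii : i ≠ i' := fun h => hab (by rw [h])
      refine Set.disjoint_union_left.2 ⟨Set.disjoint_union_right.2 ⟨hdisj hii, ?_⟩,
        Set.disjoint_union_right.2 ⟨?_, ?_⟩⟩
      · exact Set.disjoint_singleton_right.2 (hfH _ _)
      · exact Set.disjoint_singleton_left.2 (hfH _ _)
      · refine Set.disjoint_singleton.2 fun h => hii (Prod.ext_iff.1 (hinj h)).1
    · exact Set.disjoint_union_left.2 ⟨Set.disjoint_singleton_right.2 (hfH _ _),
        Set.disjoint_singleton.2 (hlast _ _ _)⟩
    · exact Set.disjoint_singleton_left.2 (hfD _)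
    · exact Set.disjoint_union_right.2 ⟨Set.disjoint_singleton_left.2 (hfH _ _),
        Set.disjoint_singleton.2 (hlast _ _ _).symm⟩
    · refine Set.disjoint_singleton.2 fun h => hab ?_
      obtain ⟨h₁, h₂⟩ := Prod.ext_iff.1 (hinj h)
      have h₁ : i = i' := h₁
      have h₂ : j = j' := Fin.castSucc_injective _ h₂
      rw [h₁, h₂]
  · intro a b hab
    rw [fatStar, fromRel_adj] at hab
    rcases hab.2 with h | h
    · exact hedge a b h
    · obtain ⟨x, hx, y, hy, hxy⟩ := hedge b a h
      exact ⟨y, hy, x, hx, hxy.symm⟩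

/-- A fat star minor all of whose hubs are single vertices. -/
lemma isMinor_fatStar_of_points [Finite V] {k : ℕ} (D : Set V) (h : Fin k → V)
    (hinj : Function.Injective h) (hD : (G.induce D).Connected) (hDh : ∀ i, h i ∉ D)
    (hc : ∀ i, ∃ a ∈ D, k * (k + 1) + k + D.ncard ≤ (G.commonNeighbors a (h i)).ncard) :
    IsMinor (fatStar k) G := by
  classical
  refine isMinor_fatStar_of_hubs D (fun i => {h i}) hD (fun i => connected_singleton G _)
    (fun i j hij => Set.disjoint_singleton.2 (hinj.ne hij))
    (fun i => Set.disjoint_singleton_right.2 (hDh i)) fun i => ?_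
  obtain ⟨a, ha, hle⟩ := hc i
  have hsub : G.commonNeighbors a (h i) \ (D ∪ Set.range h) ⊆ {z | z ∉ D ∧
      (∀ j, z ∉ ({h j} : Set V)) ∧ (∃ x ∈ D, G.Adj x z) ∧
      ∃ y ∈ ({h i} : Set V), G.Adj y z} := by
    rintro z ⟨hz, hz'⟩
    rw [Set.mem_union, not_or] at hz'
    exact ⟨hz'.1, fun j hj => hz'.2 ⟨j, hj.symm⟩, ⟨a, ha, hz.1⟩, h i, rfl, hz.2⟩
  refine le_trans ?_ (Set.ncard_le_ncard hsub (Set.toFinite _))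
  have h1 : (D ∪ Set.range h).ncard ≤ D.ncard + k := by
    refine (Set.ncard_union_le _ _).trans ?_
    have : (Set.range h).ncard = k := by
      rw [← Set.image_univ, Set.ncard_image_of_injective _ hinj]; simp
    omega
  have h2 := Set.le_ncard_sdiff (D ∪ Set.range h) (G.commonNeighbors a (h i)) (Set.toFinite _)
  omega

/-- A set of large size contains the range of an injective map from `Fin k`. -/
lemma exists_injective_of_le_ncard {s : Set V} {k : ℕ} [Finite V] (h : k ≤ s.ncard) :
    ∃ f : Fin k → V, Function.Injective f ∧ ∀ i, f i ∈ s := by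
  have hs := Set.toFinite s
  rw [Set.ncard_eq_toFinset_card s hs] at h
  obtain ⟨t, hts, htk⟩ := Finset.exists_subset_card_eq h
  refine ⟨fun i => (t.equivFinOfCardEq htk).symm i, ?_, fun i => ?_⟩
  · exact Subtype.val_injective.comp (Equiv.injective _)
  · exact hs.mem_toFinset.1 (hts (Subtype.prop _))

/-! ### Sparsity -/

/-- The graph obtained by contracting the vertex `u` into the vertex `v`, leaving `u` isolated. -/
def contractInto (G : SimpleGraph V) (u v : V) : SimpleGraph V where
  Adj x y := x ≠ y ∧ x ≠ u ∧ y ≠ u ∧ (G.Adj x y ∨ x = v ∧ G.Adj u y ∨ y = v ∧ G.Adj u x)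
  symm := ⟨fun x y h => ⟨h.1.symm, h.2.2.1, h.2.1, by
    rcases h.2.2.2 with h | h | h
    · exact Or.inl h.symm
    · exact Or.inr (Or.inr h)
    · exact Or.inr (Or.inl h)⟩⟩
  loopless := ⟨fun x h => h.1 rfl⟩

lemma isMinor_of_contractInto {k : ℕ} (hk : 0 < k) {u v : V} (huv : G.Adj u v)
    (h : IsMinor (fatStar k) (contractInto G u v)) : IsMinor (fatStar k) G := by
  classical
  refine isMinor_trans (fatStar_no_isolated hk) (fun x => if x = v then {u, v} else {x})
    ?_ ?_ ?_ h
  · intro x y _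
    by_cases hx : x = v
    · rw [if_pos hx]; exact induce_pair_connected_of_adj huv
    · rw [if_neg hx]; exact connected_singleton G x
  · rintro x x' y y' ⟨_, hxu, _, _⟩ ⟨_, hyu, _, _⟩ hxy
    by_cases hx : x = v <;> by_cases hy : y = v
    · exact absurd (hx.trans hy.symm) hxy
    · simp [hx, hy, hyu]
    · simp [hx, hy, hxu]
    · simp [hx, hy, hxy]
  · rintro x y ⟨hxy, hxu, hyu, hadj | ⟨rfl, hadj⟩ | ⟨rfl, hadj⟩⟩
    · refine ⟨x, ?_, y, ?_, hadj⟩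
      · by_cases hx : x = v <;> simp [hx]
      · by_cases hy : y = v <;> simp [hy]
    · exact ⟨u, by simp, y, by simp [hxy.symm], hadj⟩
    · exact ⟨x, by simp [hxy], u, by simp, hadj.symm⟩

lemma ncard_edgeSet_le_contractInto [Finite V] {u v : V} (huv : G.Adj u v) :
    G.edgeSet.ncard ≤
      (contractInto G u v).edgeSet.ncard + ((G.commonNeighbors u v).ncard + 1) := by
  classical
  set B : Set V := (G.neighborSet u \ G.neighborSet v) \ {v} with hB
  have h1 : G.edgeSet ⊆ (G.edgeSet ∩ (contractInto G u v).edgeSet) ∪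
      ((fun y => s(u, y)) '' B ∪ (fun y => s(u, y)) '' insert v (G.commonNeighbors u v)) := by
    have key : ∀ y, G.Adj u y → s(u, y) ∈ (fun y => s(u, y)) '' B ∪
        (fun y => s(u, y)) '' insert v (G.commonNeighbors u v) := by
      intro y hy
      by_cases hyv : y = v
      · exact Or.inr ⟨y, Or.inl hyv, rfl⟩
      · by_cases hvy : G.Adj v y
        · exact Or.inr ⟨y, Or.inr ⟨hy, hvy⟩, rfl⟩
        · exact Or.inl ⟨y, ⟨⟨hy, hvy⟩, hyv⟩, rfl⟩
    intro e he
    induction e using Sym2.ind with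
    | _ x y =>
      rw [mem_edgeSet] at he
      by_cases hx : x = u
      · subst hx; exact Or.inr (key y he)
      by_cases hy : y = u
      · subst hy; rw [Sym2.eq_swap]; exact Or.inr (key x he.symm)
      exact Or.inl ⟨he, he.ne, hx, hy, Or.inl he⟩
  have hinj : ∀ w : V, Function.Injective (fun y => s(w, y)) := fun w a b h =>
    Sym2.congr_right.1 h
  have h2 : (G.edgeSet ∩ (contractInto G u v).edgeSet) ∪ (fun y => s(v, y)) '' B ⊆
      (contractInto G u v).edgeSet := by
    rintro e (he | ⟨y, hy, rfl⟩)
    · exact he.2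
    · have hyu : G.Adj u y := hy.1.1
      exact ⟨fun h => hy.2 h.symm, huv.ne.symm, hyu.ne.symm, Or.inr (Or.inl ⟨rfl, hyu⟩)⟩
  have h3 : Disjoint (G.edgeSet ∩ (contractInto G u v).edgeSet) ((fun y => s(v, y)) '' B) := by
    rw [Set.disjoint_left]
    rintro e he ⟨y, hy, rfl⟩
    exact hy.1.2 he.1
  have h4 := Set.ncard_le_ncard h2 (Set.toFinite _)
  rw [Set.ncard_union_eq h3 (Set.toFinite _) (Set.toFinite _),
    Set.ncard_image_of_injective _ (hinj v)] at h4
  have h5 := Set.ncard_le_ncard h1 (Set.toFinite _)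
  have h6 := Set.ncard_union_le (G.edgeSet ∩ (contractInto G u v).edgeSet)
      ((fun y => s(u, y)) '' B ∪ (fun y => s(u, y)) '' insert v (G.commonNeighbors u v))
  have h7 := Set.ncard_union_le ((fun y => s(u, y)) '' B)
    ((fun y => s(u, y)) '' insert v (G.commonNeighbors u v))
  rw [Set.ncard_image_of_injective _ (hinj u), Set.ncard_image_of_injective _ (hinj u)] at h7
  have h8 := Set.ncard_insert_le v (G.commonNeighbors u v)
  omega

/-- Graphs without a `k`-fat star minor have linearly many edges. -/
theorem ncard_edgeSet_le [Finite V] {k : ℕ} (hk : 0 < k) (S : Finset V) :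
    ∀ G : SimpleGraph V, (∀ x y, G.Adj x y → x ∈ S) → ¬ IsMinor (fatStar k) G →
      G.edgeSet.ncard ≤ (k * (k + 1) + k + 1) * S.card := by
  classical
  induction hn : S.card generalizing S with
  | zero =>
    intro G hS _
    rw [Finset.card_eq_zero] at hn
    subst hn
    have : G.edgeSet = ∅ := by
      ext e
      induction e using Sym2.ind with
      | _ x y => simpa using fun h => by simpa using hS x y h
    simp [this]
  | succ n ih =>
    intro G hS hG
    by_cases hE : ∃ u v, G.Adj u v ∧ (G.commonNeighbors u v).ncard < k * (k + 1) + k + 1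
    · obtain ⟨u, v, huv, hlt⟩ := hE
      have huS : u ∈ S := hS u v huv
      have h1 := ih (S.erase u) (by rw [Finset.card_erase_of_mem huS]; omega)
        (contractInto G u v) ?_ (fun h => hG (isMinor_of_contractInto hk huv h))
      · have h2 := ncard_edgeSet_le_contractInto huv
        calc G.edgeSet.ncard ≤ (k * (k + 1) + k + 1) * n + (k * (k + 1) + k + 1) := by omega
          _ = _ := by ring
      · rintro x y ⟨_, hxu, _, h | ⟨rfl, h⟩ | ⟨rfl, h⟩⟩
        · exact Finset.mem_erase.2 ⟨hxu, hS _ _ h⟩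
        · exact Finset.mem_erase.2 ⟨hxu, hS _ _ huv.symm⟩
        · exact Finset.mem_erase.2 ⟨hxu, hS _ _ h.symm⟩
    · push Not at hE
      by_cases hno : ∃ u v, G.Adj u v
      · exfalso
        obtain ⟨u, v, huv⟩ := hno
        have hdeg : k ≤ (G.neighborSet u).ncard := by
          have := Set.ncard_le_ncard (s := G.commonNeighbors u v) (t := G.neighborSet u)
            Set.inter_subset_left (Set.toFinite _)
          have := hE u v huv
          omega
        obtain ⟨h, hinj, hmem⟩ := exists_injective_of_le_ncard hdeg
        refine hG (isMinor_fatStar_of_points {u} h hinj (connected_singleton G u)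
          (fun i hi => ?_) fun i => ⟨u, rfl, ?_⟩)
        · have hi : h i = u := hi
          exact G.irrefl (v := u) (by have := hmem i; rw [hi] at this; exact this)
        · rw [Set.ncard_singleton]; exact hE _ _ (hmem i)
      · push Not at hno
        have : G.edgeSet = ∅ := by
          ext e
          induction e using Sym2.ind with
          | _ x y => simpa using hno x y
        simp [this]

/-! ### Pairs of vertices with many common neighbours -/

/-- The number of common neighbours that makes a pair of vertices fat. -/
def fatBound (k : ℕ) : ℕ := k * (k + 1) + 3 * k + 1

/-- Two distinct vertices are a fat pair if they have many common neighbours. -/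
def IsFatPair (G : SimpleGraph V) (k : ℕ) (a b : V) : Prop :=
  a ≠ b ∧ fatBound k ≤ (G.commonNeighbors a b).ncard

lemma IsFatPair.symm {k : ℕ} {a b : V} (h : IsFatPair G k a b) : IsFatPair G k b a :=
  ⟨h.1.symm, by rw [commonNeighbors_symm]; exact h.2⟩

/-- The vertices that belong to some fat pair. -/
def fatVerts (G : SimpleGraph V) (k : ℕ) : Set V := {a | ∃ b, IsFatPair G k a b}

/-- The vertices outside `fatVerts` with a neighbour in `fatVerts`. -/
def fatBoundary (G : SimpleGraph V) (k : ℕ) : Set V :=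
  {u | u ∉ fatVerts G k ∧ ∃ a ∈ fatVerts G k, G.Adj u a}

lemma ncard_fatPair_lt [Finite V] {k : ℕ} (hG : ¬ IsMinor (fatStar k) G) (a : V) :
    {b | IsFatPair G k a b}.ncard < k := by
  by_contra hle
  push Not at hle
  obtain ⟨h, hinj, hmem⟩ := exists_injective_of_le_ncard hle
  refine hG (isMinor_fatStar_of_points {a} h hinj (connected_singleton G a)
    (fun i hi => (hmem i).1 hi.symm) fun i => ⟨a, rfl, ?_⟩)
  rw [Set.ncard_singleton]
  have := (hmem i).2
  unfold fatBound at this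
  omega

/-- A large set in which every element conflicts with few others has a large conflict-free
subset. -/
lemma exists_conflict_free {α : Type*} (R : α → α → Prop) (hR : ∀ a b, R a b → R b a) (c : ℕ) :
    ∀ (n : ℕ) (s : Finset α), (∀ a ∈ s, {b | b ∈ s ∧ R a b}.ncard ≤ c) →
      n * (c + 1) ≤ s.card → ∃ t ⊆ s, t.card = n ∧ ∀ a ∈ t, ∀ b ∈ t, a ≠ b → ¬ R a b := by
  classical
  intro n
  induction n with
  | zero => exact fun s _ _ => ⟨∅, by simp, by simp, by simp⟩
  | succ n ih =>
    intro s hs hn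
    have hpos : 0 < s.card := by
      have : 0 < (n + 1) * (c + 1) := by positivity
      omega
    obtain ⟨a, ha⟩ := Finset.card_pos.1 hpos
    set s' := s.filter (fun b => b ≠ a ∧ ¬ R a b) with hs'
    have hcard : n * (c + 1) ≤ s'.card := by
      have h1 : s ⊆ s' ∪ insert a (s.filter (R a)) := by
        intro b hb
        by_cases hba : b = a
        · simp [hba]
        · by_cases hr : R a b <;> simp [hs', hb, hba, hr]
      have h2 := Finset.card_le_card h1
      have h3 := Finset.card_union_le s' (insert a (s.filter (R a)))
      have h4 := Finset.card_insert_le a (s.filter (R a))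
      have h5 := hs a ha
      have h6 : {b | b ∈ s ∧ R a b}.ncard = (s.filter (R a)).card := by
        rw [← Set.ncard_coe_finset]; congr 1; ext; simp
      have : (n + 1) * (c + 1) = n * (c + 1) + (c + 1) := by ring
      omega
    have hfew : ∀ b ∈ s', {x | x ∈ s' ∧ R b x}.ncard ≤ c := fun b hb =>
      (hs b (Finset.filter_subset _ _ hb)).trans' <|
        Set.ncard_le_ncard (fun x hx => ⟨Finset.filter_subset _ _ hx.1, hx.2⟩)
          (s.finite_toSet.subset fun x hx => hx.1)
    obtain ⟨t, hts, htn, ht⟩ := ih s' hfew hcard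
    have hat : a ∉ t := fun h => by simpa [hs'] using hts h
    refine ⟨insert a t, ?_, by simp [hat, htn], ?_⟩
    · refine Finset.insert_subset ha (hts.trans (Finset.filter_subset _ _))
    · have hfree : ∀ b ∈ t, ¬ R a b := fun b hb => (Finset.mem_filter.1 (hts hb)).2.2
      intro x hx y hy hxy
      rcases Finset.mem_insert.1 hx with hxa | hxt
      · rcases Finset.mem_insert.1 hy with hya | hyt
        · exact absurd (hxa.trans hya.symm) hxy
        · exact hxa ▸ hfree y hyt
      · rcases Finset.mem_insert.1 hy with hya | hyt
        · exact fun h => hfree x hxt (hR _ _ (hya ▸ h))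
        · exact ht x hxt y hyt hxy

/-- Only few vertices of fat pairs can be reached from a given vertex, directly or through
vertices in no fat pair. -/
lemma card_arms_lt [Finite V] {k : ℕ} (hG : ¬ IsMinor (fatStar k) G) (v : V) (s : Finset V)
    (u : V → V) (hs : ∀ a ∈ s, a ∈ fatVerts G k ∧
      (u a = v ∨ G.Adj v (u a) ∧ u a ∉ fatVerts G k) ∧ G.Adj (u a) a) :
    s.card < k * (2 * k + 1) + k := by
  classical
  by_contra hle
  push Not at hle
  have hp : ∀ a, ∃ b, a ∈ fatVerts G k → IsFatPair G k a b := by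
    intro a
    by_cases ha : a ∈ fatVerts G k
    · exact ⟨ha.choose, fun _ => ha.choose_spec⟩
    · exact ⟨a, fun h => absurd h ha⟩
  choose p hp using hp
  have hcount : ∀ x, {b | b ∈ s ∧ p b = x}.ncard < k := fun x =>
    lt_of_le_of_lt (Set.ncard_le_ncard (fun b hb => by
      have := (hp b (hs b hb.1).1).symm
      rw [hb.2] at this
      exact this) (Set.toFinite _)) (ncard_fatPair_lt hG x)
  set s' := s.filter (fun a => p a ≠ v) with hs'
  have hcard : k * (2 * k + 1) ≤ s'.card := by
    have h1 := Finset.card_filter_add_card_filter_not (s := s) (fun a => p a = v)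
    have h2 := hcount v
    have h3 : {b | b ∈ s ∧ p b = v}.ncard = (s.filter (fun a => p a = v)).card := by
      rw [← Set.ncard_coe_finset]; congr 1; ext; simp
    change _ + s'.card = _ at h1
    omega
  obtain ⟨t, hts, htk, ht⟩ := exists_conflict_free
    (fun a b => p b = p a ∨ b = p a ∨ p b = a) (fun a b h => by
      rcases h with h | h | h
      · exact Or.inl h.symm
      · exact Or.inr (Or.inr h.symm)
      · exact Or.inr (Or.inl h.symm)) (2 * k) k s' (fun a ha => by
      have h1 : {b | b ∈ s' ∧ (p b = p a ∨ b = p a ∨ p b = a)} ⊆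
          {b | b ∈ s ∧ p b = p a} ∪ ({p a} ∪ {b | b ∈ s ∧ p b = a}) := by
        rintro b ⟨hb, h | h | h⟩
        · exact Or.inl ⟨Finset.filter_subset _ _ hb, h⟩
        · exact Or.inr (Or.inl h)
        · exact Or.inr (Or.inr ⟨Finset.filter_subset _ _ hb, h⟩)
      have h2 := Set.ncard_le_ncard h1 (Set.toFinite _)
      have h3 := Set.ncard_union_le {b | b ∈ s ∧ p b = p a} ({p a} ∪ {b | b ∈ s ∧ p b = a})
      have h4 := Set.ncard_union_le {p a} {b | b ∈ s ∧ p b = a}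
      rw [Set.ncard_singleton] at h4
      have h5 := hcount (p a)
      have h6 := hcount a
      omega) hcard
  have htmem : ∀ a ∈ t, a ∈ s ∧ p a ≠ v := fun a ha => Finset.mem_filter.1 (hts ha)
  have hfat : ∀ a ∈ t, IsFatPair G k a (p a) := fun a ha => hp a (hs a (htmem a ha).1).1
  set D : Finset V := insert v (t.image u ∪ t) with hD
  have hDcard : D.card ≤ 2 * k + 1 := by
    have h1 := Finset.card_insert_le v (t.image u ∪ t)
    have h2 := Finset.card_union_le (t.image u) t
    have h3 := Finset.card_image_le (s := t) (f := u)
    rw [← hD] at h1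
    omega
  let e : Fin k → V := fun i => (t.equivFinOfCardEq htk).symm i
  have he : ∀ i, e i ∈ t := fun i => Subtype.prop _
  have heinj : Function.Injective e := Subtype.val_injective.comp (Equiv.injective _)
  refine hG (isMinor_fatStar_of_points (D : Set V) (fun i => p (e i)) ?_ ?_ ?_ ?_)
  · intro i j hij
    by_contra hne
    exact ht _ (he i) _ (he j) (heinj.ne hne) (Or.inl hij.symm)
  · refine connected_of_rank (u := v) (by simp [hD])
      (fun x => if x = v then 0 else if G.Adj v x then 1 else 2) fun x hx hxv => ?_
    by_cases hadj : G.Adj v x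
    · exact ⟨v, by simp [hD], hadj.symm, by simp [hxv, hadj]⟩
    · simp only [hD, Finset.coe_insert, Finset.coe_union, Finset.coe_image, Set.mem_insert_iff,
        hxv, Set.mem_union, Set.mem_image, Finset.mem_coe, false_or] at hx
      rcases hx with ⟨a, ha, rfl⟩ | hx
      · rcases (hs a (htmem a ha).1).2.1 with h | h
        · exact absurd h hxv
        · exact absurd h.1 hadj
      · obtain ⟨_, h1, h2⟩ := hs x (htmem x hx).1
        have huv : u x ≠ v := fun h => hadj (h ▸ h2)
        refine ⟨u x, ?_, h2.symm, ?_⟩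
        · simp only [hD, Finset.coe_insert, Finset.coe_union, Finset.coe_image]
          exact Or.inr (Or.inl ⟨x, hx, rfl⟩)
        · simp [hxv, hadj, huv, (h1.resolve_left huv).1]
  · intro i hi
    simp only [hD, Finset.coe_insert, Finset.coe_union, Finset.coe_image, Set.mem_insert_iff,
      Set.mem_union, Set.mem_image, Finset.mem_coe] at hi
    rcases hi with hi | ⟨a, ha, hi⟩ | hi
    · exact (htmem _ (he i)).2 hi
    · rcases (hs a (htmem a ha).1).2.1 with h | h
      · exact (htmem _ (he i)).2 (hi.symm.trans h)
      · exact h.2 (hi ▸ ⟨e i, (hfat _ (he i)).symm⟩)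
    · exact ht _ (he i) _ hi (hfat _ (he i)).1 (Or.inr (Or.inl rfl))
  · refine fun i => ⟨e i, ?_, ?_⟩
    · simp only [hD, Finset.coe_insert, Finset.coe_union]
      exact Or.inr (Or.inr (he i))
    · rw [Set.ncard_coe_finset]
      have := (hfat _ (he i)).2
      unfold fatBound at this
      omega

/-- A bound on the number of vertices of fat pairs near any given vertex. -/
def armBound (k : ℕ) : ℕ := k * (2 * k + 1) + k

lemma ncard_neighborSet_inter_fatVerts_le [Finite V] {k : ℕ} (hG : ¬ IsMinor (fatStar k) G)
    (v : V) : (G.neighborSet v ∩ fatVerts G k).ncard ≤ armBound k := by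
  rw [Set.ncard_eq_toFinset_card _ (Set.toFinite _)]
  refine (card_arms_lt hG v _ (fun _ => v) fun a ha => ?_).le
  have ha := (Set.Finite.mem_toFinset _).1 ha
  exact ⟨ha.2, Or.inl rfl, ha.1⟩

lemma ncard_neighborSet_inter_fatBoundary_le [Finite V] {k : ℕ} (hG : ¬ IsMinor (fatStar k) G)
    {v : V} (hv : v ∉ fatVerts G k) :
    (G.neighborSet v ∩ fatBoundary G k).ncard ≤ fatBound k * armBound k := by
  classical
  rw [Set.ncard_eq_toFinset_card _ (Set.toFinite _)]
  set T := (Set.toFinite (G.neighborSet v ∩ fatBoundary G k)).toFinset with hT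
  have hTmem : ∀ x, x ∈ T ↔ G.Adj v x ∧ x ∈ fatBoundary G k := fun x => by
    rw [hT, Set.Finite.mem_toFinset]; rfl
  have hpick : ∀ x, ∃ a, x ∈ T → a ∈ fatVerts G k ∧ G.Adj x a := by
    intro x
    by_cases hx : x ∈ T
    · obtain ⟨a, ha⟩ := ((hTmem x).1 hx).2.2
      exact ⟨a, fun _ => ha⟩
    · exact ⟨x, fun h => absurd h hx⟩
  choose a ha using hpick
  have hback : ∀ b, ∃ x, b ∈ T.image a → x ∈ T ∧ a x = b := by
    intro b
    by_cases hb : b ∈ T.image a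
    · obtain ⟨x, hx⟩ := Finset.mem_image.1 hb
      exact ⟨x, fun _ => hx⟩
    · exact ⟨b, fun h => absurd h hb⟩
  choose u hu using hback
  refine (Finset.card_le_mul_card_image (f := a) T (fatBound k) fun b hb => ?_).trans
    (Nat.mul_le_mul_left _ (card_arms_lt hG v _ u fun b hb => ?_).le)
  · by_contra hlt
    push Not at hlt
    obtain ⟨hx, hxb⟩ := hu b hb
    have hbfat : b ∈ fatVerts G k := hxb ▸ (ha _ hx).1
    refine hv ⟨b, fun h => hv (h ▸ hbfat), hlt.le.trans ?_⟩
    rw [← Set.ncard_coe_finset]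
    refine Set.ncard_le_ncard (fun y hy => ?_) (Set.toFinite _)
    have hy := Finset.mem_filter.1 (Finset.mem_coe.1 hy)
    exact ⟨((hTmem y).1 hy.1).1, by have := (ha y hy.1).2; rw [hy.2] at this; exact this.symm⟩
  · obtain ⟨hx, hxb⟩ := hu b hb
    have h := ha _ hx
    rw [hxb] at h
    exact ⟨h.1, Or.inr ⟨((hTmem _).1 hx).1, ((hTmem _).1 hx).2.1⟩, h.2⟩

/-! ### Graphs without fat pairs -/

/-- The density bound for graphs without a `k`-fat star minor. -/
def densityBound (k : ℕ) : ℕ := k * (k + 1) + k + 1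

/-- The degree above which a vertex counts as having high degree. -/
def lightBound (k : ℕ) : ℕ :=
  2 * (densityBound k * (1 + fatBound k * densityBound k))

/-- In a graph without fat pairs and without a fat star minor it is impossible that every
non-isolated vertex of low degree has at least two neighbours and only neighbours of high
degree. -/
lemma false_of_low_degree_sparse [Finite V] {k : ℕ} (hk : 0 < k)
    (hG : ¬ IsMinor (fatStar k) G)
    (hfat : ∀ a b, a ≠ b → (G.commonNeighbors a b).ncard < fatBound k)
    (htwo : ∀ v w, G.Adj v w → (G.neighborSet v).ncard ≤ lightBound k →
      2 ≤ (G.neighborSet v).ncard)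
    (hhigh : ∀ v w, G.Adj v w → (G.neighborSet v).ncard ≤ lightBound k →
      lightBound k < (G.neighborSet w).ncard)
    {x y : V} (hxy : G.Adj x y) : False := by
  classical
  have := Fintype.ofFinite V
  set h : Finset V := Finset.univ.filter fun v => lightBound k < (G.neighborSet v).ncard with hh
  set L : Finset V := Finset.univ.filter fun v =>
    (G.neighborSet v).ncard ≤ lightBound k ∧ ∃ w, G.Adj v w with hL
  have hmem : ∀ v, v ∈ h ↔ lightBound k < (G.neighborSet v).ncard := fun v => by simp [hh]
  have hLmem : ∀ v, v ∈ L ↔ (G.neighborSet v).ncard ≤ lightBound k ∧ ∃ w, G.Adj v w :=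
    fun v => by simp [hL]
  have hpos : 0 < h.card := by
    rw [Finset.card_pos]
    by_cases hx : lightBound k < (G.neighborSet x).ncard
    · exact ⟨x, (hmem x).2 hx⟩
    · exact ⟨y, (hmem y).2 (hhigh x y hxy (not_lt.1 hx))⟩
  have hdeg : ∀ v, (G.neighborSet v).ncard = G.degree v := fun v => by
    rw [Set.ncard_eq_toFinset_card']; rfl
  have hedges : (lightBound k + 1) * h.card ≤ 2 * (densityBound k * (h.card + L.card)) := by
    have h1 : G.edgeSet.ncard ≤ densityBound k * (h ∪ L).card :=
      ncard_edgeSet_le hk (h ∪ L) G (fun v w hvw => by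
        by_cases hv : lightBound k < (G.neighborSet v).ncard
        · exact Finset.mem_union_left _ ((hmem v).2 hv)
        · exact Finset.mem_union_right _ ((hLmem v).2 ⟨not_lt.1 hv, w, hvw⟩)) hG
    have h2 : G.edgeSet.ncard = G.edgeFinset.card := by
      rw [Set.ncard_eq_toFinset_card']; rfl
    have h3 := G.sum_degrees_eq_twice_card_edges
    have h4 : h.card * (lightBound k + 1) ≤ ∑ v ∈ h, G.degree v := by
      rw [← smul_eq_mul]
      refine Finset.card_nsmul_le_sum _ _ _ fun v hv => ?_
      rw [← hdeg]; exact (hmem v).1 hv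
    have h5 : ∑ v ∈ h, G.degree v ≤ ∑ v, G.degree v :=
      Finset.sum_le_sum_of_subset (Finset.subset_univ _)
    have h6 : densityBound k * (h ∪ L).card ≤ densityBound k * (h.card + L.card) :=
      Nat.mul_le_mul_left _ (Finset.card_union_le _ _)
    rw [mul_comm]
    omega
  have hpick : ∀ v, ∃ a b, v ∈ L → a ≠ b ∧ G.Adj v a ∧ G.Adj v b := by
    intro v
    by_cases hv : v ∈ L
    · obtain ⟨hle, w, hw⟩ := (hLmem v).1 hv
      obtain ⟨a, b, ha, hb, hab⟩ := (Set.one_lt_ncard_iff (Set.toFinite _)).1 (htwo v w hw hle)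
      exact ⟨a, b, fun _ => ⟨hab, ha, hb⟩⟩
    · exact ⟨v, v, fun h => absurd h hv⟩
  choose a b hab using hpick
  have hLh : ∀ v ∈ L, ∀ w, G.Adj v w → w ∈ h := fun v hv w hw =>
    (hmem w).2 (hhigh v w hw ((hLmem v).1 hv).1)
  have hnot : ∀ v ∈ L, v ∉ h := fun v hv hv' =>
    absurd ((hmem v).1 hv') (not_lt.2 ((hLmem v).1 hv).1)
  set P : Finset (Sym2 V) := L.image fun v => s(a v, b v) with hP
  have hLP : L.card ≤ fatBound k * P.card := by
    refine Finset.card_le_mul_card_image L (fatBound k) fun e he => ?_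
    obtain ⟨v, hv, rfl⟩ := Finset.mem_image.1 he
    refine le_trans ?_ (hfat (a v) (b v) (hab v hv).1).le
    rw [← Set.ncard_coe_finset]
    refine Set.ncard_le_ncard (fun w hw => ?_) (Set.toFinite _)
    obtain ⟨hwL, hw⟩ := Finset.mem_filter.1 (Finset.mem_coe.1 hw)
    obtain ⟨-, h1, h2⟩ := hab w hwL
    rcases Sym2.eq_iff.1 hw with ⟨e1, e2⟩ | ⟨e1, e2⟩
    · exact ⟨e1 ▸ h1.symm, e2 ▸ h2.symm⟩
    · exact ⟨e2 ▸ h2.symm, e1 ▸ h1.symm⟩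
  set M : SimpleGraph V := fromEdgeSet (P : Set (Sym2 V)) with hM
  have hMadj : ∀ c d, M.Adj c d → ∃ v ∈ L, s(a v, b v) = s(c, d) := fun c d hcd => by
    rw [hM, fromEdgeSet_adj] at hcd
    exact Finset.mem_image.1 (Finset.mem_coe.1 hcd.1)
  have hMh : ∀ c d, M.Adj c d → c ∈ h := fun c d hcd => by
    obtain ⟨v, hv, hcd⟩ := hMadj c d hcd
    rcases Sym2.eq_iff.1 hcd with ⟨e1, -⟩ | ⟨-, e2⟩
    · exact e1 ▸ hLh v hv _ (hab v hv).2.1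
    · exact e2 ▸ hLh v hv _ (hab v hv).2.2
  have hMedges : M.edgeSet = (P : Set (Sym2 V)) := by
    rw [hM, edgeSet_fromEdgeSet, sdiff_eq_left, Set.disjoint_left]
    intro e he hdiag
    obtain ⟨v, hv, rfl⟩ := Finset.mem_image.1 (Finset.mem_coe.1 he)
    exact (hab v hv).1 (by simpa using hdiag)
  have hMminor : ¬ IsMinor (fatStar k) M := by
    refine fun hm => hG (isMinor_trans (fatStar_no_isolated hk)
      (fun c => insert c {v | v ∈ L ∧ a v = c}) ?_ ?_ ?_ hm)
    · intro c d _
      refine connected_of_rank (Set.mem_insert c _) (fun v => if v = c then 0 else 1)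
        fun v hv hvc => ⟨c, Set.mem_insert c _, ?_, by simp [hvc]⟩
      obtain ⟨hvL, hv⟩ := hv.resolve_left hvc
      exact hv ▸ (hab v hvL).2.1
    · intro c c' d d' hc hd hcd
      have hch := hMh c c' hc
      have hdh := hMh d d' hd
      rw [Set.disjoint_left]
      rintro v (rfl | ⟨hv, hvc⟩) (hvd | ⟨hv', hvd⟩)
      · exact hcd hvd
      · exact hnot v hv' hch
      · exact hnot v hv (hvd ▸ hdh)
      · exact hcd (hvc.symm.trans hvd)
    · intro c d hcd
      obtain ⟨v, hv, hcd⟩ := hMadj c d hcd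
      obtain ⟨-, h1, h2⟩ := hab v hv
      rcases Sym2.eq_iff.1 hcd with ⟨e1, e2⟩ | ⟨e1, e2⟩
      · exact ⟨v, Or.inr ⟨hv, e1⟩, d, Or.inl rfl, e2 ▸ h2⟩
      · exact ⟨c, Or.inl rfl, v, Or.inr ⟨hv, e1⟩, e2 ▸ h2.symm⟩
  have hPcard : P.card ≤ densityBound k * h.card := by
    have := ncard_edgeSet_le hk h M hMh hMminor
    rwa [hMedges, Set.ncard_coe_finset] at this
  have hLcard : L.card ≤ fatBound k * (densityBound k * h.card) :=
    hLP.trans (Nat.mul_le_mul_left _ hPcard)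
  have h1 : densityBound k * (h.card + L.card) ≤
      densityBound k * (h.card + fatBound k * (densityBound k * h.card)) :=
    Nat.mul_le_mul_left _ (Nat.add_le_add_left hLcard _)
  have h2 : (lightBound k + 1) * h.card =
      2 * (densityBound k * (h.card + fatBound k * (densityBound k * h.card))) + h.card := by
    unfold lightBound; ring
  omega

/-- A graph without fat pairs and without a fat star minor has a 2-colouring that extends a
constant precolouring of `B`, such that each vertex has boundedly many neighbours of its own
colour outside `B`. -/
theorem exists_colouring_of_no_fatPair [Finite V] {k : ℕ} (hk : 0 < k) (B : Set V) (n : ℕ) :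
    ∀ G : SimpleGraph V, G.edgeSet.ncard = n → ¬ IsMinor (fatStar k) G →
      (∀ a b, a ≠ b → (G.commonNeighbors a b).ncard < fatBound k) →
      ∃ f : V → Bool, (∀ b ∈ B, f b = true) ∧
        ∀ v, {u | u ∉ B ∧ G.Adj v u ∧ f u = f v}.ncard ≤ lightBound k := by
  classical
  induction n with
  | zero =>
    intro G hn _ _
    have hE : G.edgeSet = ∅ := (Set.ncard_eq_zero (Set.toFinite _)).1 hn
    refine ⟨fun _ => true, fun _ _ => rfl, fun v => ?_⟩
    have : {u | u ∉ B ∧ G.Adj v u ∧ true = true} = ∅ := by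
      ext u
      have : s(v, u) ∉ G.edgeSet := by simp [hE]
      simpa using fun _ => this
    rw [this]; simp
  | succ n ih =>
    intro G hn hG hfat
    have hdel : ∀ u v, G.Adj u v → ∃ f : V → Bool, (∀ b ∈ B, f b = true) ∧
        ∀ w, {x | x ∉ B ∧ (G.deleteEdges {s(u, v)}).Adj w x ∧ f x = f w}.ncard
          ≤ lightBound k := by
      intro u v huv
      have hle : G.deleteEdges {s(u, v)} ≤ G := deleteEdges_le _
      refine ih _ ?_ (fun h => hG (isMinor_mono hle h)) fun a b hab =>
        (hfat a b hab).trans_le' <|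
          Set.ncard_le_ncard (fun x hx => ⟨hle hx.1, hle hx.2⟩) (Set.toFinite _)
      rw [edgeSet_deleteEdges, Set.ncard_sdiff_singleton_of_mem (by simpa using huv), hn]
      rfl
    have hdeg : ∀ (f : V → Bool) v, {u | u ∉ B ∧ G.Adj v u ∧ f u = f v}.ncard ≤
        (G.neighborSet v).ncard := fun f v =>
      Set.ncard_le_ncard (fun x hx => hx.2.1) (Set.toFinite _)
    by_cases hlight : ∃ u v, G.Adj u v ∧ (G.neighborSet v).ncard ≤ lightBound k ∧
        ((G.neighborSet u).ncard ≤ lightBound k ∨ v ∈ B)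
    · obtain ⟨u, v, huv, hv, hu⟩ := hlight
      obtain ⟨f, hfB, hf⟩ := hdel u v huv
      refine ⟨f, hfB, fun w => ?_⟩
      by_cases hwv : w = v
      · exact (hdeg f w).trans (hwv ▸ hv)
      by_cases hwu : w = u ∧ (G.neighborSet u).ncard ≤ lightBound k
      · exact (hdeg f w).trans (hwu.1 ▸ hwu.2)
      refine (hf w).trans' (Set.ncard_le_ncard (fun x hx => ⟨hx.1, ?_, hx.2.2⟩) (Set.toFinite _))
      rw [deleteEdges_adj]
      refine ⟨hx.2.1, fun he => ?_⟩
      rcases Sym2.eq_iff.1 he with ⟨e1, e2⟩ | ⟨e1, e2⟩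
      · rcases hu with hu | hu
        · exact hwu ⟨e1, hu⟩
        · exact hx.1 (e2 ▸ hu)
      · exact hwv e1
    · push Not at hlight
      by_cases hone : ∃ u w, u ∉ B ∧ G.neighborSet u = {w}
      · obtain ⟨u, w, huB, huw⟩ := hone
        have hadj : ∀ x, G.Adj u x ↔ x = w := fun x => by
          rw [← mem_neighborSet, huw, Set.mem_singleton_iff]
        obtain ⟨f, hfB, hf⟩ := hdel u w ((hadj w).2 rfl)
        have hne : u ≠ w := ((hadj w).2 rfl).ne
        refine ⟨Function.update f u (!f w), fun b hb => ?_, fun x => ?_⟩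
        · rw [Function.update_of_ne (ne_of_mem_of_not_mem hb huB)]; exact hfB b hb
        by_cases hxu : x = u
        · have : {y | y ∉ B ∧ G.Adj x y ∧ Function.update f u (!f w) y =
              Function.update f u (!f w) x} = ∅ := by
            ext y
            simp only [Set.mem_ofPred_eq, Set.mem_empty_iff_false, iff_false, not_and]
            intro _ hxy
            rw [hxu, hadj] at hxy
            rw [hxu, hxy, Function.update_of_ne hne.symm, Function.update_self]
            simp
          rw [this]; simp
        · refine le_trans (Set.ncard_le_ncard (fun y hy => ?_) (Set.toFinite _)) (hf x)
          obtain ⟨hyB, hxy, hcol⟩ := hy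
          rw [Function.update_of_ne hxu] at hcol
          have hyu : y ≠ u := by
            rintro rfl
            have hxw : x = w := (hadj x).1 hxy.symm
            rw [Function.update_self, hxw] at hcol
            simp at hcol
          rw [Function.update_of_ne hyu] at hcol
          refine ⟨hyB, ?_, hcol⟩
          rw [deleteEdges_adj]
          refine ⟨hxy, fun he => ?_⟩
          rcases Sym2.eq_iff.1 he with ⟨e1, e2⟩ | ⟨e1, e2⟩
          · exact hxu e1
          · exact hyu e2
      · push Not at hone
        exfalso
        obtain ⟨e, he⟩ : G.edgeSet.Nonempty := by
          rw [Set.nonempty_iff_ne_empty]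
          intro h
          rw [h, Set.ncard_empty] at hn
          omega
        induction e using Sym2.ind with
        | _ x y =>
          refine false_of_low_degree_sparse hk hG hfat (fun v w hvw hv => ?_)
            (fun v w hvw hv => (hlight w v hvw.symm hv).1) he
          by_contra hlt
          have hpos : 0 < (G.neighborSet v).ncard :=
            (Set.ncard_pos (Set.toFinite _)).2 ⟨w, hvw⟩
          obtain ⟨z, hz⟩ := Set.ncard_eq_one.1 (show (G.neighborSet v).ncard = 1 by omega)
          exact hone v z (hlight w v hvw.symm hv).2 hz

/-! ### A defective colouring with two colours -/

/-- The monochromatic degree of the defective colouring. -/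
def defectBound (k : ℕ) : ℕ := lightBound k + (fatBound k * armBound k + armBound k)

/-- A graph without a fat star minor has a 2-colouring of bounded monochromatic degree. -/
theorem exists_defective_colouring [Finite V] {k : ℕ} (hk : 0 < k)
    (hG : ¬ IsMinor (fatStar k) G) :
    ∃ f : V → Bool, ∀ v, {u | G.Adj v u ∧ f u = f v}.ncard ≤ defectBound k := by
  classical
  set A := fatVerts G k with hA
  set B := fatBoundary G k with hB
  let G₀ : SimpleGraph V :=
    { Adj := fun x y => G.Adj x y ∧ x ∉ A ∧ y ∉ A
      symm := ⟨fun x y h => ⟨h.1.symm, h.2.2, h.2.1⟩⟩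
      loopless := ⟨fun x h => G.irrefl h.1⟩ }
  have hle : G₀ ≤ G := fun x y h => h.1
  obtain ⟨f, hfB, hf⟩ := exists_colouring_of_no_fatPair hk B _ G₀ rfl
    (fun h => hG (isMinor_mono hle h)) (fun a b hab => by
      by_contra hge
      push Not at hge
      have ha : a ∈ A := ⟨b, hab, hge.trans
        (Set.ncard_le_ncard (fun x hx => ⟨hle hx.1, hle hx.2⟩) (Set.toFinite _))⟩
      have hempty : G₀.commonNeighbors a b = ∅ :=
        Set.eq_empty_iff_forall_notMem.2 fun x hx => hx.1.2.1 ha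
      rw [hempty, Set.ncard_empty] at hge
      unfold fatBound at hge
      omega)
  refine ⟨fun v => if v ∈ A then false else f v, fun v => ?_⟩
  beta_reduce
  have hvA := ncard_neighborSet_inter_fatVerts_le hG v
  rw [← hA] at hvA
  by_cases hv : v ∈ A
  · refine le_trans (Set.ncard_le_ncard (fun u hu => ?_) (Set.toFinite _))
      (hvA.trans (by unfold defectBound; omega))
    refine ⟨hu.1, by_contra fun huA => ?_⟩
    have hcol := hu.2
    rw [if_neg huA, if_pos hv, hfB u ⟨huA, v, hv, hu.1.symm⟩] at hcol
    exact absurd hcol (by simp)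
  · have hsub : {u | G.Adj v u ∧ (if u ∈ A then false else f u) = if v ∈ A then false else f v} ⊆
        {u | u ∉ B ∧ G₀.Adj v u ∧ f u = f v} ∪
          ((G.neighborSet v ∩ B) ∪ (G.neighborSet v ∩ A)) := by
      rintro u ⟨huv, hcol⟩
      by_cases huA : u ∈ A
      · exact Or.inr (Or.inr ⟨huv, huA⟩)
      by_cases huB : u ∈ B
      · exact Or.inr (Or.inl ⟨huv, huB⟩)
      rw [if_neg huA, if_neg hv] at hcol
      exact Or.inl ⟨huB, ⟨huv, hv, huA⟩, hcol⟩
    have h1 := Set.ncard_le_ncard hsub (Set.toFinite _)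
    have h2 := Set.ncard_union_le {u | u ∉ B ∧ G₀.Adj v u ∧ f u = f v}
      ((G.neighborSet v ∩ B) ∪ (G.neighborSet v ∩ A))
    have h3 := Set.ncard_union_le (G.neighborSet v ∩ B) (G.neighborSet v ∩ A)
    have h4 := hf v
    have h5 := ncard_neighborSet_inter_fatBoundary_le hG hv
    rw [← hB] at h5
    unfold defectBound
    omega

/-! ### Graphs of bounded degree -/

lemma exists_adj_dist_eq {u v : V} {n : ℕ} (h : G.dist u v = n + 1) :
    ∃ w, G.Adj v w ∧ G.dist u w = n := by
  have hr : G.Reachable u v := Reachable.of_dist_ne_zero (by omega)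
  obtain ⟨p, hp⟩ := hr.symm.exists_walk_length_eq_dist
  rw [dist_comm, h] at hp
  cases p with
  | nil => simp at hp
  | @cons _ w _ hadj q =>
    refine ⟨w, hadj, le_antisymm ?_ ?_⟩
    · rw [dist_comm]
      refine (dist_le q).trans ?_
      rw [Walk.length_cons] at hp
      omega
    · have h1 := hadj.symm.reachable.dist_triangle_right u
      rw [dist_eq_one_iff_adj.2 hadj.symm] at h1
      omega

/-- A large connected graph of bounded degree contains a long path. -/
lemma exists_long_path [Finite V] (hG : G.Connected) {d n : ℕ}
    (hd : ∀ v, (G.neighborSet v).ncard ≤ d) (hn : (d + 1) ^ n < Nat.card V) :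
    ∃ q : ℕ → V, (∀ j < n, G.Adj (q j) (q (j + 1))) ∧ Set.InjOn q {j | j ≤ n} := by
  classical
  obtain ⟨u⟩ := hG.nonempty
  have hball : ∀ r, {v | G.dist u v ≤ r}.ncard ≤ (d + 1) ^ r := by
    intro r
    induction r with
    | zero =>
      have : {v | G.dist u v ≤ 0} ⊆ {u} := fun v hv => by
        have hv : G.dist u v ≤ 0 := hv
        exact ((hG.preconnected u v).dist_eq_zero_iff.1 (by omega)).symm
      simpa using Set.ncard_le_ncard this
    | succ r ih =>
      set S := (Set.toFinite {v | G.dist u v ≤ r}).toFinset with hS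
      have hsub : {v | G.dist u v ≤ r + 1} ⊆
          ((S ∪ S.biUnion fun w => (Set.toFinite (G.neighborSet w)).toFinset : Finset V) :
            Set V) := by
        intro v hv
        have hv : G.dist u v ≤ r + 1 := hv
        rw [Finset.mem_coe, Finset.mem_union]
        by_cases hle : G.dist u v ≤ r
        · exact Or.inl ((Set.Finite.mem_toFinset _).2 hle)
        · obtain ⟨w, hw, hdw⟩ := exists_adj_dist_eq (show G.dist u v = r + 1 by omega)
          refine Or.inr (Finset.mem_biUnion.2 ⟨w, (Set.Finite.mem_toFinset _).2 hdw.le, ?_⟩)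
          exact (Set.Finite.mem_toFinset _).2 hw.symm
      have h1 := Set.ncard_le_ncard hsub (Set.toFinite _)
      rw [Set.ncard_coe_finset] at h1
      have h2 := Finset.card_union_le S
        (S.biUnion fun w => (Set.toFinite (G.neighborSet w)).toFinset)
      have h3 := Finset.card_biUnion_le_card_mul S
        (fun w => (Set.toFinite (G.neighborSet w)).toFinset) d fun w _ => by
          rw [← Set.ncard_eq_toFinset_card]; exact hd w
      rw [Set.ncard_eq_toFinset_card _ (Set.toFinite _), ← hS] at ih
      calc _ ≤ S.card * (d + 1) := by rw [mul_add, mul_one]; omega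
        _ ≤ (d + 1) ^ r * (d + 1) := Nat.mul_le_mul_right _ ih
        _ = _ := (pow_succ _ _).symm
  obtain ⟨v, hv⟩ : ∃ v, n < G.dist u v := by
    by_contra hno
    push Not at hno
    have : {v | G.dist u v ≤ n} = Set.univ := Set.eq_univ_of_forall hno
    have h1 := hball n
    rw [this, Set.ncard_univ] at h1
    omega
  obtain ⟨p, hp⟩ := (hG.preconnected u v).exists_walk_length_eq_dist
  refine ⟨p.getVert, fun j hj => p.adj_getVert_succ (by omega), ?_⟩
  refine (p.isPath_of_length_eq_dist hp).getVert_injOn.mono fun j hj => ?_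
  have hj : j ≤ n := hj
  exact (by omega : j ≤ p.length)

lemma connected_image_Icc {q : ℕ → V} {a n : ℕ}
    (h : ∀ j, a ≤ j → j < a + n → G.Adj (q j) (q (j + 1))) :
    (G.induce (q '' Set.Icc a (a + n))).Connected := by
  induction n with
  | zero =>
    rw [add_zero, Set.Icc_self, Set.image_singleton]
    exact connected_singleton G (q a)
  | succ n ih =>
    have : q '' Set.Icc a (a + (n + 1)) = q '' Set.Icc a (a + n) ∪ {q (a + n + 1)} := by
      rw [← Set.image_singleton, ← Set.image_union]
      congr 1
      ext j
      simp only [Set.mem_Icc, Set.mem_union, Set.mem_singleton_iff]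
      omega
    rw [this]
    exact connected_union (ih fun j h1 h2 => h j h1 (by omega)) (connected_singleton G _)
      ⟨a + n, ⟨by omega, le_rfl⟩, rfl⟩ rfl (h (a + n) (by omega) (by omega))

/-- The size of the parts of the layered colouring. -/
def layerBound (k d : ℕ) : ℕ := (d + 1) ^ (k * (d * (k * (k + 1)) + 1)) + (d + 1)

/-- A graph of bounded degree without a fat star minor has a 2-colouring with bounded
clustering. -/
theorem exists_clustered_colouring_of_degree_le [Finite V] {k d : ℕ}
    (hG : ¬ IsMinor (fatStar k) G) (hd : ∀ v, (G.neighborSet v).ncard ≤ d) :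
    ∃ g : V → Bool, ∀ K : Set V, (G.induce K).Connected → (∀ x ∈ K, ∀ y ∈ K, g x = g y) →
      K.ncard ≤ layerBound k d := by
  classical
  let r : V → V := fun v => (G.connectedComponentMk v).out
  let δ : V → ℕ := fun v => G.dist (r v) v
  have hr : ∀ v, G.Reachable (r v) v := fun v =>
    ConnectedComponent.exact (Quot.out_eq _)
  have hradj : ∀ x y, G.Adj x y → r x = r y := fun x y h => by
    simp only [r, ConnectedComponent.sound h.reachable]
  have hδadj : ∀ x y, G.Adj x y → δ y ≤ δ x + 1 := fun x y h => by
    have h1 := h.reachable.dist_triangle_right (r x)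
    rw [dist_eq_one_iff_adj.2 h] at h1
    simpa only [δ, ← hradj x y h] using h1
  have hpar : ∀ v n, δ v = n + 1 → ∃ w, G.Adj v w ∧ r w = r v ∧ δ w = n := fun v n h => by
    obtain ⟨w, hw, hdw⟩ := exists_adj_dist_eq h
    exact ⟨w, hw, (hradj v w hw).symm, by simpa only [δ, ← hradj v w hw] using hdw⟩
  have hzero : ∀ v, δ v = 0 → v = r v := fun v h => ((hr v).dist_eq_zero_iff.1 h).symm
  refine ⟨fun v => decide (δ v % 2 = 0), fun K hK hcol => ?_⟩
  by_contra hbig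
  push Not at hbig
  unfold layerBound at hbig
  obtain ⟨x₀, hx₀⟩ := connected_nonempty hK
  have hlayer : ∀ x ∈ K, r x = r x₀ ∧ δ x = δ x₀ := fun x hx => by
    refine connected_propagate hK (fun x => r x = r x₀ ∧ δ x = δ x₀) (fun x hx y hy hxy h => ?_)
      hx₀ hx ⟨rfl, rfl⟩
    refine ⟨(hradj x y hxy).symm.trans h.1, ?_⟩
    have h1 := hδadj x y hxy
    have h2 := hδadj y x hxy.symm
    have h3 := hcol x hx y hy
    simp only [decide_eq_decide] at h3
    omega
  obtain ⟨i, hi⟩ : ∃ i, δ x₀ = i + 2 := by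
    refine ⟨δ x₀ - 2, ?_⟩
    by_contra hne
    have hsmall : δ x₀ = 0 ∨ δ x₀ = 1 := by omega
    rcases hsmall with h | h
    · have : K ⊆ {r x₀} := fun x hx => by
        obtain ⟨h1, h2⟩ := hlayer x hx
        exact (hzero x (h2.trans h)).trans h1
      have := Set.ncard_le_ncard this
      rw [Set.ncard_singleton] at this
      omega
    · have : K ⊆ G.neighborSet (r x₀) := fun x hx => by
        obtain ⟨h1, h2⟩ := hlayer x hx
        obtain ⟨w, hw, hrw, hdw⟩ := hpar x 0 (h2.trans h)
        rw [mem_neighborSet, ← h1, ← hrw, ← hzero w hdw]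
        exact hw.symm
      have := Set.ncard_le_ncard this (Set.toFinite _)
      have := hd (r x₀)
      omega
  set t := d * (k * (k + 1)) with ht
  obtain ⟨q, hqadj, hqinj⟩ := exists_long_path hK (d := d) (n := k * (t + 1)) (fun v => by
    refine le_trans ?_ (hd v.1)
    rw [← Set.ncard_image_of_injective _ Subtype.val_injective]
    refine Set.ncard_le_ncard ?_ (Set.toFinite _)
    rintro _ ⟨w, hw, rfl⟩
    exact hw) (by rw [Nat.card_coe_set_eq]; omega)
  let Q : ℕ → V := fun j => q j
  have hQK : ∀ j, Q j ∈ K := fun j => (q j).2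
  let hub : Fin k → Set V := fun a => Q '' Set.Icc (a * (t + 1)) (a * (t + 1) + t)
  have hlt : ∀ (a : Fin k) j, j ∈ Set.Icc (a * (t + 1)) (a * (t + 1) + t) →
      j < k * (t + 1) := fun a j hj => by
    have h1 : ((a : ℕ) + 1) * (t + 1) ≤ k * (t + 1) := Nat.mul_le_mul_right _ a.2
    have h2 := hj.2
    rw [add_mul] at h1
    omega
  have hQinj : ∀ j j', j < k * (t + 1) → j' < k * (t + 1) → Q j = Q j' → j = j' :=
    fun j j' hj hj' h => hqinj hj.le hj'.le (Subtype.ext h)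
  have hhubK : ∀ a, hub a ⊆ K := by
    rintro a _ ⟨j, -, rfl⟩
    exact hQK j
  have hhub : ∀ a, ∀ x ∈ hub a, r x = r x₀ ∧ δ x = i + 2 := fun a x hx =>
    hi ▸ hlayer x (hhubK a hx)
  have hpar' : ∀ v, ∃ w, δ v = i + 2 → G.Adj v w ∧ r w = r v ∧ δ w = i + 1 := fun v => by
    by_cases h : δ v = i + 2
    · obtain ⟨w, hw⟩ := hpar v (i + 1) h
      exact ⟨w, fun _ => hw⟩
    · exact ⟨v, fun h' => absurd h' h⟩
  choose par hparent using hpar'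
  refine hG (isMinor_fatStar_of_hubs {x | r x = r x₀ ∧ δ x ≤ i} hub ?_ ?_ ?_ ?_ ?_)
  · have hroot : r (r x₀) = r x₀ := by
      simp only [r]
      congr 1
      exact Quot.out_eq _
    refine connected_of_rank (u := r x₀) ⟨hroot, ?_⟩ δ fun v hv hne => ?_
    · simp only [δ, hroot, dist_self]; omega
    · have hpos : δ v ≠ 0 := fun h => hne ((hzero v h).trans hv.1)
      obtain ⟨n, hn⟩ := Nat.exists_eq_succ_of_ne_zero hpos
      obtain ⟨w, hw, hrw, hdw⟩ := hpar v n hn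
      have := hv.2
      exact ⟨w, ⟨hrw.trans hv.1, by omega⟩, hw, by omega⟩
  · refine fun a => connected_image_Icc fun j h1 h2 => hqadj j ?_
    exact hlt a j ⟨h1, h2.le⟩
  · intro a b hab
    refine Set.disjoint_left.2 ?_
    rintro _ ⟨j, hj, rfl⟩ ⟨j', hj', he⟩
    obtain rfl := hQinj _ _ (hlt b _ hj') (hlt a _ hj) he
    refine hab (Fin.ext ?_)
    have h1 : (a : ℕ) = j' / (t + 1) := by
      symm
      refine Nat.div_eq_of_lt_le hj.1 ?_
      have := hj.2
      rw [add_mul]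
      omega
    have h2 : (b : ℕ) = j' / (t + 1) := by
      symm
      refine Nat.div_eq_of_lt_le hj'.1 ?_
      have := hj'.2
      rw [add_mul]
      omega
    rw [h1, h2]
  · refine fun a => Set.disjoint_left.2 fun x hx hx' => ?_
    have := (hhub a x hx').2
    have := hx.2
    omega
  · intro a
    have hsub : par '' hub a ⊆ {z | z ∉ {x | r x = r x₀ ∧ δ x ≤ i} ∧ (∀ j, z ∉ hub j) ∧
        (∃ x ∈ {x | r x = r x₀ ∧ δ x ≤ i}, G.Adj x z) ∧ ∃ y ∈ hub a, G.Adj y z} := by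
      rintro _ ⟨x, hx, rfl⟩
      obtain ⟨hrx, hdx⟩ := hhub a x hx
      obtain ⟨hadj, hrw, hdw⟩ := hparent x hdx
      obtain ⟨w, hw, hrw', hdw'⟩ := hpar _ _ hdw
      refine ⟨fun h => ?_, fun j h => ?_, ⟨w, ⟨?_, hdw'.le⟩, hw.symm⟩, x, hx, hadj⟩
      · have := h.2
        omega
      · have := (hhub j _ h).2
        omega
      · rw [hrw', hrw, hrx]
    refine le_trans ?_ (Set.ncard_le_ncard hsub (Set.toFinite _))
    have hcard : (hub a).ncard = t + 1 := by
      rw [Set.InjOn.ncard_image fun j hj j' hj' h =>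
        hQinj _ _ (hlt a _ hj) (hlt a _ hj') h]
      rw [← Finset.coe_Icc, Set.ncard_coe_finset, Nat.card_Icc]
      omega
    set S := (Set.toFinite (hub a)).toFinset with hS
    have hSmem : ∀ x, x ∈ S ↔ x ∈ hub a := fun x => Set.Finite.mem_toFinset _
    have hScard : S.card = t + 1 := by
      rw [← hcard, Set.ncard_eq_toFinset_card _ (Set.toFinite _)]
    have himg : par '' hub a = (S.image par : Finset V) := by
      ext x; simp [hSmem]
    rw [himg, Set.ncard_coe_finset]
    have h1 := Finset.card_le_mul_card_image (f := par) S d fun w _ => by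
      refine le_trans ?_ (hd w)
      rw [← Set.ncard_coe_finset]
      refine Set.ncard_le_ncard (fun x hx => ?_) (Set.toFinite _)
      obtain ⟨hxS, hxw⟩ := Finset.mem_filter.1 (Finset.mem_coe.1 hx)
      exact hxw ▸ (hparent x (hhub a x ((hSmem x).1 hxS)).2).1.symm
    by_contra hlt'
    push Not at hlt'
    have h2 := Nat.mul_le_mul_left d hlt'.le
    omega

/-- Graphs without a fat star minor are 4-colourable with bounded clustering. -/
theorem clusteredColourable_of_not_isMinor [Finite V] {k : ℕ} (hk : 0 < k)
    (hG : ¬ IsMinor (fatStar k) G) :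
    ClusteredColourable G 4 (layerBound k (defectBound k)) := by
  obtain ⟨f, hf⟩ := exists_defective_colouring hk hG
  let G' : SimpleGraph V :=
    { Adj := fun x y => G.Adj x y ∧ f y = f x
      symm := ⟨fun x y h => ⟨h.1.symm, h.2.symm⟩⟩
      loopless := ⟨fun x h => G.irrefl h.1⟩ }
  have hle : G' ≤ G := fun x y hxy => hxy.1
  obtain ⟨g, hg⟩ := exists_clustered_colouring_of_degree_le (G := G') (k := k)
    (d := defectBound k) (fun h => hG (isMinor_mono hle h)) hf
  let e : Bool × Bool ≃ Fin 4 := Fintype.equivFinOfCardEq (by simp)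
  have he : ∀ x y, e (f x, g x) = e (f y, g y) → f x = f y ∧ g x = g y := fun x y h =>
    Prod.ext_iff.1 (e.injective h)
  refine ⟨fun v => e (f v, g v), fun v => ?_⟩
  set C := (G.induce {u | e (f u, g u) = e (f v, g v)}).connectedComponentMk ⟨v, rfl⟩
  have hcol : ∀ x : {u | e (f u, g u) = e (f v, g v)}, f x = f v ∧ g x = g v := fun x =>
    he _ _ x.2
  rw [← Set.ncard_image_of_injective C.supp Subtype.val_injective]
  refine hg _ ?_ ?_
  · refine Connected.map (G := C.toSimpleGraph) ⟨fun x => ⟨x.1.1, x.1, x.2, rfl⟩, ?_⟩ ?_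
      C.connected_toSimpleGraph
    · intro x y hxy
      exact ⟨hxy, (hcol y.1).1.trans (hcol x.1).1.symm⟩
    · rintro ⟨_, x, hx, rfl⟩
      exact ⟨⟨x, hx⟩, rfl⟩
  · rintro _ ⟨x, -, rfl⟩ _ ⟨y, -, rfl⟩
    exact (hcol x).2.trans (hcol y).2.symm

/-! ### The lower bound construction -/

/-- A path with `n` edges in which, for each edge, `2 * n + 1` disjoint paths with `n` edges are
made complete to both ends of that edge. -/
def spineGraph (n : ℕ) : SimpleGraph (Fin (n + 1) ⊕ Fin n × Fin (2 * n + 1) × Fin (n + 1)) :=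
  SimpleGraph.fromRel fun u v =>
    match u, v with
    | Sum.inl a, Sum.inl b => (a : ℕ) + 1 = b
    | Sum.inl a, Sum.inr (i, _, _) => a = i.castSucc ∨ a = i.succ
    | Sum.inr (i, c, x), Sum.inr (i', c', y) => i = i' ∧ c = c' ∧ (x : ℕ) + 1 = y
    | _, _ => False

section Adjacency

variable {n : ℕ}

lemma spineGraph_adj_inl_inl {a b : Fin (n + 1)} :
    (spineGraph n).Adj (Sum.inl a) (Sum.inl b) ↔ (a : ℕ) + 1 = b ∨ (b : ℕ) + 1 = a := by
  simp only [spineGraph, fromRel_adj, ne_eq, Sum.inl.injEq, Fin.ext_iff]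
  omega

lemma spineGraph_adj_inl_inr {a : Fin (n + 1)} {i : Fin n} {c : Fin (2 * n + 1)}
    {x : Fin (n + 1)} :
    (spineGraph n).Adj (Sum.inl a) (Sum.inr (i, c, x)) ↔ a = i.castSucc ∨ a = i.succ := by
  simp [spineGraph, fromRel_adj]

lemma spineGraph_adj_inr_inl {a : Fin (n + 1)} {i : Fin n} {c : Fin (2 * n + 1)}
    {x : Fin (n + 1)} :
    (spineGraph n).Adj (Sum.inr (i, c, x)) (Sum.inl a) ↔ a = i.castSucc ∨ a = i.succ := by
  rw [adj_comm, spineGraph_adj_inl_inr]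

lemma spineGraph_adj_inr_inr {i i' : Fin n} {c c' : Fin (2 * n + 1)} {x y : Fin (n + 1)} :
    (spineGraph n).Adj (Sum.inr (i, c, x)) (Sum.inr (i', c', y)) ↔
      i = i' ∧ c = c' ∧ ((x : ℕ) + 1 = y ∨ (y : ℕ) + 1 = x) := by
  simp only [spineGraph, fromRel_adj, ne_eq, Sum.inr.injEq, Prod.mk.injEq, Fin.ext_iff]
  omega

/-- Connected sets of the construction are convex on the spine. -/
lemma spine_convex {X : Set (Fin (n + 1) ⊕ Fin n × Fin (2 * n + 1) × Fin (n + 1))}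
    (hX : ((spineGraph n).induce X).Connected) {a m b : Fin (n + 1)} (ha : Sum.inl a ∈ X)
    (hb : Sum.inl b ∈ X) (ham : a < m) (hmb : m < b) : Sum.inl m ∈ X := by
  by_contra hm
  have := connected_propagate hX (fun v => match v with
    | Sum.inl c => c < m
    | Sum.inr (i, _, _) => (i : ℕ) < m) ?_ ha hb ham
  · exact absurd hmb (not_lt.2 (le_of_lt this))
  · rintro (c | ⟨i, c, x⟩) hc (c' | ⟨i', c', y⟩) hc' hadj hlt
    · rw [spineGraph_adj_inl_inl] at hadj
      have hne : c' ≠ m := fun h => hm (h ▸ hc')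
      have hlt : (c : ℕ) < m := hlt
      have hne : (c' : ℕ) ≠ m := fun h => hne (Fin.ext h)
      exact (by omega : (c' : ℕ) < m)
    · rw [spineGraph_adj_inl_inr] at hadj
      have hlt : (c : ℕ) < m := hlt
      rcases hadj with rfl | rfl
      · exact hlt
      · exact (Nat.lt_succ_self _).trans hlt
    · rw [spineGraph_adj_inr_inl] at hadj
      have hne : c' ≠ m := fun h => hm (h ▸ hc')
      have hlt : (i : ℕ) < m := hlt
      rcases hadj with rfl | rfl
      · exact hlt
      · have hne : (i : ℕ) + 1 ≠ m := fun h => hne (Fin.ext h)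
        exact (by omega : (i : ℕ) + 1 < m)
    · rw [spineGraph_adj_inr_inr] at hadj
      obtain ⟨rfl, -, -⟩ := hadj
      exact hlt

/-- A connected set that meets an attached path either lies in it or contains one of the two
spine vertices it is attached to. -/
lemma subset_attached {X : Set (Fin (n + 1) ⊕ Fin n × Fin (2 * n + 1) × Fin (n + 1))}
    (hX : ((spineGraph n).induce X).Connected) {i : Fin n} {c : Fin (2 * n + 1)}
    {x : Fin (n + 1)} (hx : Sum.inr (i, c, x) ∈ X) (h₁ : Sum.inl i.castSucc ∉ X)
    (h₂ : Sum.inl i.succ ∉ X) : ∀ v ∈ X, ∃ y, v = Sum.inr (i, c, y) := by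
  intro v hv
  refine connected_propagate hX (fun v => ∃ y, v = Sum.inr (i, c, y)) ?_ hx hv ⟨x, rfl⟩
  rintro _ - (b | ⟨i', c', z⟩) hw hadj ⟨y, rfl⟩
  · rw [spineGraph_adj_inr_inl] at hadj
    rcases hadj with rfl | rfl
    · exact absurd hw h₁
    · exact absurd hw h₂
  · rw [spineGraph_adj_inr_inr] at hadj
    obtain ⟨rfl, rfl, -⟩ := hadj
    exact ⟨z, rfl⟩

/-- Connected subsets of an attached path are convex. -/
lemma attached_convex {X : Set (Fin (n + 1) ⊕ Fin n × Fin (2 * n + 1) × Fin (n + 1))}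
    (hX : ((spineGraph n).induce X).Connected) {i : Fin n} {c : Fin (2 * n + 1)}
    (hsub : ∀ v ∈ X, ∃ y, v = Sum.inr (i, c, y)) {x m y : Fin (n + 1)}
    (hx : Sum.inr (i, c, x) ∈ X) (hy : Sum.inr (i, c, y) ∈ X) (hxm : x < m) (hmy : m < y) :
    Sum.inr (i, c, m) ∈ X := by
  by_contra hm
  have := connected_propagate hX (fun v => ∃ z, v = Sum.inr (i, c, z) ∧ z < m) ?_ hx hy
    ⟨x, rfl, hxm⟩
  · obtain ⟨z, hz, hzm⟩ := this
    simp only [Sum.inr.injEq, Prod.mk.injEq, true_and] at hz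
    exact absurd hmy (not_lt.2 (hz ▸ hzm.le))
  · rintro _ - w hw hadj ⟨z, rfl, hz⟩
    obtain ⟨z', rfl⟩ := hsub w hw
    rw [spineGraph_adj_inr_inr] at hadj
    refine ⟨z', rfl, ?_⟩
    have hne : (z' : ℕ) ≠ m := fun h => hm (Fin.ext h ▸ hw)
    have hz : (z : ℕ) < m := hz
    exact (by omega : (z' : ℕ) < m)

end Adjacency

/-- Three disjoint sets cannot each form, together with a further disjoint set, a convex subset
of a line. -/
lemma false_of_tripod_on_line {m : ℕ} (line : Fin m → V) (C : Set V) (S : Fin 3 → Set V)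
    (hS : Pairwise fun i j => Disjoint (S i) (S j)) (hCS : ∀ j, Disjoint C (S j))
    (hconv : ∀ j a x b, line a ∈ C ∪ S j → line b ∈ C ∪ S j → a < x → x < b →
      line x ∈ C ∪ S j)
    (hC : ∃ a, line a ∈ C) (hSl : ∀ j, ∃ b, line b ∈ S j) : False := by
  obtain ⟨a, ha⟩ := hC
  choose b hb using hSl
  have hba : ∀ j, (b j : ℕ) ≠ a := fun j h =>
    Set.disjoint_left.1 (hCS j) ha (Fin.ext h ▸ hb j)
  have hbb : ∀ i j, i ≠ j → (b i : ℕ) ≠ b j := fun i j hij h =>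
    Set.disjoint_left.1 (hS hij) (hb i) (Fin.ext h ▸ hb j)
  have hnot : ∀ i j, i ≠ j → line (b i) ∉ C ∪ S j := by
    rintro i j hij (h | h)
    · exact Set.disjoint_left.1 (hCS i) h (hb i)
    · exact Set.disjoint_left.1 (hS hij) (hb i) h
  have hright : ∀ i j, i ≠ j → ¬ ((a : ℕ) < b i ∧ (b i : ℕ) < b j) := fun i j hij h =>
    hnot i j hij (hconv j a (b i) (b j) (Or.inl ha) (Or.inr (hb j)) h.1 h.2)
  have hleft : ∀ i j, i ≠ j → ¬ ((b j : ℕ) < b i ∧ (b i : ℕ) < a) := fun i j hij h =>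
    hnot i j hij (hconv j (b j) (b i) a (Or.inr (hb j)) (Or.inl ha) h.1 h.2)
  have h01 : (0 : Fin 3) ≠ 1 := by decide
  have h02 : (0 : Fin 3) ≠ 2 := by decide
  have h12 : (1 : Fin 3) ≠ 2 := by decide
  have := hba 0
  have := hba 1
  have := hba 2
  have := hbb 0 1 h01
  have := hbb 0 2 h02
  have := hbb 1 2 h12
  have := hright 0 1 h01
  have := hright 1 0 h01.symm
  have := hright 0 2 h02
  have := hright 2 0 h02.symm
  have := hright 1 2 h12
  have := hright 2 1 h12.symm
  have := hleft 0 1 h01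
  have := hleft 1 0 h01.symm
  have := hleft 0 2 h02
  have := hleft 2 0 h02.symm
  have := hleft 1 2 h12
  have := hleft 2 1 h12.symm
  omega

/-- A connected set together with connected sets attached to it is connected. -/
lemma connected_union_iUnion {ι : Type*} {X : Set V} {Y : ι → Set V}
    (hX : (G.induce X).Connected) (hXY : ∀ j, (G.induce (X ∪ Y j)).Connected) :
    (G.induce (X ∪ ⋃ j, Y j)).Connected := by
  obtain ⟨x, hx⟩ := connected_nonempty hX
  refine induce_connected_of_patches x (Or.inl hx) fun {v} hv => ?_
  rcases hv with hv | hv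
  · exact ⟨X, Set.subset_union_left, hx, hv, hX.preconnected _ _⟩
  · obtain ⟨j, hj⟩ := Set.mem_iUnion.1 hv
    exact ⟨X ∪ Y j, Set.union_subset_union_right _ (Set.subset_iUnion _ _), Or.inl hx, Or.inr hj,
      (hXY j).preconnected _ _⟩

theorem not_isMinor_fatStar_spineGraph {k : ℕ} (hk : 3 ≤ k) (n : ℕ) :
    ¬ IsMinor (fatStar k) (spineGraph n) := by
  rintro ⟨X, hXc, hXd, hXe⟩
  have hadj : ∀ a b, (fatStar k).Adj a b →
      ((spineGraph n).induce (X a ∪ X b)).Connected := fun a b hab => by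
    obtain ⟨x, hx, y, hy, hxy⟩ := hXe a b hab
    exact connected_union (hXc a) (hXc b) hx hy hxy
  let e : Fin 3 → Fin k := Fin.castLE hk
  have he : Function.Injective e := Fin.castLE_injective hk
  let C := X (Sum.inl ())
  let hub : Fin 3 → Set _ := fun i => X (Sum.inr (Sum.inl (e i)))
  let mid : Fin 3 → Fin 3 → Set _ := fun i j => X (Sum.inr (Sum.inr (e i, e j)))
  let S : Fin 3 → Set _ := fun i => hub i ∪ ⋃ j, mid i j
  have hhm : ∀ i j, ((spineGraph n).induce (hub i ∪ mid i j)).Connected := fun i j =>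
    hadj _ _ (by simp [fatStar])
  have hSc : ∀ i, ((spineGraph n).induce (S i)).Connected := fun i =>
    connected_union_iUnion (hXc _) (hhm i)
  have hCS : ∀ i, Disjoint C (S i) := fun i =>
    Set.disjoint_union_right.2 ⟨hXd (by simp), Set.disjoint_iUnion_right.2 fun j => hXd (by simp)⟩
  have hSS : Pairwise fun i j => Disjoint (S i) (S j) := by
    intro i j hij
    have hne : e i ≠ e j := he.ne hij
    refine Set.disjoint_union_left.2 ⟨Set.disjoint_union_right.2 ⟨hXd (by simp [hne]), ?_⟩,
      Set.disjoint_iUnion_left.2 fun a => Set.disjoint_union_right.2 ⟨hXd (by simp), ?_⟩⟩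
    · exact Set.disjoint_iUnion_right.2 fun b => hXd (by simp)
    · exact Set.disjoint_iUnion_right.2 fun b => hXd (by simp [hne])
  have hCSc : ∀ i, ((spineGraph n).induce (C ∪ S i)).Connected := fun i => by
    obtain ⟨x, hx, y, hy, hxy⟩ := hXe (Sum.inl ()) (Sum.inr (Sum.inl (e i))) (by simp [fatStar])
    exact connected_union (hXc _) (hSc i) hx (Or.inl hy) hxy
  have hspine : ∀ i, ∃ b, Sum.inl b ∈ S i := by
    intro i
    by_contra hno
    push Not at hno
    obtain ⟨v, hv⟩ := connected_nonempty (hSc i)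
    rcases v with b | ⟨i₀, c, x⟩
    · exact hno b hv
    have hsub := subset_attached (hSc i) hv (hno _) (hno _)
    have hsub' : ∀ j, hub i ∪ mid i j ⊆ S i := fun j =>
      Set.union_subset_union_right _ (Set.subset_iUnion _ _)
    refine false_of_tripod_on_line (fun x => Sum.inr (i₀, c, x)) (hub i) (mid i) ?_ ?_ ?_ ?_ ?_
    · exact fun a b hab => hXd (by simp [he.ne hab])
    · exact fun j => hXd (by simp)
    · intro j a x b ha hb hax hxb
      exact attached_convex (hhm i j) (fun v hv => hsub v (hsub' j hv)) ha hb hax hxb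
    · obtain ⟨v, hv⟩ := connected_nonempty (hXc (Sum.inr (Sum.inl (e i))))
      obtain ⟨y, rfl⟩ := hsub v (Or.inl hv)
      exact ⟨y, hv⟩
    · intro j
      obtain ⟨v, hv⟩ := connected_nonempty (hXc (Sum.inr (Sum.inr (e i, e j))))
      obtain ⟨y, rfl⟩ := hsub v (hsub' j (Or.inr hv))
      exact ⟨y, hv⟩
  by_cases hC : ∃ a, Sum.inl a ∈ C
  · exact false_of_tripod_on_line Sum.inl C S hSS hCS
      (fun j a x b ha hb hax hxb => spine_convex (hCSc j) ha hb hax hxb) hC hspine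
  · push Not at hC
    obtain ⟨v, hv⟩ := connected_nonempty (hXc (Sum.inl ()))
    rcases v with b | ⟨i₀, c, x⟩
    · exact hC b hv
    have hend : ∀ j, Sum.inl i₀.castSucc ∈ S j ∨ Sum.inl i₀.succ ∈ S j := by
      intro j
      by_contra hno
      rw [not_or] at hno
      obtain ⟨b, hb⟩ := hspine j
      obtain ⟨y, hy⟩ := subset_attached (hCSc j) (Or.inl hv)
        (fun h => h.elim (hC _) hno.1) (fun h => h.elim (hC _) hno.2) _ (Or.inr hb)
      exact absurd hy (by simp)
    have hdis : ∀ i j v, i ≠ j → v ∈ S i → v ∉ S j := fun i j v hij hi hj =>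
      Set.disjoint_left.1 (hSS hij) hi hj
    have h01 := fun v => hdis 0 1 v (by decide)
    have h02 := fun v => hdis 0 2 v (by decide)
    have h12 := fun v => hdis 1 2 v (by decide)
    rcases hend 0 with h0 | h0 <;> rcases hend 1 with h1 | h1 <;> rcases hend 2 with h2 | h2
    all_goals first
      | exact h01 _ h0 h1
      | exact h02 _ h0 h2
      | exact h12 _ h1 h2

/-- In a colouring with clustering `c`, connected monochromatic sets have at most `c` vertices. -/
lemma ncard_le_of_monochromatic [Finite V] {α : Type*} {f : V → α} {c : ℕ}
    (hf : ∀ v, ((G.induce {u | f u = f v}).connectedComponentMk ⟨v, rfl⟩).supp.ncard ≤ c)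
    {K : Set V} (hK : (G.induce K).Connected) {v : V} (hv : v ∈ K)
    (hcol : ∀ x ∈ K, f x = f v) : K.ncard ≤ c := by
  refine le_trans ?_ (hf v)
  rw [← Set.ncard_image_of_injective _ Subtype.val_injective]
  refine Set.ncard_le_ncard (fun x hx => ⟨⟨x, hcol x hx⟩, ?_, rfl⟩) (Set.toFinite _)
  refine ConnectedComponent.sound ?_
  exact (hK.preconnected ⟨x, hx⟩ ⟨v, hv⟩).map (induceHomOfLE G hcol).toHom

lemma connected_range_path {n : ℕ} (p : Fin (n + 1) → V)
    (hp : ∀ a b : Fin (n + 1), (a : ℕ) + 1 = b → G.Adj (p a) (p b)) :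
    (G.induce (Set.range p)).Connected := by
  refine Connected.map (G := pathGraph (n + 1)) ⟨fun a => ⟨p a, a, rfl⟩, ?_⟩ ?_
    (pathGraph_connected n)
  · intro a b hab
    rw [pathGraph_adj] at hab
    rcases hab with h | h
    · exact hp a b h
    · exact (hp b a h).symm
  · rintro ⟨_, a, rfl⟩
    exact ⟨a, rfl⟩

lemma connected_insert_of_adj {w : V} {S : Set V} (hS : ∀ x ∈ S, G.Adj x w) :
    (G.induce (insert w S)).Connected := by
  classical
  exact connected_of_rank (Set.mem_insert w S) (fun v => if v = w then 0 else 1)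
    fun v hv hvw => ⟨w, Set.mem_insert w S, hS v (hv.resolve_left hvw), by simp [hvw]⟩

theorem not_clusteredColourable_spineGraph (n : ℕ) : ¬ ClusteredColourable (spineGraph n) 3 n := by
  classical
  rintro ⟨f, hf⟩
  have hpath : ∀ p : Fin (n + 1) → _, Function.Injective p →
      (∀ a b : Fin (n + 1), (a : ℕ) + 1 = b → (spineGraph n).Adj (p a) (p b)) →
      ¬ ∀ a, f (p a) = f (p 0) := by
    intro p hinj hp hcol
    have h1 := ncard_le_of_monochromatic hf (connected_range_path p hp) (v := p 0) ⟨0, rfl⟩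
      (by rintro _ ⟨a, rfl⟩; exact hcol a)
    rw [← Set.image_univ, Set.ncard_image_of_injective _ hinj, Set.ncard_univ,
      Nat.card_eq_fintype_card, Fintype.card_fin] at h1
    omega
  obtain ⟨i, hi⟩ : ∃ i : Fin n, f (Sum.inl i.castSucc) ≠ f (Sum.inl i.succ) := by
    by_contra hno
    push Not at hno
    refine hpath Sum.inl Sum.inl_injective (fun a b hab => spineGraph_adj_inl_inl.2 (Or.inl hab))
      fun a => ?_
    induction a using Fin.induction with
    | zero => rfl
    | succ i ih => exact (hno i).symm.trans ih
  have hfew : ∀ w, (w = i.castSucc ∨ w = i.succ) →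
      {c | ∃ x, f (Sum.inr (i, c, x)) = f (Sum.inl w)}.ncard ≤ n := by
    intro w hw
    set T := {v | ∃ c x, v = Sum.inr (i, c, x) ∧ f v = f (Sum.inl w)} with hT
    have h1 := ncard_le_of_monochromatic hf (v := Sum.inl w) (K := insert (Sum.inl w) T)
      (connected_insert_of_adj (by
        rintro _ ⟨c, x, rfl, -⟩
        exact spineGraph_adj_inr_inl.2 hw)) (Set.mem_insert _ _) (by
        rintro v (rfl | ⟨c, x, -, h⟩)
        · rfl
        · exact h)
    refine le_trans ?_ h1
    have hpick : ∀ c, ∃ x, (∃ x, f (Sum.inr (i, c, x)) = f (Sum.inl w)) →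
        f (Sum.inr (i, c, x)) = f (Sum.inl w) := by
      intro c
      by_cases h : ∃ x, f (Sum.inr (i, c, x)) = f (Sum.inl w)
      · exact ⟨h.choose, fun _ => h.choose_spec⟩
      · exact ⟨0, fun h' => absurd h' h⟩
    choose x hx using hpick
    refine Set.ncard_le_ncard_of_injOn (fun c => Sum.inr (i, c, x c)) ?_ ?_ (Set.toFinite _)
    · exact fun c hc => Or.inr ⟨c, x c, rfl, hx c hc⟩
    · intro c _ c' _ h
      simp only [Sum.inr.injEq, Prod.mk.injEq, true_and] at h
      exact h.1
  obtain ⟨c, hc⟩ : ∃ c, c ∉ {c | ∃ x, f (Sum.inr (i, c, x)) = f (Sum.inl i.castSucc)} ∪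
      {c | ∃ x, f (Sum.inr (i, c, x)) = f (Sum.inl i.succ)} := by
    by_contra hno
    push Not at hno
    have h1 := Set.ncard_union_le {c | ∃ x, f (Sum.inr (i, c, x)) = f (Sum.inl i.castSucc)}
      {c | ∃ x, f (Sum.inr (i, c, x)) = f (Sum.inl i.succ)}
    rw [Set.eq_univ_of_forall hno, Set.ncard_univ, Nat.card_eq_fintype_card,
      Fintype.card_fin] at h1
    have h2 := hfew i.castSucc (Or.inl rfl)
    have h3 := hfew i.succ (Or.inr rfl)
    omega
  rw [Set.mem_union, not_or] at hc
  refine hpath (fun x => Sum.inr (i, c, x)) (fun x y h => by simpa using h)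
    (fun a b hab => spineGraph_adj_inr_inr.2 ⟨rfl, rfl, Or.inl hab⟩) fun a => ?_
  have third : ∀ p q r s : Fin 3, p ≠ q → r ≠ p → r ≠ q → s ≠ p → s ≠ q → r = s := by decide
  exact third _ _ _ _ hi (fun h => hc.1 ⟨a, h⟩) (fun h => hc.2 ⟨a, h⟩) (fun h => hc.1 ⟨0, h⟩)
    fun h => hc.2 ⟨0, h⟩

end FatStar

/-- For every `k ≥ 3`, the clustered chromatic number of the class of
graphs with no `k`-fat star minor equals 4: some `c` works for 4 colours, and for every
`c'` some graph with no `k`-fat star minor admits no 3-colouring with clustering `c'`. -/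
theorem clustered_chromatic_number_fatStar_free (k : ℕ) (hk : 3 ≤ k) :
    (∃ c : ℕ, ∀ (V : Type) [Finite V] (G : SimpleGraph V),
      ¬ IsMinor (fatStar k) G → ClusteredColourable G 4 c) ∧
    (∀ c' : ℕ, ∃ (V : Type) (_ : Finite V) (G : SimpleGraph V),
      ¬ IsMinor (fatStar k) G ∧ ¬ ClusteredColourable G 3 c') := by
  have hpos : 0 < k := by omega
  refine ⟨⟨_, fun V _ G hG => FatStar.clusteredColourable_of_not_isMinor hpos hG⟩, fun c' => ?_⟩
  exact ⟨_, inferInstance, FatStar.spineGraph c', FatStar.not_isMinor_fatStar_spineGraph hk c',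
    FatStar.not_clusteredColourable_spineGraph c'⟩
end

section
/- For every graph H with td(H) ≤ 3, there exists an integer c = c(H) such that every H-minor-free graph is 5-colourable with clustering c. -/
namespace FatMinor

variable {V : Type} {G : SimpleGraph V}

/-- The vertex set `X` is nonempty and cannot be cut into two parts with no edge between them;
this says that `G.induce X` is connected. -/
def Conn (G : SimpleGraph V) (X : Set V) : Prop :=
  X.Nonempty ∧ ∀ S : Set V, (X ∩ S).Nonempty → (X \ S).Nonempty →
    ∃ x ∈ X ∩ S, ∃ y ∈ X \ S, G.Adj x y

/-- There is an edge between `A` and `B`. -/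
def Touch (G : SimpleGraph V) (A B : Set V) : Prop :=
  ∃ x ∈ A, ∃ y ∈ B, G.Adj x y

theorem Touch.symm {A B : Set V} (h : Touch G A B) : Touch G B A := by
  obtain ⟨x, hx, y, hy, e⟩ := h
  exact ⟨y, hy, x, hx, e.symm⟩

theorem Touch.mono {A B A' B' : Set V} (h : Touch G A B) (hA : A ⊆ A') (hB : B ⊆ B') :
    Touch G A' B' := by
  obtain ⟨x, hx, y, hy, e⟩ := h
  exact ⟨x, hA hx, y, hB hy, e⟩

theorem conn_singleton (v : V) : Conn G {v} := by
  refine ⟨⟨v, rfl⟩, ?_⟩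
  rintro S ⟨x, rfl, hx⟩ ⟨y, rfl, hy⟩
  exact absurd hx hy

theorem conn_iff_induce_connected {X : Set V} : Conn G X ↔ (G.induce X).Connected := by
  constructor
  · rintro ⟨⟨a, ha⟩, h⟩
    have : Nonempty X := ⟨⟨a, ha⟩⟩
    refine ⟨fun u v => ?_⟩
    by_contra hv
    obtain ⟨x, ⟨hxX, hx, hxr⟩, y, ⟨hyX, hy⟩, e⟩ :=
      h {w | ∃ hw : w ∈ X, (G.induce X).Reachable u ⟨w, hw⟩}
        ⟨u, u.2, u.2, SimpleGraph.Reachable.refl _⟩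
        ⟨v, v.2, fun ⟨_, hw⟩ => hv hw⟩
    refine hy ⟨hyX, hxr.trans (SimpleGraph.Adj.reachable ?_)⟩
    simpa using e
  · intro h
    obtain ⟨⟨a, ha⟩⟩ := h.nonempty
    refine ⟨⟨a, ha⟩, ?_⟩
    rintro S ⟨x, hx, hxS⟩ ⟨y, hy, hyS⟩
    obtain ⟨p⟩ := h.preconnected ⟨x, hx⟩ ⟨y, hy⟩
    obtain ⟨d, -, h1, h2⟩ := p.exists_boundary_dart {w | w.1 ∈ S} hxS hyS
    exact ⟨d.fst.1, ⟨d.fst.2, h1⟩, d.snd.1, ⟨d.snd.2, h2⟩, by simpa using d.adj⟩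

theorem Conn.union {A B : Set V} (hA : Conn G A) (hB : Conn G B)
    (h : (A ∩ B).Nonempty ∨ Touch G A B) : Conn G (A ∪ B) := by
  refine ⟨hA.1.mono Set.subset_union_left, fun S hS hS' => ?_⟩
  by_cases h1 : (A ∩ S).Nonempty ∧ (A \ S).Nonempty
  · obtain ⟨x, hx, y, hy, e⟩ := hA.2 S h1.1 h1.2
    exact ⟨x, ⟨.inl hx.1, hx.2⟩, y, ⟨.inl hy.1, hy.2⟩, e⟩
  by_cases h2 : (B ∩ S).Nonempty ∧ (B \ S).Nonempty
  · obtain ⟨x, hx, y, hy, e⟩ := hB.2 S h2.1 h2.2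
    exact ⟨x, ⟨.inr hx.1, hx.2⟩, y, ⟨.inr hy.1, hy.2⟩, e⟩
  have key : ∀ C : Set V, ¬ ((C ∩ S).Nonempty ∧ (C \ S).Nonempty) → ∀ x ∈ C, ∀ y ∈ C,
      (x ∈ S ↔ y ∈ S) := by
    intro C hC x hx y hy
    by_contra hne
    apply hC
    by_cases hxS : x ∈ S
    · exact ⟨⟨x, hx, hxS⟩, ⟨y, hy, by tauto⟩⟩
    · exact ⟨⟨y, hy, by tauto⟩, ⟨x, hx, hxS⟩⟩
  have k1 := key A h1
  have k2 := key B h2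
  obtain ⟨a, ha, haS⟩ := hS
  obtain ⟨b, hb, hbS⟩ := hS'
  rcases h with ⟨c, hcA, hcB⟩ | ⟨x, hx, y, hy, e⟩
  · exfalso
    rcases ha with ha | ha <;> rcases hb with hb | hb
    · exact hbS ((k1 a ha b hb).1 haS)
    · exact hbS ((k2 c hcB b hb).1 ((k1 a ha c hcA).1 haS))
    · exact hbS ((k1 c hcA b hb).1 ((k2 a ha c hcB).1 haS))
    · exact hbS ((k2 a ha b hb).1 haS)
  · rcases ha with ha | ha <;> rcases hb with hb | hb
    · exact absurd ((k1 a ha b hb).1 haS) hbS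
    · exact ⟨x, ⟨.inl hx, (k1 a ha x hx).1 haS⟩, y,
        ⟨.inr hy, fun h => hbS ((k2 y hy b hb).1 h)⟩, e⟩
    · exact ⟨y, ⟨.inr hy, (k2 a ha y hy).1 haS⟩, x,
        ⟨.inl hx, fun h => hbS ((k1 x hx b hb).1 h)⟩, e.symm⟩
    · exact absurd ((k2 a ha b hb).1 haS) hbS

/-- A union of connected sets, each containing a given point, is connected. -/
theorem conn_biUnion_of_mem {a : V} {F : Set (Set V)} (hF : F.Nonempty)
    (h : ∀ K ∈ F, Conn G K ∧ a ∈ K) : Conn G (⋃₀ F) := by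
  obtain ⟨K₀, hK₀⟩ := hF
  refine ⟨⟨a, K₀, hK₀, (h K₀ hK₀).2⟩, ?_⟩
  rintro S ⟨x, ⟨K, hK, hxK⟩, hxS⟩ ⟨y, ⟨L, hL, hyL⟩, hyS⟩
  by_cases haS : a ∈ S
  · obtain ⟨u, hu, v, hv, e⟩ := (h L hL).1.2 S ⟨a, (h L hL).2, haS⟩ ⟨y, hyL, hyS⟩
    exact ⟨u, ⟨⟨L, hL, hu.1⟩, hu.2⟩, v, ⟨⟨L, hL, hv.1⟩, hv.2⟩, e⟩
  · obtain ⟨u, hu, v, hv, e⟩ := (h K hK).1.2 S ⟨x, hxK, hxS⟩ ⟨a, (h K hK).2, haS⟩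
    exact ⟨u, ⟨⟨K, hK, hu.1⟩, hu.2⟩, v, ⟨⟨K, hK, hv.1⟩, hv.2⟩, e⟩

/-- A connected set together with connected sets touching it is connected. -/
theorem Conn.union_iUnion {ι : Type*} {M : Set V} (hM : Conn G M) (D : ι → Set V)
    (hD : ∀ i, Conn G (D i)) (hT : ∀ i, Touch G M (D i)) : Conn G (M ∪ ⋃ i, D i) := by
  obtain ⟨a, ha⟩ := hM.1
  have := conn_biUnion_of_mem (G := G) (a := a) (F := insert M (Set.range fun i => M ∪ D i))
    ⟨M, Set.mem_insert _ _⟩ (by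
      rintro K (rfl | ⟨i, rfl⟩)
      · exact ⟨hM, ha⟩
      · exact ⟨hM.union (hD i) (.inr (hT i)), .inl ha⟩)
  convert this using 1
  ext x
  simp only [Set.mem_union, Set.mem_iUnion, Set.mem_sUnion, Set.mem_insert_iff, Set.mem_range]
  constructor
  · rintro (h | ⟨i, h⟩)
    · exact ⟨M, .inl rfl, h⟩
    · exact ⟨_, .inr ⟨i, rfl⟩, .inr h⟩
  · rintro ⟨_, rfl | ⟨i, rfl⟩, h⟩
    · exact .inl h
    · exact h.imp id fun h => ⟨i, h⟩

/-- `C` is (the vertex set of) a connected component of `G[A]`. -/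
def IsComp (G : SimpleGraph V) (A C : Set V) : Prop :=
  C ⊆ A ∧ Conn G C ∧ ∀ x ∈ C, ∀ y ∈ A, G.Adj x y → y ∈ C

theorem IsComp.subset_of_conn {A C D : Set V} (hC : IsComp G A C) (hD : Conn G D) (hDA : D ⊆ A)
    (h : (D ∩ C).Nonempty) : D ⊆ C := by
  by_contra hn
  obtain ⟨y, hy, hyC⟩ := Set.not_subset.1 hn
  obtain ⟨x, hx, z, hz, e⟩ := hD.2 C h ⟨y, hy, hyC⟩
  exact hz.2 (hC.2.2 x hx.2 z (hDA hz.1) e)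

theorem IsComp.eq_of_inter {A C D : Set V} (hC : IsComp G A C) (hD : IsComp G A D)
    (h : (C ∩ D).Nonempty) : C = D :=
  Set.Subset.antisymm (hD.subset_of_conn hC.2.1 hC.1 h)
    (hC.subset_of_conn hD.2.1 hD.1 (Set.inter_comm C D ▸ h))

/-- The component of `G[A]` containing `a`. -/
def compOf (G : SimpleGraph V) (A : Set V) (a : V) : Set V :=
  ⋃₀ {K | K ⊆ A ∧ Conn G K ∧ a ∈ K}

theorem mem_compOf {A : Set V} {a : V} (ha : a ∈ A) : a ∈ compOf G A a :=
  ⟨{a}, ⟨by simpa using ha, conn_singleton a, rfl⟩, rfl⟩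

theorem isComp_compOf {A : Set V} {a : V} (ha : a ∈ A) : IsComp G A (compOf G A a) := by
  have hc : Conn G (compOf G A a) := conn_biUnion_of_mem (a := a)
    ⟨{a}, by simpa using ha, conn_singleton a, rfl⟩ fun K hK => hK.2
  have hs : compOf G A a ⊆ A := Set.sUnion_subset fun K hK => hK.1
  refine ⟨hs, hc, fun x hx y hy e => ?_⟩
  exact ⟨compOf G A a ∪ {y}, ⟨Set.union_subset hs (by simpa using hy),
    hc.union (conn_singleton y) (.inr ⟨x, hx, y, rfl, e⟩), .inl (mem_compOf ha)⟩, .inr rfl⟩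

theorem IsComp.eq_compOf {A C : Set V} {a : V} (hC : IsComp G A C) (ha : a ∈ C) :
    C = compOf G A a :=
  hC.eq_of_inter (isComp_compOf (hC.1 ha)) ⟨a, ha, mem_compOf (hC.1 ha)⟩

theorem Conn.exists_isComp {A D : Set V} (hD : Conn G D) (hDA : D ⊆ A) :
    ∃ C, IsComp G A C ∧ D ⊆ C := by
  obtain ⟨d, hd⟩ := hD.1
  exact ⟨_, isComp_compOf (hDA hd), (isComp_compOf (hDA hd)).subset_of_conn hD hDA
    ⟨d, hd, mem_compOf (hDA hd)⟩⟩

/-- Distinct components do not meet. -/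
theorem IsComp.disjoint {A C D : Set V} (hC : IsComp G A C) (hD : IsComp G A D) (h : C ≠ D) :
    Disjoint C D := by
  rw [Set.disjoint_iff_inter_eq_empty, ← Set.not_nonempty_iff_eq_empty]
  exact fun hne => h (hC.eq_of_inter hD hne)

/-- A haven of order `t` in `G[U]`. -/
def Haven (G : SimpleGraph V) (U : Set V) (t : ℕ) (β : Set V → Set V) : Prop :=
  (∀ Z : Set V, Z.ncard ≤ t → IsComp G (U \ Z) (β Z)) ∧
    ∀ Z Z' : Set V, Z ⊆ Z' → Z'.ncard ≤ t → β Z' ⊆ β Z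

/-- The number of vertices needed to hit a family of connected sets without `N` disjoint
members in a graph without haven of order `t`. -/
def hitBound (t : ℕ) : ℕ → ℕ
  | 0 => 0
  | N + 1 => 2 * hitBound t N + t

theorem exists_hitting_set [Finite V] {t : ℕ} (hG : ∀ U β, ¬ Haven G U t β)
    (F : Set V → Prop) (hF : ∀ K, F K → Conn G K) (N : ℕ) (U : Set V)
    (hU : ¬ ∃ f : Fin N → Set V, (∀ i, F (f i) ∧ f i ⊆ U) ∧
      Pairwise fun i j => Disjoint (f i) (f j)) :
    ∃ Z ⊆ U, Z.ncard ≤ hitBound t N ∧ ∀ K, F K → ¬ K ⊆ U \ Z := by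
  induction N generalizing U with
  | zero => exact absurd ⟨fun i => i.elim0, fun i => i.elim0, fun i => i.elim0⟩ hU
  | succ N ih =>
  by_contra hcon
  push Not at hcon
  -- a smaller packing number leaves room for one more member
  have ext : ∀ A B : Set V, A ⊆ U → B ⊆ U → Disjoint A B → (∃ K, F K ∧ K ⊆ A) →
      ∃ Z ⊆ B, Z.ncard ≤ hitBound t N ∧ ∀ K, F K → ¬ K ⊆ B \ Z := by
    rintro A B hA hB hAB ⟨K, hK, hKA⟩
    apply ih
    rintro ⟨f, hf, hd⟩
    apply hU
    refine ⟨Fin.cons K f, ?_, ?_⟩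
    · intro i
      refine Fin.cases ⟨hK, hKA.trans hA⟩ (fun i => ⟨(hf i).1, (hf i).2.trans hB⟩) i
    · intro i j
      refine Fin.cases ?_ (fun i => ?_) i <;> refine Fin.cases ?_ (fun j => ?_) j
      · simp
      · exact fun _ => hAB.mono hKA (hf j).2
      · exact fun _ => (hAB.mono hKA (hf i).2).symm
      · exact fun h => hd (fun h' => h (congrArg _ h'))
  have uniq : ∀ Z : Set V, Z.ncard ≤ t → ∃ C, IsComp G (U \ Z) C ∧
      (∃ K, F K ∧ K ⊆ C) ∧ ∀ K, F K → K ⊆ U \ Z → K ⊆ C := by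
    intro Z hZ
    have h0 : ∃ K, F K ∧ K ⊆ U \ Z := by
      obtain ⟨K, hK, hKZ⟩ := hcon (Z ∩ U) Set.inter_subset_right (by
        have : (Z ∩ U).ncard ≤ Z.ncard := Set.ncard_le_ncard Set.inter_subset_left
        simp only [hitBound]; omega)
      exact ⟨K, hK, hKZ.trans fun x hx => ⟨hx.1, fun h => hx.2 ⟨h, hx.1⟩⟩⟩
    obtain ⟨K, hK, hKZ⟩ := h0
    obtain ⟨C, hC, hKC⟩ := (hF K hK).exists_isComp hKZ
    refine ⟨C, hC, ⟨K, hK, hKC⟩, ?_⟩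
    intro L hL hLZ
    by_contra hLC
    obtain ⟨C', hC', hLC'⟩ := (hF L hL).exists_isComp hLZ
    have hne : C' ≠ C := by rintro rfl; exact hLC hLC'
    have hdis := hC'.disjoint hC hne
    have hCU := hC.1.trans Set.sdiff_subset
    obtain ⟨Z1, hZ1, hZ1c, hZ1h⟩ := ext C' C (hC'.1.trans Set.sdiff_subset) hCU hdis ⟨L, hL, hLC'⟩
    obtain ⟨Z2, hZ2, hZ2c, hZ2h⟩ := ext C ((U \ Z) \ C) hCU
      (Set.sdiff_subset.trans Set.sdiff_subset) Set.disjoint_sdiff_right ⟨K, hK, hKC⟩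
    obtain ⟨M, hM, hMs⟩ := hcon (Z1 ∪ Z2 ∪ (Z ∩ U))
      (Set.union_subset (Set.union_subset (hZ1.trans hCU)
        (hZ2.trans (Set.sdiff_subset.trans Set.sdiff_subset))) Set.inter_subset_right) (by
        have h1 := Set.ncard_union_le (Z1 ∪ Z2) (Z ∩ U)
        have h2 := Set.ncard_union_le Z1 Z2
        have : (Z ∩ U).ncard ≤ Z.ncard := Set.ncard_le_ncard Set.inter_subset_left
        simp only [hitBound]; omega)
    have hMU : M ⊆ U \ Z := fun x hx => ⟨(hMs hx).1, fun h => (hMs hx).2 (.inr ⟨h, (hMs hx).1⟩)⟩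
    by_cases hMC : (M ∩ C).Nonempty
    · have := hC.subset_of_conn (hF M hM) hMU hMC
      exact hZ1h M hM fun x hx => ⟨this hx, fun h => (hMs hx).2 (.inl (.inl h))⟩
    · exact hZ2h M hM fun x hx => ⟨⟨hMU hx, fun h => hMC ⟨x, hx, h⟩⟩,
        fun h => (hMs hx).2 (.inl (.inr h))⟩
  choose! β hβ using uniq
  refine hG U β ⟨fun Z hZ => (hβ Z hZ).1, fun Z Z' hZZ hZ' => ?_⟩
  have hZ : Z.ncard ≤ t := (Set.ncard_le_ncard hZZ).trans hZ'
  obtain ⟨h1, ⟨K, hK, hKC⟩, -⟩ := hβ Z' hZ'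
  have hsub : U \ Z' ⊆ U \ Z := Set.sdiff_subset_sdiff_right hZZ
  refine (hβ Z hZ).1.subset_of_conn h1.2.1 (h1.1.trans hsub) ?_
  have := (hβ Z hZ).2.2 K hK ((hKC.trans h1.1).trans hsub)
  obtain ⟨x, hx⟩ := (hF K hK).1
  exact ⟨x, hKC hx, this hx⟩

/-- `Z` separates `A` from `B`: some set `R ⊇ A` can only be left through `Z`, and meets `B`
only in `Z`. -/
def Separates (G : SimpleGraph V) (A B Z : Set V) : Prop :=
  ∃ R : Set V, A ⊆ R ∧ ∀ x ∈ R, x ∉ Z → x ∉ B ∧ ∀ y, G.Adj x y → y ∈ R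

theorem Conn.mono_graph {G' : SimpleGraph V} (h : G ≤ G') {X : Set V} (hX : Conn G X) :
    Conn G' X := by
  refine ⟨hX.1, fun S h1 h2 => ?_⟩
  obtain ⟨x, hx, y, hy, e⟩ := hX.2 S h1 h2
  exact ⟨x, hx, y, hy, h e⟩

/-- `m` disjoint sets meeting an `m`-element set `P` do so in distinct single vertices. -/
theorem exists_transversal [Finite V] {m : ℕ} {D : Fin m → Set V} {P : Set V} (hP : P.ncard = m)
    (hD : Pairwise fun i j => Disjoint (D i) (D j)) (hm : ∀ i, (D i ∩ P).Nonempty) :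
    ∃ p : Fin m → V, (∀ i, p i ∈ D i ∧ p i ∈ P) ∧ (∀ s ∈ P, ∃ i, p i = s) ∧
      ∀ i, ∀ s ∈ D i, s ∈ P → s = p i := by
  choose p hp using hm
  have huniq : ∀ i j, p i ∈ D j → i = j := by
    intro i j h
    by_contra hne
    exact (hD hne).le_bot ⟨(hp i).1, h⟩
  have hinj : Function.Injective p := fun i j h => huniq i j (h ▸ (hp j).1)
  have hr : Set.range p = P := by
    apply Set.eq_of_subset_of_ncard_le
    · rintro _ ⟨i, rfl⟩; exact (hp i).2
    · rw [← Set.image_univ, Set.ncard_image_of_injective _ hinj, Set.ncard_univ]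
      simp [hP]
    · exact P.toFinite
  have hs : ∀ s ∈ P, ∃ i, p i = s := fun s hs => by rwa [← hr] at hs
  refine ⟨p, hp, hs, fun i s hsD hsP => ?_⟩
  obtain ⟨j, rfl⟩ := hs s hsP
  rw [huniq j i hsD]

/-- Inside a connected set `D` meeting `A` and meeting `P` only in `s`, if one can leave `R` only
through `P` then `D ∩ R` connects `A` with `s`. -/
theorem Conn.exists_truncation {D R A P : Set V} {s : V} (hD : Conn G D) (hDA : (D ∩ A).Nonempty)
    (hAR : A ⊆ R) (hs : s ∈ D) (hu : ∀ z ∈ D, z ∈ P → z = s)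
    (hR : ∀ u ∈ R, u ∉ P → ∀ v, G.Adj u v → v ∈ R) :
    ∃ D' ⊆ D, D' ⊆ R ∧ Conn G D' ∧ (D' ∩ A).Nonempty ∧ s ∈ D' := by
  obtain ⟨a, haD, haA⟩ := hDA
  have ha : a ∈ D ∩ R := ⟨haD, hAR haA⟩
  have hc := isComp_compOf (G := G) ha
  refine ⟨compOf G (D ∩ R) a, fun x hx => (hc.1 hx).1, fun x hx => (hc.1 hx).2, hc.2.1,
    ⟨a, mem_compOf ha, haA⟩, ?_⟩
  by_contra hsC
  obtain ⟨u, hu1, v, hv, e⟩ := hD.2 (compOf G (D ∩ R) a) ⟨a, haD, mem_compOf ha⟩ ⟨s, hs, hsC⟩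
  have hup : u ∉ P := fun h => hsC (hu u hu1.1 h ▸ hu1.2)
  exact hv.2 (hc.2.2 u hu1.2 v ⟨hv.1, hR u (hc.1 hu1.2).2 hup v e⟩ e)

/-- Menger's theorem, with connected sets in place of paths. -/
theorem exists_disjoint_connectors [Finite V] (G : SimpleGraph V) (m : ℕ) (A B : Set V)
    (h : ∀ Z, Separates G A B Z → m ≤ Z.ncard) :
    ∃ D : Fin m → Set V, (∀ i, Conn G (D i) ∧ (D i ∩ A).Nonempty ∧ (D i ∩ B).Nonempty) ∧
      Pairwise fun i j => Disjoint (D i) (D j) := by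
  induction G using WellFoundedLT.induction generalizing A B with
  | ind G ih =>
  by_cases hne : ∀ x y, ¬ G.Adj x y
  · have hm : m ≤ (A ∩ B).ncard :=
      h _ ⟨A, subset_rfl, fun x hx hxZ => ⟨fun hB => hxZ ⟨hx, hB⟩, fun y e => absurd e (hne x y)⟩⟩
    have : Nonempty (Fin m ↪ ↥(A ∩ B)) := by
      have := Fintype.ofFinite ↥(A ∩ B)
      apply Function.Embedding.nonempty_of_card_le
      rwa [Fintype.card_fin, ← Nat.card_eq_fintype_card, Nat.card_coe_set_eq]
    obtain ⟨f⟩ := this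
    refine ⟨fun i => {(f i : V)}, fun i => ⟨conn_singleton _, ⟨f i, rfl, (f i).2.1⟩,
      ⟨f i, rfl, (f i).2.2⟩⟩, fun i j hij => ?_⟩
    dsimp only
    rw [Set.disjoint_singleton]
    exact fun h => hij (f.injective (Subtype.ext h))
  push Not at hne
  obtain ⟨x₀, y₀, e₀⟩ := hne
  set G' := G.deleteEdges {s(x₀, y₀)} with hG'
  have hlt : G' < G := by
    refine lt_of_le_of_ne (SimpleGraph.deleteEdges_le _) fun heq => ?_
    have : G'.Adj x₀ y₀ := heq ▸ e₀
    simp [hG'] at this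
  by_cases hsep : ∀ Z, Separates G' A B Z → m ≤ Z.ncard
  · obtain ⟨D, hD, hd⟩ := ih G' hlt A B hsep
    exact ⟨D, fun i => ⟨(hD i).1.mono_graph hlt.le, (hD i).2⟩, hd⟩
  push Not at hsep
  obtain ⟨Z, ⟨R₀, hA₀, hR₀⟩, hZm⟩ := hsep
  obtain ⟨R, hZR, hAR, hRB, hR⟩ : ∃ R : Set V, Z ⊆ R ∧ A ⊆ R ∧ (∀ x ∈ R, x ∉ Z → x ∉ B) ∧
      ∀ x ∈ R, x ∉ Z → ∀ y, G'.Adj x y → y ∈ R := by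
    refine ⟨R₀ ∪ Z, Set.subset_union_right, hA₀.trans Set.subset_union_left, ?_, ?_⟩
    · rintro x (hx | hx) hxZ
      · exact (hR₀ x hx hxZ).1
      · exact absurd hx hxZ
    · rintro x (hx | hx) hxZ
      · exact fun y e => .inl ((hR₀ x hx hxZ).2 y e)
      · exact absurd hx hxZ
  obtain ⟨x, y, hxR, hxZ, hyR, hxy⟩ : ∃ x y, x ∈ R ∧ x ∉ Z ∧ y ∉ R ∧ G.Adj x y := by
    by_contra hcon
    push Not at hcon
    have := h Z ⟨R, hAR, fun x hx hxZ => ⟨hRB x hx hxZ, fun y e => by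
      by_contra hy
      exact hcon x y hx hxZ hy e⟩⟩
    omega
  have hadj : ∀ u v, G.Adj u v → G'.Adj u v ∨ (u = x ∧ v = y) ∨ (u = y ∧ v = x) := by
    have h1 : s(x, y) = s(x₀, y₀) := by
      by_contra hne
      exact hyR (hR x hxR hxZ y (by simp only [hG', SimpleGraph.deleteEdges_adj]; exact ⟨hxy, hne⟩))
    intro u v e
    by_cases h2 : s(u, v) = s(x₀, y₀)
    · rw [← h1, Sym2.eq_iff] at h2
      exact .inr h2
    · exact .inl (by simp only [hG', SimpleGraph.deleteEdges_adj]; exact ⟨e, h2⟩)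
  have hyZ : y ∉ Z := fun h => hyR (hZR h)
  have hmZ : m ≤ Z.ncard + 1 := by
    rw [← Set.ncard_insert_of_notMem hxZ]
    refine h _ ⟨R, hAR, fun u hu huZ => ?_⟩
    rw [Set.mem_insert_iff, not_or] at huZ
    refine ⟨hRB u hu huZ.2, fun v e => ?_⟩
    rcases hadj u v e with e | ⟨rfl, -⟩ | ⟨rfl, -⟩
    · exact hR u hu huZ.2 v e
    · exact absurd rfl huZ.1
    · exact absurd hu hyR
  have hPc : (insert x Z).ncard = m := by rw [Set.ncard_insert_of_notMem hxZ]; omega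
  have hQc : (insert y Z).ncard = m := by rw [Set.ncard_insert_of_notMem hyZ]; omega
  obtain ⟨D, hD, hDd⟩ := ih G' hlt A (insert x Z) (by
    rintro Z₁ ⟨R₁, hA₁, hR₁⟩
    refine h _ ⟨R₁ ∩ R, Set.subset_inter hA₁ hAR, fun u hu huZ => ?_⟩
    obtain ⟨h1, h2⟩ := hR₁ u hu.1 huZ
    rw [Set.mem_insert_iff, not_or] at h1
    refine ⟨hRB u hu.2 h1.2, fun v e => ?_⟩
    rcases hadj u v e with e | ⟨rfl, -⟩ | ⟨rfl, -⟩
    · exact ⟨h2 v e, hR u hu.2 h1.2 v e⟩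
    · exact absurd rfl h1.1
    · exact absurd hu.2 hyR)
  obtain ⟨E, hE, hEd⟩ := ih G' hlt (insert y Z) B (by
    rintro Z₂ ⟨R₂, hA₂, hR₂⟩
    have hin : ∀ u ∈ R, u ∈ (R \ Z) ∪ R₂ := fun u hu => by
      by_cases h : u ∈ Z
      · exact .inr (hA₂ (Set.mem_insert_of_mem _ h))
      · exact .inl ⟨hu, h⟩
    refine h _ ⟨(R \ Z) ∪ R₂, fun u hu => hin u (hAR hu), fun u hu huZ => ?_⟩
    refine ⟨hu.elim (fun h => hRB u h.1 h.2) fun h => (hR₂ u h huZ).1, fun v e => ?_⟩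
    rcases hadj u v e with e | ⟨-, rfl⟩ | ⟨-, rfl⟩
    · exact hu.elim (fun h => hin v (hR u h.1 h.2 v e)) fun h => .inr ((hR₂ u h huZ).2 v e)
    · exact .inr (hA₂ (Set.mem_insert _ _))
    · exact .inl ⟨hxR, hxZ⟩)
  obtain ⟨p, hp, hps, hpu⟩ := exists_transversal hPc hDd fun i => (hD i).2.2
  obtain ⟨q, hq, hqs, hqu⟩ := exists_transversal hQc hEd fun i => (hE i).2.1
  have hDt := fun i => (hD i).1.exists_truncation (hD i).2.1 hAR (hp i).1 (hpu i)
    fun u hu huP => hR u hu fun h => huP (Set.mem_insert_of_mem _ h)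
  have hEt := fun i => (hE i).1.exists_truncation (R := (R \ Z)ᶜ) (hE i).2.2
    (fun b hb hbR => hRB b hbR.1 hbR.2 hb) (hq i).1 (hqu i)
    fun u hu huQ v e hv => hu ⟨hR v hv.1 hv.2 u e.symm, fun h => huQ (Set.mem_insert_of_mem _ h)⟩
  choose D' hD'D hD'R hD'c hD'A hpD' using hDt
  choose E' hsubE hE'R hE'c hE'B hqE' using hEt
  -- match the two systems of connectors
  have hmatch : ∀ i, ∃ j, (p i ∈ Z ∧ q j = p i) ∨ (p i = x ∧ q j = y) := by
    intro i
    rcases (hp i).2 with h | h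
    · obtain ⟨j, hj⟩ := hqs y (Set.mem_insert _ _)
      exact ⟨j, .inr ⟨h, hj⟩⟩
    · obtain ⟨j, hj⟩ := hqs (p i) (Set.mem_insert_of_mem _ h)
      exact ⟨j, .inl ⟨h, hj⟩⟩
  choose g hg using hmatch
  have hpinj : ∀ i j, p i = p j → i = j := by
    intro i j hij
    by_contra hne
    exact (hDd hne).le_bot ⟨(hp i).1, hij ▸ (hp j).1⟩
  have hginj : ∀ i j, g i = g j → i = j := by
    intro i j hij
    have hi := hg i
    have hj := hg j
    rw [hij] at hi
    apply hpinj
    rcases hi with ⟨h1, h2⟩ | ⟨h1, h2⟩ <;> rcases hj with ⟨h3, h4⟩ | ⟨h3, h4⟩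
    · rw [← h2, h4]
    · exact absurd (h4 ▸ h2 ▸ h1) hyZ
    · exact absurd (h2 ▸ h4 ▸ h3) hyZ
    · rw [h1, h3]
  have hcross : ∀ i j, i ≠ j → Disjoint (D' i) (E' (g j)) := by
    intro i j hij
    rw [Set.disjoint_left]
    intro z hzD hzE
    have hzZ : z ∈ Z := by
      by_contra h
      exact hE'R _ hzE ⟨hD'R i hzD, h⟩
    have h1 := hpu i z (hD'D i hzD) (Set.mem_insert_of_mem _ hzZ)
    have h2 := hqu (g j) z (hsubE _ hzE) (Set.mem_insert_of_mem _ hzZ)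
    rcases hg j with ⟨-, h4⟩ | ⟨-, h4⟩
    · exact hij (hpinj i j (by rw [← h1, h2, h4]))
    · exact hyZ (h4 ▸ h2 ▸ hzZ)
  refine ⟨fun i => D' i ∪ E' (g i), fun i => ⟨?_, ?_, ?_⟩, fun i j hij => ?_⟩
  · apply ((hD'c i).mono_graph hlt.le).union ((hE'c (g i)).mono_graph hlt.le)
    rcases hg i with ⟨-, h⟩ | ⟨h1, h2⟩
    · exact .inl ⟨p i, hpD' i, h ▸ hqE' (g i)⟩
    · exact .inr ⟨x, h1 ▸ hpD' i, y, h2 ▸ hqE' (g i), hxy⟩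
  · exact (hD'A i).mono (Set.inter_subset_inter_left _ Set.subset_union_left)
  · exact (hE'B (g i)).mono (Set.inter_subset_inter_left _ Set.subset_union_right)
  · dsimp only
    rw [Set.disjoint_union_left, Set.disjoint_union_right, Set.disjoint_union_right]
    exact ⟨⟨(hDd hij).mono (hD'D i) (hD'D j), hcross i j hij⟩, (hcross j i hij.symm).symm,
      (hEd fun h => hij (hginj i j h)).mono (hsubE _) (hsubE _)⟩

/-- The vertices of `l` are, in order, the vertices of a path of `G` inside `U`. -/
def IsPathList (G : SimpleGraph V) (U : Set V) (l : List V) : Prop :=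
  l.IsChain G.Adj ∧ l.Nodup ∧ ∀ v ∈ l, v ∈ U

/-- The list `l` meets the haven at every set of fewer than `m` vertices. -/
def Robust (β : Set V → Set V) (m : ℕ) (l : List V) : Prop :=
  ∀ Z : Set V, Z.ncard < m → ∃ v ∈ l, v ∈ β Z

/-- A path starting in `W` that avoids the haven at `W` but meets the haven at smaller sets. -/
def PathState (G : SimpleGraph V) (U : Set V) (β : Set V → Set V) (e : V) (l : List V)
    (W : Set V) : Prop :=
  IsPathList G U (e :: l) ∧ e ∈ W ∧ (∀ v ∈ e :: l, v ∉ β W) ∧ Robust β W.ncard (e :: l)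

theorem Haven.exists_adj [Finite V] {U : Set V} {t : ℕ} {β : Set V → Set V} (hβ : Haven G U t β)
    {e : V} {l : List V} {W : Set V} (h : PathState G U β e l W) (hW : W.ncard ≤ t) :
    ∃ u ∈ β W, G.Adj e u := by
  obtain ⟨-, heW, hav, hrob⟩ := h
  by_contra hcon
  push Not at hcon
  have hlt : (W \ {e}).ncard < W.ncard := Set.ncard_sdiff_singleton_lt_of_mem heW
  have hC := hβ.1 W hW
  have hC' := hβ.1 (W \ {e}) (by omega)
  have hcomp : IsComp G (U \ (W \ {e})) (β W) := by
    refine ⟨fun x hx => ⟨(hC.1 hx).1, fun h => (hC.1 hx).2 h.1⟩, hC.2.1, fun x hx y hy e' => ?_⟩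
    by_cases hye : y = e
    · subst hye
      exact absurd e'.symm (hcon x hx)
    · exact hC.2.2 x hx y ⟨hy.1, fun h => hy.2 ⟨h, hye⟩⟩ e'
  have hsub := hβ.2 (W \ {e}) W Set.sdiff_subset hW
  obtain ⟨z, hz⟩ := hC.2.1.1
  obtain ⟨v, hv, hvβ⟩ := hrob _ hlt
  rw [← hcomp.eq_of_inter hC' ⟨z, hz, hsub hz⟩] at hvβ
  exact hav v hv hvβ

theorem PathState.exists_longer [Finite V] {U : Set V} {t m : ℕ} {β : Set V → Set V}
    (hβ : Haven G U t β) (hmt : 2 * m ≤ t) {e : V} {l : List V} {W : Set V}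
    (h : PathState G U β e l W) (hW : W.ncard < m) :
    ∃ e' l' W', PathState G U β e' l' W' ∧ W'.ncard ≤ m ∧ l.length < l'.length := by
  obtain ⟨u, hu, heu⟩ := hβ.exists_adj h (by omega)
  obtain ⟨⟨hch, hnd, hU⟩, heW, hav, hrob⟩ := h
  have hC := hβ.1 W (by omega)
  have huU := hC.1 hu
  have hul : u ∉ e :: l := fun h => hav u h hu
  have hpath : IsPathList G U (u :: e :: l) := by
    refine ⟨List.isChain_cons_cons.2 ⟨heu.symm, hch⟩, List.nodup_cons.2 ⟨hul, hnd⟩, ?_⟩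
    intro v hv
    rcases List.mem_cons.1 hv with rfl | hv
    · exact huU.1
    · exact hU v hv
  by_cases hr : Robust β (W.ncard + 1) (u :: e :: l)
  · have hc : (insert u W).ncard = W.ncard + 1 := Set.ncard_insert_of_notMem huU.2
    refine ⟨u, e :: l, insert u W, ⟨hpath, Set.mem_insert _ _, ?_, hc ▸ hr⟩, by omega, by simp⟩
    intro v hv hvβ
    rcases List.mem_cons.1 hv with rfl | hv
    · exact ((hβ.1 (insert v W) (by omega)).1 hvβ).2 (Set.mem_insert _ _)
    · exact hav v hv (hβ.2 W _ (Set.subset_insert _ _) (by omega) hvβ)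
  simp only [Robust] at hr
  push Not at hr
  obtain ⟨W', hW'c, hW'⟩ := hr
  have hW'eq : W'.ncard = W.ncard := by
    by_contra hne
    obtain ⟨v, hv, hvβ⟩ := hrob W' (by omega)
    exact hW' v (List.mem_cons_of_mem _ hv) hvβ
  have hC' := hβ.1 W' (by omega)
  have hunion : (W ∪ W').ncard ≤ t := (Set.ncard_union_le _ _).trans (by omega)
  let S : Set V := {v | ∃ p : List V, (v :: (p ++ e :: l)).IsChain G.Adj ∧
    (v :: (p ++ e :: l)).Nodup ∧ ∀ w ∈ v :: p, w ∈ β W ∧ w ∉ β W'}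
  obtain ⟨z, hz⟩ := (hβ.1 _ hunion).2.1.1
  obtain ⟨x, ⟨hx, p, hp1, hp2, hp3⟩, y, ⟨hy, hyS⟩, hxy⟩ := hC.2.1.2 S
    ⟨u, hu, [], hpath.1, hpath.2.1, by
      intro w hw
      rw [List.mem_singleton] at hw
      subst hw
      exact ⟨hu, hW' w (List.mem_cons_self ..)⟩⟩
    ⟨z, hβ.2 _ _ Set.subset_union_left hunion hz, fun ⟨p, _, _, h3⟩ =>
      (h3 z (List.mem_cons_self ..)).2 (hβ.2 _ _ Set.subset_union_right hunion hz)⟩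
  have hyp : y ∉ x :: (p ++ e :: l) := by
    intro hmem
    rw [← List.cons_append, List.mem_append] at hmem
    rcases hmem with hmem | hmem
    · obtain ⟨a, b, hab⟩ := List.append_of_mem hmem
      have heq : x :: (p ++ e :: l) = a ++ (y :: (b ++ e :: l)) := by
        rw [← List.cons_append, hab]; simp
      rw [heq] at hp1 hp2
      refine hyS ⟨b, (List.isChain_append.1 hp1).2.1, (List.nodup_append.1 hp2).2.1, ?_⟩
      intro w hw
      exact hp3 w (hab ▸ List.mem_append_right a hw)
    · exact hav y hmem hy
  have hyβ : y ∈ β W' := by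
    by_contra hyn
    refine hyS ⟨x :: p, List.isChain_cons_cons.2 ⟨hxy.symm, hp1⟩, List.nodup_cons.2 ⟨hyp, hp2⟩, ?_⟩
    intro w hw
    rcases List.mem_cons.1 hw with rfl | hw
    · exact ⟨hy, hyn⟩
    · exact hp3 w hw
  have hxW' : x ∈ W' := by
    by_contra hxn
    exact (hp3 x (List.mem_cons_self ..)).2
      (hC'.2.2 y hyβ x ⟨(hC.1 hx).1, hxn⟩ hxy.symm)
  refine ⟨x, p ++ e :: l, W', ⟨⟨hp1, hp2, ?_⟩, hxW', ?_, ?_⟩, by omega, by simp; omega⟩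
  · intro v hv
    rw [← List.cons_append, List.mem_append] at hv
    rcases hv with hv | hv
    · exact (hC.1 (hp3 v hv).1).1
    · exact hU v hv
  · intro v hv
    rw [← List.cons_append, List.mem_append] at hv
    rcases hv with hv | hv
    · exact (hp3 v hv).2
    · exact hW' v (List.mem_cons_of_mem _ hv)
  · intro Z hZ
    obtain ⟨v, hv, hvβ⟩ := hrob Z (by omega)
    exact ⟨v, by rw [← List.cons_append, List.mem_append]; exact .inr hv, hvβ⟩

theorem Haven.exists_robust_path [Finite V] {U : Set V} {t m : ℕ} {β : Set V → Set V}
    (hβ : Haven G U t β) (hm : 1 ≤ m) (hmt : 2 * m ≤ t) :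
    ∃ l : List V, IsPathList G U l ∧ Robust β m l ∧
      ∃ W : Set V, W.ncard ≤ m ∧ ∀ v ∈ l, v ∉ β W := by
  by_contra hcon
  have hgrow : ∀ n : ℕ, ∃ e l W, PathState G U β e l W ∧ W.ncard ≤ m ∧ n ≤ l.length := by
    intro n
    induction n with
    | zero =>
      obtain ⟨v, hv⟩ := (hβ.1 ∅ (by simp)).2.1.1
      have h1 : ({v} : Set V).ncard = 1 := Set.ncard_singleton v
      refine ⟨v, [], {v}, ⟨⟨by simp, by simp, ?_⟩, rfl, ?_, ?_⟩, by omega, by simp⟩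
      · simpa using ((hβ.1 ∅ (by simp)).1 hv).1
      · intro w hw hwβ
        rw [List.mem_singleton] at hw
        subst hw
        exact ((hβ.1 {w} (by omega)).1 hwβ).2 rfl
      · intro Z hZ
        have : Z = ∅ := (Set.ncard_eq_zero (Set.toFinite Z)).1 (by omega)
        subst this
        exact ⟨v, by simp, hv⟩
    | succ n ih =>
      obtain ⟨e, l, W, hs, hW, hn⟩ := ih
      by_cases hlt : W.ncard < m
      · obtain ⟨e', l', W', hs', hW', hl⟩ := hs.exists_longer hβ hmt hlt
        exact ⟨e', l', W', hs', hW', by omega⟩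
      · have : W.ncard = m := by omega
        exact absurd ⟨e :: l, hs.1, this ▸ hs.2.2.2, W, hW, hs.2.2.1⟩ hcon
  have := Fintype.ofFinite V
  obtain ⟨e, l, W, hs, -, hn⟩ := hgrow (Fintype.card V)
  have := hs.1.2.1.length_le_card
  simp at this
  omega

theorem Haven.restrict [Finite V] {U W : Set V} {t m : ℕ} {β : Set V → Set V}
    (hβ : Haven G U t β) (hW : W.ncard ≤ m) (hmt : m ≤ t) :
    Haven G (β W) (t - m) fun Z => β (W ∪ Z) := by
  have hle : ∀ Z : Set V, Z.ncard ≤ t - m → (W ∪ Z).ncard ≤ t := fun Z hZ =>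
    (Set.ncard_union_le _ _).trans (by omega)
  refine ⟨fun Z hZ => ?_, fun Z Z' h hZ' => hβ.2 _ _ (Set.union_subset_union_right _ h) (hle _ hZ')⟩
  have hC := hβ.1 _ (hle Z hZ)
  refine ⟨fun x hx => ⟨hβ.2 _ _ Set.subset_union_left (hle Z hZ) hx,
    fun h => (hC.1 hx).2 (.inr h)⟩, hC.2.1, fun x hx y hy e => ?_⟩
  have hyU := (hβ.1 W (by omega)).1 hy.1
  exact hC.2.2 x hx y ⟨hyU.1, fun h => h.elim hyU.2 hy.2⟩ e

theorem Haven.exists_disjoint_robust_paths [Finite V] {U : Set V} {t m : ℕ} {β : Set V → Set V}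
    (hβ : Haven G U t β) (hm : 1 ≤ m) (q : ℕ) (hmt : (q + 1) * m ≤ t) :
    ∃ L : Fin q → List V, (∀ i, IsPathList G U (L i) ∧ Robust β m (L i)) ∧
      Pairwise fun i j => ∀ v ∈ L i, v ∉ L j := by
  induction q generalizing U t β with
  | zero => exact ⟨fun i => i.elim0, fun i => i.elim0, fun i => i.elim0⟩
  | succ q ih =>
    have h2 : (q + 1 + 1) * m = q * m + 2 * m := by ring
    have h3 : (q + 1) * m = q * m + m := by ring
    have h2m : 2 * m ≤ t := by nlinarith
    obtain ⟨l, hl, hlr, W, hW, hlW⟩ := hβ.exists_robust_path hm h2m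
    obtain ⟨L, hL, hLd⟩ := ih (hβ.restrict hW (by omega)) (by omega)
    have hWt : W.ncard ≤ t := by omega
    have hnot : ∀ i, ∀ v ∈ L i, v ∉ l := fun i v hv hvl => hlW v hvl ((hL i).1.2.2 v hv)
    refine ⟨Fin.cons l L, ?_, ?_⟩
    · refine Fin.cases ⟨hl, hlr⟩ fun i => ?_
      refine ⟨⟨(hL i).1.1, (hL i).1.2.1, fun v hv => ((hβ.1 W hWt).1 ((hL i).1.2.2 v hv)).1⟩, ?_⟩
      intro Z hZ
      obtain ⟨v, hv, hvβ⟩ := (hL i).2 Z hZ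
      exact ⟨v, hv, hβ.2 _ _ Set.subset_union_right
        ((Set.ncard_union_le _ _).trans (by omega)) hvβ⟩
    · intro i j
      refine Fin.cases ?_ (fun i => ?_) i <;> refine Fin.cases ?_ (fun j => ?_) j
      · simp
      · exact fun _ v hv hv' => hnot j v hv' hv
      · exact fun _ v hv => hnot i v hv
      · exact fun h => hLd fun h' => h (congrArg _ h')

theorem Haven.le_ncard_of_separates {U : Set V} {t m : ℕ} {β : Set V → Set V}
    (hβ : Haven G U t β) (hmt : m ≤ t) {l l' : List V} (hl : Robust β m l) (hl' : Robust β m l')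
    {Z : Set V} (hZ : Separates G {v | v ∈ l} {v | v ∈ l'} Z) : m ≤ Z.ncard := by
  obtain ⟨R, hR, hRc⟩ := hZ
  by_contra hlt
  push Not at hlt
  have hC := hβ.1 Z (by omega)
  obtain ⟨a, ha, haβ⟩ := hl Z hlt
  obtain ⟨b, hb, hbβ⟩ := hl' Z hlt
  obtain ⟨x, hx, y, hy, e⟩ := hC.2.1.2 R ⟨a, haβ, hR ha⟩
    ⟨b, hbβ, fun h => (hRc b h (hC.1 hbβ).2).1 hb⟩
  exact hy.2 ((hRc x hx.2 (hC.1 hx.1).2).2 y e)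

/-- The nodes of the complete `k`-ary tree of depth three. -/
inductive Node (k : ℕ) : Type
  | root : Node k
  | mid (i : Fin k) : Node k
  | leaf (i r : Fin k) : Node k

/-- A minor model of the tree-like graph in which every leaf is adjacent to the root and to its
parent. -/
def FatModel (G : SimpleGraph V) (k : ℕ) (X : Node k → Set V) : Prop :=
  (∀ a, Conn G (X a)) ∧ (Pairwise fun a b => Disjoint (X a) (X b)) ∧
    ∀ i r, Touch G (X (.leaf i r)) (X .root) ∧ Touch G (X (.leaf i r)) (X (.mid i))

/-- Sacrificing one leaf below each node of depth two, a fat model contains a model of the closure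
of the complete `k`-ary tree of depth three. -/
theorem FatModel.exists_closure_model {k : ℕ} {X : Node (k + 1) → Set V}
    (hX : FatModel G (k + 1) X) :
    ∃ Y : Node k → Set V, (∀ a, Conn G (Y a)) ∧ (∀ a, Y a ⊆ ⋃ b, X b) ∧
      (Pairwise fun a b => Disjoint (Y a) (Y b)) ∧
      ∀ i r, Touch G (Y .root) (Y (.mid i)) ∧ Touch G (Y .root) (Y (.leaf i r)) ∧
        Touch G (Y (.mid i)) (Y (.leaf i r)) := by
  obtain ⟨hc, hd, ht⟩ := hX
  let Y : Node k → Set V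
    | .root => X .root
    | .mid i => X (.mid i.castSucc) ∪ X (.leaf i.castSucc (Fin.last k))
    | .leaf i r => X (.leaf i.castSucc r.castSucc)
  have hne : ∀ r : Fin k, r.castSucc ≠ Fin.last k := fun r => (Fin.castSucc_lt_last r).ne
  have hdis : ∀ a b, a ≠ b → Disjoint (Y a) (Y b) := by
    intro a b hab
    rcases a with _ | i | ⟨i, r⟩ <;> rcases b with _ | j | ⟨j, s⟩
    · exact absurd rfl hab
    · exact Set.disjoint_union_right.2 ⟨hd (by simp), hd (by simp)⟩
    · exact hd (by simp)
    · exact Set.disjoint_union_left.2 ⟨hd (by simp), hd (by simp)⟩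
    · have hij : i ≠ j := fun h => hab (by rw [h])
      exact Set.disjoint_union_left.2 ⟨Set.disjoint_union_right.2
        ⟨hd (by simpa using hij), hd (by simp)⟩, Set.disjoint_union_right.2
        ⟨hd (by simp), hd (by simpa using hij)⟩⟩
    · exact Set.disjoint_union_left.2 ⟨hd (by simp), hd (by
        simp [(hne s).symm])⟩
    · exact hd (by simp)
    · exact Set.disjoint_union_right.2 ⟨hd (by simp), hd (by simp [hne r])⟩
    · exact hd (by simpa using hab)
  refine ⟨Y, ?_, ?_, hdis, fun i r => ⟨?_, ?_, ?_⟩⟩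
  · rintro (_ | i | ⟨i, r⟩)
    · exact hc _
    · exact (hc _).union (hc _) (.inr (ht _ _).2.symm)
    · exact hc _
  · rintro (_ | i | ⟨i, r⟩)
    · exact Set.subset_iUnion X _
    · exact Set.union_subset (Set.subset_iUnion X _) (Set.subset_iUnion X _)
    · exact Set.subset_iUnion X _
  · exact (ht i.castSucc (Fin.last k)).1.symm.mono subset_rfl Set.subset_union_right
  · exact (ht _ _).1.symm
  · exact (ht _ _).2.symm.mono Set.subset_union_left subset_rfl

theorem exists_isSubgraphEmb_closureTree {W : Type} [Finite W] (H : SimpleGraph W) :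
    ∃ h, IsSubgraphEmb H (closureTree h (Nat.card W)) := by
  rcases isEmpty_or_nonempty W with hW | ⟨⟨w₀⟩⟩
  · exact ⟨0, fun w => hW.elim w, fun w => hW.elim w, fun w => hW.elim w⟩
  let e := Finite.equivFin W
  have hinj : Function.Injective fun w =>
      (⟨List.replicate (e w) (e w₀), by simp⟩ :
        {l : List (Fin (Nat.card W)) // l.length < Nat.card W}) := by
    intro a b hab
    have := congrArg (fun l => l.1.length) hab
    simp only [List.length_replicate] at this
    exact e.injective (Fin.ext this)
  refine ⟨Nat.card W, _, hinj, fun a b hab => ?_⟩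
  rw [closureTree, SimpleGraph.fromRel_adj]
  refine ⟨fun h => hab.ne (hinj h), ?_⟩
  rcases le_total (e a).val (e b).val with h | h
  · exact .inl (by simpa using List.prefix_replicate_iff.2 ⟨by simpa using h, by simp⟩)
  · exact .inr (by simpa using List.prefix_replicate_iff.2 ⟨by simpa using h, by simp⟩)

/-- The node of the complete `k`-ary tree of depth three described by a list. -/
def toNode {c k : ℕ} (h : c ≤ k) : List (Fin c) → Node k
  | [] => .root
  | [i] => .mid (i.castLE h)
  | i :: r :: _ => .leaf (i.castLE h) (r.castLE h)

theorem toNode_injOn {c k : ℕ} (h : c ≤ k) {u v : List (Fin c)} (hu : u.length < 3)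
    (hv : v.length < 3) (huv : toNode h u = toNode h v) : u = v := by
  rcases u with _ | ⟨i, _ | ⟨r, _ | ⟨x, u⟩⟩⟩ <;> rcases v with _ | ⟨j, _ | ⟨s, _ | ⟨y, v⟩⟩⟩ <;>
    simp_all [toNode] <;> omega

theorem touch_toNode_of_prefix {c k : ℕ} (h : c ≤ k) {Y : Node k → Set V}
    (hY : ∀ i r, Touch G (Y .root) (Y (.mid i)) ∧ Touch G (Y .root) (Y (.leaf i r)) ∧
        Touch G (Y (.mid i)) (Y (.leaf i r))) {u v : List (Fin c)} (hv : v.length < 3)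
    (hne : u ≠ v) (huv : u <+: v) : Touch G (Y (toNode h u)) (Y (toNode h v)) := by
  rcases v with _ | ⟨j, _ | ⟨s, _ | ⟨y, v⟩⟩⟩ <;> rcases u with _ | ⟨i, _ | ⟨r, _ | ⟨x, u⟩⟩⟩ <;>
    simp_all [toNode]
  · exact (hY _ (j.castLE h)).1
  · omega
  · omega

/-- A graph of tree-depth at most three is a minor of every graph with enough disjoint fat
models. -/
theorem exists_isMinor_of_fatModels {U : Type} [Finite U] (H : SimpleGraph U)
    (htd : treeDepth H ≤ 3) : ∃ n k : ℕ, 0 < k ∧ ∀ (V : Type) (G : SimpleGraph V)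
      (X : Fin n → Node k → Set V), (∀ j, FatModel G k (X j)) →
      (∀ j j', j ≠ j' → ∀ a b, Disjoint (X j a) (X j' b)) → IsMinor H G := by
  refine ⟨Nat.card H.ConnectedComponent, Nat.card U + 1, by omega, fun V G X hX hd => ?_⟩
  have hemb : ∀ C : H.ConnectedComponent, ∃ f : C.supp → List (Fin (Nat.card C.supp)),
      (∀ a, (f a).length < 3) ∧ Function.Injective f ∧
        ∀ a b, H.Adj a.1 b.1 → f a ≠ f b ∧ (f a <+: f b ∨ f b <+: f a) := by
    intro C
    have hle : ctd (H.induce C.supp) ≤ 3 := by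
      refine le_trans (le_csSup ?_ (Set.mem_ofPred.2 ⟨C, rfl⟩)) htd
      have : {n : ℕ | ∃ C : H.ConnectedComponent, n = ctd (H.induce C.supp)} =
          Set.range fun C : H.ConnectedComponent => ctd (H.induce C.supp) := by
        ext n; simp [eq_comm]
      rw [this]
      exact (Set.finite_range _).bddAbove
    have hmem : IsSubgraphEmb (H.induce C.supp)
        (closureTree (ctd (H.induce C.supp)) (Nat.card C.supp)) :=
      Nat.sInf_mem (exists_isSubgraphEmb_closureTree (H.induce C.supp))
    obtain ⟨f, hf, hadj⟩ := hmem
    refine ⟨fun a => (f a).1, fun a => (f a).2.trans_le hle,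
      fun a b h => hf (Subtype.ext h), fun a b hab => ?_⟩
    have := hadj a b (by simpa using hab)
    rw [closureTree, SimpleGraph.fromRel_adj] at this
    exact ⟨fun h => this.1 (Subtype.ext h), this.2⟩
  choose f hlen hinj hadj using hemb
  have hcard : ∀ C : H.ConnectedComponent, Nat.card C.supp ≤ Nat.card U := fun C =>
    Nat.card_le_card_of_injective _ Subtype.val_injective
  have hY := fun j => (hX j).exists_closure_model
  choose Y hYc hYs hYd hYt using hY
  let e := Finite.equivFin H.ConnectedComponent
  let B : (C : H.ConnectedComponent) → C.supp → Set V := fun C a =>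
    Y (e C) (toNode (hcard C) (f C a))
  have hcross : ∀ C C' a b, C ≠ C' → Disjoint (B C a) (B C' b) := by
    intro C C' a b hne
    refine Disjoint.mono (hYs _ _) (hYs _ _) ?_
    rw [Set.disjoint_iUnion_left]
    intro a'
    rw [Set.disjoint_iUnion_right]
    exact fun b' => hd _ _ (fun h => hne (e.injective h)) _ _
  have hB : ∀ (u : U) (C : H.ConnectedComponent) (h : H.connectedComponentMk u = C),
      B (H.connectedComponentMk u) ⟨u, rfl⟩ = B C ⟨u, h⟩ := by
    rintro u _ rfl; rfl
  refine ⟨fun u => B (H.connectedComponentMk u) ⟨u, rfl⟩, fun u => ?_, fun u v huv => ?_,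
    fun u v huv => ?_⟩
  · exact conn_iff_induce_connected.1 (hYc _ _)
  · by_cases hC : H.connectedComponentMk u = H.connectedComponentMk v
    · have hvu : ∀ (C : H.ConnectedComponent) (a b : C.supp), a ≠ b →
          Disjoint (B C a) (B C b) := fun C a b hab => hYd _ fun h =>
        hab (hinj C (toNode_injOn _ (hlen C a) (hlen C b) h))
      dsimp only
      rw [hB u _ hC]
      exact hvu _ _ _ fun h => huv (congrArg Subtype.val h)
    · exact hcross _ _ _ _ hC
  · have hC : H.connectedComponentMk u = H.connectedComponentMk v :=
      SimpleGraph.ConnectedComponent.sound huv.reachable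
    have ht : ∀ (C : H.ConnectedComponent) (a b : C.supp), H.Adj a.1 b.1 →
        Touch G (B C a) (B C b) := by
      intro C a b hab
      obtain ⟨hne, h | h⟩ := hadj C a b hab
      · exact touch_toNode_of_prefix _ (hYt _) (hlen C b) hne h
      · exact (touch_toNode_of_prefix _ (hYt _) (hlen C a) hne.symm h).symm
    dsimp only
    rw [hB u _ hC]
    exact ht _ _ _ huv

/-- A form of the Erdős–Szekeres theorem. -/
theorem exists_monotone_list {ι : Type} (α γ : ι → ℕ) (hα : Function.Injective α)
    (hγ : Function.Injective γ) (a b : ℕ) (T : Finset ι) (hT : 2 ^ (a + b) ≤ T.card) :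
    (∃ L : List ι, L.length = a ∧ (∀ x ∈ L, x ∈ T) ∧
      L.Pairwise fun x y => α x < α y ∧ γ x < γ y) ∨
    ∃ L : List ι, L.length = b ∧ (∀ x ∈ L, x ∈ T) ∧
      L.Pairwise fun x y => α x < α y ∧ γ y < γ x := by
  classical
  induction hn : a + b generalizing a b T with
  | zero => exact .inl ⟨[], by simp; omega, by simp, by simp⟩
  | succ n ih =>
    rcases a with _ | a
    · exact .inl ⟨[], by simp, by simp, by simp⟩
    rcases b with _ | b
    · exact .inr ⟨[], by simp, by simp, by simp⟩
    have hpos : T.Nonempty := Finset.card_pos.1 (lt_of_lt_of_le (by positivity) hT)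
    obtain ⟨x, hxT, hx⟩ := T.exists_min_image α hpos
    have hlt : ∀ y ∈ T.erase x, α x < α y := fun y hy =>
      lt_of_le_of_ne (hx y (Finset.mem_of_mem_erase hy)) fun h =>
        Finset.ne_of_mem_erase hy (hα h).symm
    have hsplit := Finset.card_filter_add_card_filter_not (s := T.erase x) fun y => γ x < γ y
    have hcard := Finset.card_erase_of_mem hxT
    have hpow : 2 ^ (a + 1 + (b + 1)) = 2 * 2 ^ n := by rw [hn, pow_succ]; ring
    by_cases hbig : 2 ^ n ≤ ((T.erase x).filter fun y => γ x < γ y).card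
    · rcases ih a (b + 1) _ (by rwa [show a + (b + 1) = n by omega]) (by omega) with
        ⟨L, h1, h2, h3⟩ | ⟨L, h1, h2, h3⟩
      · refine .inl ⟨x :: L, by simp [h1], ?_, List.pairwise_cons.2 ⟨fun y hy => ?_, h3⟩⟩
        · intro y hy
          rcases List.mem_cons.1 hy with rfl | hy
          · exact hxT
          · exact Finset.mem_of_mem_erase (Finset.mem_filter.1 (h2 y hy)).1
        · have := Finset.mem_filter.1 (h2 y hy)
          exact ⟨hlt y this.1, this.2⟩
      · exact .inr ⟨L, h1, fun y hy =>
          Finset.mem_of_mem_erase (Finset.mem_filter.1 (h2 y hy)).1, h3⟩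
    · rcases ih (a + 1) b ((T.erase x).filter fun y => ¬ γ x < γ y)
        (by rw [show a + 1 + b = n by omega]; omega) (by omega) with
        ⟨L, h1, h2, h3⟩ | ⟨L, h1, h2, h3⟩
      · exact .inl ⟨L, h1, fun y hy =>
          Finset.mem_of_mem_erase (Finset.mem_filter.1 (h2 y hy)).1, h3⟩
      · refine .inr ⟨x :: L, by simp [h1], ?_, List.pairwise_cons.2 ⟨fun y hy => ?_, h3⟩⟩
        · intro y hy
          rcases List.mem_cons.1 hy with rfl | hy
          · exact hxT
          · exact Finset.mem_of_mem_erase (Finset.mem_filter.1 (h2 y hy)).1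
        · have := Finset.mem_filter.1 (h2 y hy)
          refine ⟨hlt y this.1, lt_of_le_of_ne (not_lt.1 this.2) fun h => ?_⟩
          exact Finset.ne_of_mem_erase this.1 (hγ h)

/-- `p 0, …, p (N - 1)` is a path of `G`. -/
def IsPathSeq (G : SimpleGraph V) (p : ℕ → V) (N : ℕ) : Prop :=
  (∀ x, x + 1 < N → G.Adj (p x) (p (x + 1))) ∧ ∀ x < N, ∀ y < N, p x = p y → x = y

theorem IsPathList.exists_isPathSeq {U : Set V} {l : List V} (h : IsPathList G U l)
    (hl : l ≠ []) : ∃ p : ℕ → V, IsPathSeq G p l.length ∧ ∀ v, v ∈ l ↔ ∃ x < l.length, p x = v := by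
  obtain ⟨hc, hn, -⟩ := h
  have hp : ∀ x (hx : x < l.length), l.getD x (l.head hl) = l[x] := fun x hx => by simp [hx]
  refine ⟨fun x => l.getD x (l.head hl), ⟨fun x hx => ?_, fun x hx y hy hxy => ?_⟩, fun v => ?_⟩
  · dsimp only
    rw [hp x (by omega), hp (x + 1) hx]
    exact List.isChain_iff_getElem.1 hc x hx
  · dsimp only at hxy
    rw [hp x hx, hp y hy] at hxy
    exact (List.Nodup.getElem_inj_iff hn).1 hxy
  · rw [List.mem_iff_getElem]
    exact ⟨fun ⟨x, hx, h⟩ => ⟨x, hx, (hp x hx).trans h⟩,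
      fun ⟨x, hx, h⟩ => ⟨x, hx, (hp x hx).symm.trans h⟩⟩

/-- The vertices of the path `p` between vertices with positions in `P`. -/
def pathHull (p : ℕ → V) (P : Set ℕ) : Set V :=
  {v | ∃ x, p x = v ∧ ∃ a ∈ P, ∃ b ∈ P, a ≤ x ∧ x ≤ b}

theorem IsPathSeq.conn_segment {p : ℕ → V} {N : ℕ} (hp : IsPathSeq G p N) (a d : ℕ)
    (h : a + d < N) : Conn G {v | ∃ x, p x = v ∧ a ≤ x ∧ x ≤ a + d} := by
  induction d with
  | zero =>
    convert conn_singleton (G := G) (p a) using 1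
    ext v
    constructor
    · rintro ⟨x, rfl, h1, h2⟩
      obtain rfl : x = a := by omega
      rfl
    · rintro rfl
      exact ⟨a, rfl, le_rfl, le_rfl⟩
  | succ d ih =>
    have := (ih (by omega)).union (conn_singleton (p (a + d + 1)))
      (.inr ⟨p (a + d), ⟨a + d, rfl, by omega, le_rfl⟩, _, rfl, hp.1 _ (by omega)⟩)
    convert this using 1
    ext v
    constructor
    · rintro ⟨x, rfl, h1, h2⟩
      rcases Nat.lt_or_ge (a + d) x with h | h
      · obtain rfl : x = a + d + 1 := by omega
        exact .inr rfl
      · exact .inl ⟨x, rfl, h1, h⟩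
    · rintro (⟨x, rfl, h1, h2⟩ | rfl)
      · exact ⟨x, rfl, h1, by omega⟩
      · exact ⟨_, rfl, by omega, by omega⟩

theorem IsPathSeq.conn_pathHull {p : ℕ → V} {N : ℕ} (hp : IsPathSeq G p N) {P : Set ℕ}
    (hP : P.Nonempty) (hPN : ∀ a ∈ P, a < N) : Conn G (pathHull p P) := by
  obtain ⟨c, hc⟩ := hP
  have := conn_biUnion_of_mem (G := G) (a := p c)
    (F := {K | ∃ a ∈ P, ∃ b ∈ P, a ≤ c ∧ c ≤ b ∧ K = {v | ∃ x, p x = v ∧ a ≤ x ∧ x ≤ b}})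
    ⟨_, c, hc, c, hc, le_rfl, le_rfl, rfl⟩ (by
      rintro K ⟨a, ha, b, hb, hac, hcb, rfl⟩
      obtain ⟨d, rfl⟩ := Nat.exists_eq_add_of_le (hac.trans hcb)
      exact ⟨hp.conn_segment a d (hPN _ hb), c, rfl, hac, hcb⟩)
  convert this using 1
  ext v
  constructor
  · rintro ⟨x, rfl, a, ha, b, hb, hax, hxb⟩
    rcases le_total x c with h | h
    · exact ⟨_, ⟨a, ha, c, hc, by omega, le_rfl, rfl⟩, x, rfl, hax, h⟩
    · exact ⟨_, ⟨c, hc, b, hb, le_rfl, by omega, rfl⟩, x, rfl, h, hxb⟩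
  · rintro ⟨_, ⟨a, ha, b, hb, -, -, rfl⟩, x, rfl, h1, h2⟩
    exact ⟨x, rfl, a, ha, b, hb, h1, h2⟩

theorem mem_pathHull {p : ℕ → V} {P : Set ℕ} {a : ℕ} (ha : a ∈ P) : p a ∈ pathHull p P :=
  ⟨a, rfl, a, ha, a, ha, le_rfl, le_rfl⟩

theorem pathHull_subset {p : ℕ → V} {N : ℕ} {P : Set ℕ} (hP : ∀ a ∈ P, a < N) :
    pathHull p P ⊆ {v | ∃ x < N, p x = v} := by
  rintro _ ⟨x, rfl, a, -, b, hb, -, hxb⟩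
  exact ⟨x, hxb.trans_lt (hP b hb), rfl⟩

theorem IsPathSeq.disjoint_pathHull {p : ℕ → V} {N : ℕ} (hp : IsPathSeq G p N) {P Q : Set ℕ}
    (hP : ∀ a ∈ P, a < N) (hQ : ∀ a ∈ Q, a < N) (h : ∀ a ∈ P, ∀ b ∈ Q, a < b) :
    Disjoint (pathHull p P) (pathHull p Q) := by
  rw [Set.disjoint_left]
  rintro _ ⟨x, rfl, a, -, b, hb, -, hxb⟩ ⟨y, hxy, c, hc, d, hd, hcy, hyd⟩
  have := h b hb c hc
  have := hp.2 y (hyd.trans_lt (hQ d hd)) x (hxb.trans_lt (hP b hb)) hxy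
  omega

/-- A connected set meeting two anticomplete sets contains a connected set between them. -/
theorem Conn.exists_between {D A B : Set V} (hD : Conn G D) (hA : (D ∩ A).Nonempty)
    (hB : (D ∩ B).Nonempty) (hAB : Disjoint A B) (hn : ¬ Touch G A B) :
    ∃ K ⊆ D, Disjoint K A ∧ Disjoint K B ∧ Conn G K ∧ Touch G K (A ∩ D) ∧ Touch G K (B ∩ D) := by
  obtain ⟨a, haD, haA⟩ := hA
  obtain ⟨b, hbD, hbB⟩ := hB
  let S : Set V := {x | x ∈ A ∨ ∃ K ⊆ D, Disjoint K A ∧ Disjoint K B ∧ Conn G K ∧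
    Touch G K (A ∩ D) ∧ x ∈ K}
  have hbS : b ∉ S := by
    rintro (h | ⟨K, -, -, h, -, -, hbK⟩)
    · exact hAB.le_bot ⟨h, hbB⟩
    · exact h.le_bot ⟨hbK, hbB⟩
  obtain ⟨x, ⟨hxD, hxS⟩, y, ⟨hyD, hyS⟩, e⟩ := hD.2 S ⟨a, haD, .inl haA⟩ ⟨b, hbD, hbS⟩
  have hyA : y ∉ A := fun h => hyS (.inl h)
  rcases hxS with hxA | ⟨K, hKD, hKA, hKB, hKc, hKt, hxK⟩
  · have hyB : y ∉ B := fun h => hn ⟨x, hxA, y, h, e⟩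
    exact absurd (.inr ⟨{y}, by simpa using hyD, by simpa using hyA, by simpa using hyB,
      conn_singleton y, ⟨y, rfl, x, ⟨hxA, hxD⟩, e.symm⟩, rfl⟩) hyS
  · by_cases hyB : y ∈ B
    · exact ⟨K, hKD, hKA, hKB, hKc, hKt, x, hxK, y, ⟨hyB, hyD⟩, e⟩
    · exact absurd (.inr ⟨K ∪ {y}, Set.union_subset hKD (by simpa using hyD),
        Set.disjoint_union_left.2 ⟨hKA, by simpa using hyA⟩,
        Set.disjoint_union_left.2 ⟨hKB, by simpa using hyB⟩,
        hKc.union (conn_singleton y) (.inr ⟨x, hxK, y, rfl, e⟩),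
        hKt.mono Set.subset_union_left subset_rfl, .inr rfl⟩) hyS

theorem lex_lt {N a a' j j' : ℕ} (ha : a < N) (h : j < j') : a + N * j < a' + N * j' := by
  have : N * (j + 1) ≤ N * j' := Nat.mul_le_mul_left _ h
  rw [mul_add] at this
  omega

/-- The number of connectors between two paths forcing `n` disjoint fat models. -/
def connectorBound (n k : ℕ) : ℕ := 2 ^ (n * (k * k) + n * (k * k))

/-- Many disjoint connectors between two anticomplete paths give many disjoint fat models. -/
theorem exists_fatModels_of_connectors {n k : ℕ} (hk : 0 < k) {p p' : ℕ → V} {N N' : ℕ}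
    (hp : IsPathSeq G p N) (hp' : IsPathSeq G p' N')
    (hdis : Disjoint {v | ∃ x < N, p x = v} {v | ∃ x < N', p' x = v})
    (hnt : ¬ Touch G {v | ∃ x < N, p x = v} {v | ∃ x < N', p' x = v})
    {D : Fin (connectorBound n k) → Set V}
    (hD : ∀ i, Conn G (D i) ∧ (D i ∩ {v | ∃ x < N, p x = v}).Nonempty ∧
      (D i ∩ {v | ∃ x < N', p' x = v}).Nonempty)
    (hDd : Pairwise fun i j => Disjoint (D i) (D j)) :
    ∃ X : Fin n → Node k → Set V, (∀ j, FatModel G k (X j)) ∧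
      ∀ j j', j ≠ j' → ∀ a b, Disjoint (X j a) (X j' b) := by
  have hK := fun i => (hD i).1.exists_between (hD i).2.1 (hD i).2.2 hdis hnt
  choose K hKD hKA hKB hKc hKtA hKtB using hK
  have hα : ∀ i, ∃ x < N, p x ∈ D i ∧ Touch G (K i) {p x} := by
    intro i
    obtain ⟨u, hu, _, ⟨⟨x, hx, rfl⟩, hxD⟩, e⟩ := hKtA i
    exact ⟨x, hx, hxD, u, hu, _, rfl, e⟩
  have hγ : ∀ i, ∃ x < N', p' x ∈ D i ∧ Touch G (K i) {p' x} := by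
    intro i
    obtain ⟨u, hu, _, ⟨⟨x, hx, rfl⟩, hxD⟩, e⟩ := hKtB i
    exact ⟨x, hx, hxD, u, hu, _, rfl, e⟩
  choose α hαN hαD hαt using hα
  choose γ hγN hγD hγt using hγ
  have hαi : Function.Injective α := by
    intro i j h
    by_contra hne
    exact (hDd hne).le_bot ⟨hαD i, h ▸ hαD j⟩
  have hγi : Function.Injective γ := by
    intro i j h
    by_contra hne
    exact (hDd hne).le_bot ⟨hγD i, h ▸ hγD j⟩
  -- a long subsequence, ordered along both paths
  obtain ⟨c, hcα, hcγ⟩ : ∃ c : Fin (n * (k * k)) → Fin (connectorBound n k),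
      (∀ x y, x < y → α (c x) < α (c y)) ∧
      ((∀ x y, x < y → γ (c x) < γ (c y)) ∨ ∀ x y, x < y → γ (c y) < γ (c x)) := by
    rcases exists_monotone_list α γ hαi hγi (n * (k * k)) (n * (k * k)) Finset.univ
      (by rw [Finset.card_univ, Fintype.card_fin, connectorBound]) with
      ⟨L, hL, -, hLp⟩ | ⟨L, hL, -, hLp⟩
    · rw [List.pairwise_iff_getElem] at hLp
      have hlen : ∀ x : Fin (n * (k * k)), x.1 < L.length := fun x => by omega
      exact ⟨fun x => L.get ⟨x.1, hlen x⟩, fun x y h => (hLp _ _ (hlen x) (hlen y) h).1,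
        .inl fun x y h => (hLp _ _ (hlen x) (hlen y) h).2⟩
    · rw [List.pairwise_iff_getElem] at hLp
      have hlen : ∀ x : Fin (n * (k * k)), x.1 < L.length := fun x => by omega
      exact ⟨fun x => L.get ⟨x.1, hlen x⟩, fun x y h => (hLp _ _ (hlen x) (hlen y) h).1,
        .inr fun x y h => (hLp _ _ (hlen x) (hlen y) h).2⟩
  let ix : Fin n → Fin k → Fin k → Fin (n * (k * k)) := fun j i r =>
    finProdFinEquiv (j, finProdFinEquiv (i, r))
  have hixj : ∀ {j j' i i' r r'}, j < j' → ix j i r < ix j' i' r' := by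
    intro j j' i i' r r' h
    exact lex_lt (finProdFinEquiv (i, r)).2 h
  have hixi : ∀ {j i i' r r'}, i < i' → ix j i r < ix j i' r' := by
    intro j i i' r r' h
    exact Nat.add_lt_add_right (lex_lt r.2 h) _
  have hixinj : ∀ {j i r j' i' r'}, ix j i r = ix j' i' r' → j = j' ∧ i = i' ∧ r = r' := by
    intro j i r j' i' r' h
    simpa [ix] using h
  have hcinj : Function.Injective c := by
    intro x y h
    by_contra hne
    rcases lt_or_gt_of_ne hne with h' | h'
    · exact absurd (hcα _ _ h') (by rw [h]; exact lt_irrefl _)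
    · exact absurd (hcα _ _ h') (by rw [h]; exact lt_irrefl _)
  let PA : Fin n → Set ℕ := fun j => {x | ∃ i r, α (c (ix j i r)) = x}
  let PB : Fin n → Fin k → Set ℕ := fun j i => {x | ∃ r, γ (c (ix j i r)) = x}
  have hPA : ∀ j, ∀ a ∈ PA j, a < N := by
    rintro j _ ⟨i, r, rfl⟩; exact hαN _
  have hPB : ∀ j i, ∀ a ∈ PB j i, a < N' := by
    rintro j i _ ⟨r, rfl⟩; exact hγN _
  have hRR : ∀ j j', j ≠ j' → Disjoint (pathHull p (PA j)) (pathHull p (PA j')) := by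
    have key : ∀ j j', j < j' → Disjoint (pathHull p (PA j)) (pathHull p (PA j')) := by
      intro j j' h
      refine hp.disjoint_pathHull (hPA j) (hPA j') ?_
      rintro _ ⟨i, r, rfl⟩ _ ⟨i', r', rfl⟩
      exact hcα _ _ (hixj h)
    intro j j' h
    rcases lt_or_gt_of_ne h with h | h
    · exact key _ _ h
    · exact (key _ _ h).symm
  have hMM : ∀ j i j' i', ¬ (j = j' ∧ i = i') →
      Disjoint (pathHull p' (PB j i)) (pathHull p' (PB j' i')) := by
    have key : ∀ j i j' i', (∀ r r', ix j i r < ix j' i' r') →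
        Disjoint (pathHull p' (PB j i)) (pathHull p' (PB j' i')) := by
      intro j i j' i' h
      rcases hcγ with hc | hc
      · refine hp'.disjoint_pathHull (hPB j i) (hPB j' i') ?_
        rintro _ ⟨r, rfl⟩ _ ⟨r', rfl⟩
        exact hc _ _ (h r r')
      · refine (hp'.disjoint_pathHull (hPB j' i') (hPB j i) ?_).symm
        rintro _ ⟨r, rfl⟩ _ ⟨r', rfl⟩
        exact hc _ _ (h r' r)
    intro j i j' i' h
    rcases lt_trichotomy j j' with hj | rfl | hj
    · exact key _ _ _ _ fun r r' => hixj hj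
    · rcases lt_or_gt_of_ne (fun hi => h ⟨rfl, hi⟩) with hi | hi
      · exact key _ _ _ _ fun r r' => hixi hi
      · exact (key _ _ _ _ fun r r' => hixi hi).symm
    · exact (key _ _ _ _ fun r r' => hixj hj).symm
  have hRM : ∀ j j' i, Disjoint (pathHull p (PA j)) (pathHull p' (PB j' i)) := fun j j' i =>
    hdis.mono (pathHull_subset (hPA j)) (pathHull_subset (hPB j' i))
  have hRL : ∀ j x, Disjoint (pathHull p (PA j)) (K x) := fun j x =>
    (hKA x).symm.mono (pathHull_subset (hPA j)) subset_rfl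
  have hML : ∀ j i x, Disjoint (pathHull p' (PB j i)) (K x) := fun j i x =>
    (hKB x).symm.mono (pathHull_subset (hPB j i)) subset_rfl
  let X : Fin n → Node k → Set V := fun j a => match a with
    | .root => pathHull p (PA j)
    | .mid i => pathHull p' (PB j i)
    | .leaf i r => K (c (ix j i r))
  have hX : ∀ j a j' b, ¬ (j = j' ∧ a = b) → Disjoint (X j a) (X j' b) := by
    intro j a j' b hne
    rcases a with _ | i | ⟨i, r⟩ <;> rcases b with _ | i' | ⟨i', r'⟩
    · exact hRR j j' fun h => hne ⟨h, rfl⟩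
    · exact hRM _ _ _
    · exact hRL _ _
    · exact (hRM _ _ _).symm
    · exact hMM _ _ _ _ fun h => hne ⟨h.1, by rw [h.2]⟩
    · exact hML _ _ _
    · exact (hRL _ _).symm
    · exact (hML _ _ _).symm
    · refine (hDd fun h => hne ?_).mono (hKD _) (hKD _)
      obtain ⟨h1, h2, h3⟩ := hixinj (hcinj h)
      exact ⟨h1, by rw [h2, h3]⟩
  refine ⟨X, fun j => ⟨?_, fun a b hab => hX _ _ _ _ fun h => hab h.2, fun i r => ⟨?_, ?_⟩⟩,
    fun j j' hj a b => hX _ _ _ _ fun h => hj h.1⟩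
  · rintro (_ | i | ⟨i, r⟩)
    · exact hp.conn_pathHull ⟨_, ⟨0, hk⟩, ⟨0, hk⟩, rfl⟩ (hPA j)
    · exact hp'.conn_pathHull ⟨_, ⟨0, hk⟩, rfl⟩ (hPB j i)
    · exact hKc _
  · exact (hαt _).mono subset_rfl (Set.singleton_subset_iff.2 (mem_pathHull ⟨i, r, rfl⟩))
  · exact (hγt _).mono subset_rfl (Set.singleton_subset_iff.2 (mem_pathHull ⟨r, rfl⟩))

/-- A graph of tree-depth at most three is a minor of every graph with a haven of large order. -/
theorem Haven.isMinor [Finite V] {W : Type} [Finite W] (H : SimpleGraph W) {n k : ℕ} (hk : 0 < k)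
    (hnk : ∀ X : Fin n → Node k → Set V, (∀ j, FatModel G k (X j)) →
      (∀ j j', j ≠ j' → ∀ a b, Disjoint (X j a) (X j' b)) → IsMinor H G)
    {U : Set V} {β : Set V → Set V}
    (hβ : Haven G U ((Nat.card W + 1) * connectorBound n k) β) : IsMinor H G := by
  have hpos : 1 ≤ connectorBound n k := Nat.one_le_two_pow
  obtain ⟨L, hL, hLd⟩ := hβ.exists_disjoint_robust_paths hpos (Nat.card W) le_rfl
  have hne : ∀ i, L i ≠ [] := by
    intro i h
    obtain ⟨v, hv, -⟩ := (hL i).2 ∅ (by simp; omega)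
    simp [h] at hv
  have hseq := fun i => (hL i).1.exists_isPathSeq (hne i)
  choose p hp hpL using hseq
  have hset : ∀ i, {v | v ∈ L i} = {v | ∃ x < (L i).length, p i x = v} := fun i =>
    Set.ext fun v => hpL i v
  have hdis : ∀ i j, i ≠ j → Disjoint {v | v ∈ L i} {v | v ∈ L j} := fun i j h =>
    Set.disjoint_left.2 (hLd h)
  by_cases hall : ∀ i j, i ≠ j → Touch G {v | v ∈ L i} {v | v ∈ L j}
  · let e := Finite.equivFin W
    refine ⟨fun w => {v | v ∈ L (e w)}, fun w => ?_, fun w w' h => hdis _ _ (e.injective.ne h),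
      fun w w' h => hall _ _ (e.injective.ne h.ne)⟩
    rw [← conn_iff_induce_connected]
    dsimp only
    rw [hset]
    have hlen := List.length_pos_of_ne_nil (hne (e w))
    convert (hp (e w)).conn_segment 0 ((L (e w)).length - 1) (by omega) using 1
    ext v
    exact ⟨fun ⟨x, hx, h⟩ => ⟨x, h, by omega, by omega⟩, fun ⟨x, h, _, hx⟩ => ⟨x, by omega, h⟩⟩
  · push Not at hall
    obtain ⟨i, j, hij, hnt⟩ := hall
    have hle : connectorBound n k ≤ (Nat.card W + 1) * connectorBound n k :=
      Nat.le_mul_of_pos_left _ (by omega)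
    obtain ⟨D, hD, hDd⟩ := exists_disjoint_connectors G (connectorBound n k) _ _
      fun Z hZ => hβ.le_ncard_of_separates hle (hL i).2 (hL j).2 hZ
    have hdij := hdis i j hij
    rw [hset i, hset j] at hnt hdij
    simp only [hset] at hD
    obtain ⟨X, hX, hXd⟩ := exists_fatModels_of_connectors hk (hp i) (hp j) hdij hnt hD hDd
    exact hnk X hX hXd

theorem ncard_biUnion_le_mul [Finite V] {ι : Type*} [Finite ι] (B : Set ι) (Q : ι → Set V) {r : ℕ}
    (h : ∀ i ∈ B, (Q i).ncard ≤ r) : (⋃ i ∈ B, Q i).ncard ≤ B.ncard * r := by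
  induction B, B.toFinite using Set.Finite.induction_on with
  | empty => simp
  | @insert a B ha _ ih =>
    rw [Set.biUnion_insert, Set.ncard_insert_of_notMem ha, add_mul, one_mul, add_comm]
    exact (Set.ncard_union_le _ _).trans (add_le_add (h a (Set.mem_insert _ _))
      (ih fun i hi => h i (Set.mem_insert_of_mem _ hi)))

/-- The neighbours of `Y` in `U` outside `Y`. -/
def boundary (G : SimpleGraph V) (U Y : Set V) : Set V :=
  {x | x ∈ U ∧ x ∉ Y ∧ ∃ y ∈ Y, G.Adj y x}

/-- Disjoint connected sets `R j` and distinct vertices `x i` outside them, each `x i` having a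
neighbour in each `R j`. -/
def HasBipartiteModel (G : SimpleGraph V) (a : ℕ) : Prop :=
  ∃ (R : Fin a → Set V) (x : Fin a → V), (∀ i, Conn G (R i)) ∧
    (Pairwise fun i j => Disjoint (R i) (R j)) ∧ Function.Injective x ∧
    ∀ i j, x i ∉ R j ∧ Touch G {x i} (R j)

theorem HasBipartiteModel.isMinor {W : Type} [Finite W] (H : SimpleGraph W)
    (h : HasBipartiteModel G (Nat.card W)) : IsMinor H G := by
  obtain ⟨R, x, hR, hd, hx, hxR⟩ := h
  let e := Finite.equivFin W
  refine ⟨fun w => {x (e w)} ∪ R (e w), fun w => ?_, fun w w' hw => ?_, fun w w' hw => ?_⟩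
  · exact conn_iff_induce_connected.1 ((conn_singleton _).union (hR _) (.inr (hxR _ _).2))
  · have hne := e.injective.ne hw
    refine Set.disjoint_union_left.2 ⟨Set.disjoint_union_right.2 ⟨?_, ?_⟩,
      Set.disjoint_union_right.2 ⟨?_, hd hne⟩⟩
    · exact Set.disjoint_singleton.2 (hx.ne hne)
    · exact Set.disjoint_singleton_left.2 (hxR _ _).1
    · exact Set.disjoint_singleton_right.2 (hxR _ _).1
  · exact (hxR (e w) (e w')).2.mono Set.subset_union_left Set.subset_union_right

theorem exists_injective_of_le_ncard {α : Type*} [Finite α] {s : Set α} {a : ℕ}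
    (h : a ≤ s.ncard) : ∃ f : Fin a → α, Function.Injective f ∧ ∀ i, f i ∈ s := by
  have : Nonempty (Fin a ↪ s) := by
    have := Fintype.ofFinite s
    apply Function.Embedding.nonempty_of_card_le
    rwa [Fintype.card_fin, ← Nat.card_eq_fintype_card, Nat.card_coe_set_eq]
  obtain ⟨f⟩ := this
  exact ⟨fun i => f i, fun i j hij => f.injective (Subtype.ext hij), fun i => (f i).2⟩

/-- Without large bipartite models few components have a large boundary inside a bounded set. -/
theorem ncard_components_le [Finite V] {a : ℕ} (hKa : ¬ HasBipartiteModel G a) (U A T : Set V)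
    (B : Set (Set V)) (hB : ∀ C ∈ B, IsComp G A C ∧ boundary G U C ⊆ T ∧
      a ≤ (boundary G U C).ncard) : B.ncard ≤ a * 2 ^ T.ncard := by
  classical
  by_contra hlt
  push Not at hlt
  have hBf := B.toFinite
  have hTf := (𝒫 T).toFinite
  have hpow : hTf.toFinset.card = 2 ^ T.ncard := by
    rw [← Set.ncard_eq_toFinset_card _ hTf, Set.ncard_powerset]
  obtain ⟨X, -, hX⟩ := Finset.exists_lt_card_fiber_of_mul_lt_card_of_maps_to
    (s := hBf.toFinset) (t := hTf.toFinset) (f := boundary G U) (n := a)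
    (fun C hC => by simpa using (hB C (by simpa using hC)).2.1)
    (by rw [hpow, ← Set.ncard_eq_toFinset_card _ hBf]; linarith)
  obtain ⟨R, hRi, hR⟩ := exists_injective_of_le_ncard
    (s := {C | C ∈ B ∧ boundary G U C = X}) (a := a) (by
      rw [Set.ncard_eq_toFinset_card _ (Set.toFinite _)]
      refine hX.le.trans (Finset.card_le_card fun C hC => ?_)
      simpa using hC)
  have hXc : a = 0 ∨ a ≤ X.ncard := by
    rcases Nat.eq_zero_or_pos a with h | h
    · exact .inl h
    · right
      have := hR ⟨0, h⟩
      rw [← this.2]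
      exact (hB _ this.1).2.2
  obtain ⟨x, hxi, hx⟩ : ∃ x : Fin a → V, Function.Injective x ∧ ∀ i, x i ∈ X := by
    rcases hXc with rfl | h
    · exact ⟨fun i => i.elim0, fun i => i.elim0, fun i => i.elim0⟩
    · exact exists_injective_of_le_ncard h
  refine hKa ⟨R, x, fun i => (hB _ (hR i).1).1.2.1, fun i j hij =>
    (hB _ (hR i).1).1.disjoint (hB _ (hR j).1).1 (hRi.ne hij), hxi, fun i j => ?_⟩
  have := hx i
  rw [← (hR j).2] at this
  obtain ⟨-, h1, y, hy, e⟩ := this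
  exact ⟨h1, x i, rfl, y, hy, e.symm⟩

/-- Without havens of order `t`, every set has a balanced separator of size at most `t`. -/
theorem exists_balanced_separator [Finite V] {t : ℕ} (hG : ∀ U β, ¬ Haven G U t β)
    (W S : Set V) : ∃ Z : Set V, Z.ncard ≤ t ∧
      ∀ C, IsComp G (W \ Z) C → 2 * (C ∩ S).ncard ≤ S.ncard := by
  by_contra hcon
  push Not at hcon
  choose! β hβ using hcon
  refine hG W β ⟨fun Z hZ => (hβ Z hZ).1, fun Z Z' h hZ' => ?_⟩
  have hZ : Z.ncard ≤ t := (Set.ncard_le_ncard h).trans hZ'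
  obtain ⟨h1, h2⟩ := hβ Z hZ
  obtain ⟨h3, h4⟩ := hβ Z' hZ'
  refine h1.subset_of_conn h3.2.1 (h3.1.trans (Set.sdiff_subset_sdiff_right h)) ?_
  by_contra hne
  rw [Set.not_nonempty_iff_eq_empty] at hne
  have hd : Disjoint (β Z' ∩ S) (β Z ∩ S) :=
    (Set.disjoint_iff_inter_eq_empty.2 hne).mono Set.inter_subset_left Set.inter_subset_left
  have := Set.ncard_union_eq hd
  have : (β Z' ∩ S ∪ β Z ∩ S).ncard ≤ S.ncard :=
    Set.ncard_le_ncard (Set.union_subset Set.inter_subset_right Set.inter_subset_right)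
  omega

/-- The number of vertices that suffices to reduce boundaries of size `g`. -/
def reduceBound (t a : ℕ) : ℕ → ℕ
  | 0 => 0
  | g + 1 => t + a * 2 ^ (t + (g + 1)) * reduceBound t a g

/-- Deleting boundedly many vertices of a set with bounded boundary leaves components whose
boundary is at most `2 * t + a`. -/
theorem exists_boundary_reduction [Finite V] {t a : ℕ} (hG : ∀ U β, ¬ Haven G U t β)
    (hKa : ¬ HasBipartiteModel G a) (U : Set V) (g : ℕ) (A S : Set V) (hA : A ⊆ U)
    (hAS : boundary G U A ⊆ S) (hS : S.ncard ≤ g) :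
    ∃ Q ⊆ A, Q.ncard ≤ reduceBound t a g ∧
      ∀ C, IsComp G (A \ Q) C → (boundary G U C).ncard ≤ 2 * t + a := by
  induction g generalizing A S with
  | zero =>
    refine ⟨∅, Set.empty_subset _, by simp, fun C hC => ?_⟩
    have hS0 : S = ∅ := (Set.ncard_eq_zero S.toFinite).1 (by omega)
    have : boundary G U C = ∅ := by
      rw [Set.eq_empty_iff_forall_notMem]
      rintro x ⟨hxU, hxC, y, hy, e⟩
      by_cases hxA : x ∈ A
      · exact hxC (hC.2.2 y hy x ⟨hxA, fun h => h⟩ e)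
      · have := hAS ⟨hxU, hxA, y, (hC.1 hy).1, e⟩
        rw [hS0] at this
        exact this
    simp [this]
  | succ g ih =>
  obtain ⟨Z, hZ, hbal⟩ := exists_balanced_separator hG (A ∪ S) S
  have hbd : ∀ C, IsComp G (A \ Z) C → boundary G U C ⊆ Z ∪ S ∧
      2 * (boundary G U C).ncard ≤ 2 * t + S.ncard := by
    intro C hC
    obtain ⟨E, hE, hCE⟩ := hC.2.1.exists_isComp
      (hC.1.trans (Set.sdiff_subset_sdiff_left (Set.subset_union_left (t := S))))
    have hsub : boundary G U C ⊆ Z ∪ (E ∩ S) := by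
      rintro x ⟨hxU, hxC, y, hy, e⟩
      by_cases hxZ : x ∈ Z
      · exact .inl hxZ
      have hxA : x ∉ A := fun h => hxC (hC.2.2 y hy x ⟨h, hxZ⟩ e)
      have hxS := hAS ⟨hxU, hxA, y, (hC.1 hy).1, e⟩
      exact .inr ⟨hE.2.2 y (hCE hy) x ⟨.inr hxS, hxZ⟩ e, hxS⟩
    refine ⟨hsub.trans (Set.union_subset_union_right _ Set.inter_subset_right), ?_⟩
    have h1 := hbal E hE
    have h2 := (Set.ncard_le_ncard hsub).trans (Set.ncard_union_le _ _)
    omega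
  by_cases hg : S.ncard ≤ 2 * t
  · refine ⟨Z ∩ A, Set.inter_subset_right, ?_, fun C hC => ?_⟩
    · have : (Z ∩ A).ncard ≤ Z.ncard := Set.ncard_le_ncard Set.inter_subset_left
      simp only [reduceBound]
      exact (this.trans hZ).trans (Nat.le_add_right _ _)
    · have := hbd C (by rwa [Set.sdiff_inter_self_eq_sdiff] at hC)
      omega
  let B : Set (Set V) := {C | IsComp G (A \ Z) C ∧ 2 * t + a < (boundary G U C).ncard}
  have hBc : B.ncard ≤ a * 2 ^ (t + (g + 1)) := by
    refine (ncard_components_le hKa U (A \ Z) (Z ∪ S) B fun C hC =>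
      ⟨hC.1, (hbd C hC.1).1, by have := hC.2; omega⟩).trans ?_
    have := Set.ncard_union_le Z S
    exact Nat.mul_le_mul_left _ (Nat.pow_le_pow_right (by omega) (by omega))
  have hrec : ∀ C ∈ B, ∃ Q ⊆ C, Q.ncard ≤ reduceBound t a g ∧
      ∀ C', IsComp G (C \ Q) C' → (boundary G U C').ncard ≤ 2 * t + a := fun C hC =>
    ih C (boundary G U C) ((hC.1.1.trans Set.sdiff_subset).trans hA) subset_rfl (by
      have := (hbd C hC.1).2
      omega)
  choose! Q hQC hQc hQ using hrec
  refine ⟨(Z ∩ A) ∪ ⋃ C ∈ B, Q C, ?_, ?_, fun C' hC' => ?_⟩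
  · exact Set.union_subset Set.inter_subset_right (Set.iUnion₂_subset fun C hC =>
      (hQC C hC).trans (hC.1.1.trans Set.sdiff_subset))
  · refine (Set.ncard_union_le _ _).trans (add_le_add
      ((Set.ncard_le_ncard Set.inter_subset_left).trans hZ) ?_)
    exact (ncard_biUnion_le_mul B Q hQc).trans (Nat.mul_le_mul_right _ hBc)
  · have hC'Z : C' ⊆ A \ Z := fun x hx =>
      ⟨(hC'.1 hx).1, fun h => (hC'.1 hx).2 (.inl ⟨h, (hC'.1 hx).1⟩)⟩
    obtain ⟨C, hC, hCC⟩ := hC'.2.1.exists_isComp hC'Z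
    have hother : ∀ x ∈ C, x ∈ (Z ∩ A) ∪ ⋃ C ∈ B, Q C → C ∈ B ∧ x ∈ Q C := by
      intro x hx hxQ
      rcases hxQ with hxQ | hxQ
      · exact absurd hxQ.1 (hC.1 hx).2
      · rw [Set.mem_iUnion₂] at hxQ
        obtain ⟨E, hE, hxE⟩ := hxQ
        rw [hC.eq_of_inter hE.1 ⟨x, hx, hQC E hE hxE⟩]
        exact ⟨hE, hxE⟩
    by_cases hCB : C ∈ B
    · refine hQ C hCB C' ⟨fun x hx => ⟨hCC hx, fun h => (hC'.1 hx).2 (.inr ?_)⟩, hC'.2.1,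
        fun x hx y hy e => hC'.2.2 x hx y ⟨(hC.1 hy.1).1, fun h => hy.2 (hother y hy.1 h).2⟩ e⟩
      exact Set.mem_iUnion₂.2 ⟨C, hCB, h⟩
    · have hCsub : C ⊆ C' := by
        refine hC'.subset_of_conn hC.2.1
          (fun x hx => ⟨(hC.1 hx).1, fun h => hCB (hother x hx h).1⟩) ?_
        obtain ⟨z, hz⟩ := hC'.2.1.1
        exact ⟨z, hCC hz, hz⟩
      rw [Set.Subset.antisymm hCC hCsub]
      by_contra hlt
      exact hCB ⟨hC, not_le.1 hlt⟩

/-- A connected set in `Y` with `k` disjoint connected sets in `Y`, each touching it and `p`. -/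
def HasStar (G : SimpleGraph V) (k : ℕ) (p : V) (Y : Set V) : Prop :=
  ∃ (M : Set V) (D : Fin k → Set V), M ⊆ Y ∧ Conn G M ∧
    (∀ r, D r ⊆ Y ∧ Conn G (D r) ∧ Disjoint M (D r) ∧ Touch G (D r) M ∧ Touch G (D r) {p}) ∧
    Pairwise fun r s => Disjoint (D r) (D s)

/-- There are `k` disjoint connected sets in `Y`, each touching both `p` and `q`. -/
def HasLinks (G : SimpleGraph V) (k : ℕ) (p q : V) (Y : Set V) : Prop :=
  ∃ D : Fin k → Set V,
    (∀ r, D r ⊆ Y ∧ Conn G (D r) ∧ Touch G (D r) {p} ∧ Touch G (D r) {q}) ∧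
    Pairwise fun r s => Disjoint (D r) (D s)

theorem HasStar.mono {k : ℕ} {p : V} {Y Y' : Set V} (h : HasStar G k p Y) (hY : Y ⊆ Y') :
    HasStar G k p Y' := by
  obtain ⟨M, D, hM, hMc, hD, hd⟩ := h
  exact ⟨M, D, hM.trans hY, hMc, fun r => ⟨(hD r).1.trans hY, (hD r).2⟩, hd⟩

/-- Links from `p` to `q` give a star centred at `q`. -/
theorem HasLinks.hasStar {k : ℕ} {p q : V} {C Y : Set V} (h : HasLinks G k p q C) (hC : C ⊆ Y)
    (hq : q ∈ Y) (hqC : q ∉ C) : HasStar G k p Y := by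
  obtain ⟨D, hD, hd⟩ := h
  refine ⟨{q}, D, by simpa using hq, conn_singleton q, fun r => ?_, hd⟩
  obtain ⟨h1, h2, h3, h4⟩ := hD r
  exact ⟨h1.trans hC, h2, Set.disjoint_singleton_left.2 fun h => hqC (h1 h), h4, h3⟩

theorem exists_hitting_stars [Finite V] {t k : ℕ} (hG : ∀ U β, ¬ Haven G U t β) {U Y : Set V}
    (hU : ¬ ∃ X, FatModel G k X ∧ ∀ a, X a ⊆ U) (hY : Y ⊆ U) {p : V} (hp : p ∈ U) (hpY : p ∉ Y) :
    ∃ Z ⊆ Y, Z.ncard ≤ hitBound t k ∧ ¬ HasStar G k p (Y \ Z) := by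
  obtain ⟨Z, hZ, hZc, hZh⟩ := exists_hitting_set hG (fun K => Conn G K ∧ HasStar G k p K)
    (fun K h => h.1) k Y (by
      rintro ⟨f, hf, hd⟩
      choose M D hM hMc hD hDd using fun i => (hf i).1.2
      have hpf : ∀ i, p ∉ f i := fun i h => hpY ((hf i).2 h)
      have hpM : ∀ i, p ∉ M i := fun i h => hpf i (hM i h)
      have hpD : ∀ i r, p ∉ D i r := fun i r h => hpf i ((hD i r).1 h)
      have hMD : ∀ i j r, Disjoint (M i) (D j r) := by
        intro i j r
        rcases eq_or_ne i j with rfl | hij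
        · exact (hD i r).2.2.1
        · exact (hd hij).mono (hM i) (hD j r).1
      refine hU ⟨fun
        | .root => {p}
        | .mid i => M i
        | .leaf i r => D i r, ⟨?_, ?_, fun i r => ⟨(hD i r).2.2.2.2, (hD i r).2.2.2.1⟩⟩, ?_⟩
      · rintro (_ | i | ⟨i, r⟩)
        · exact conn_singleton p
        · exact hMc i
        · exact (hD i r).2.1
      · rintro (_ | i | ⟨i, r⟩) (_ | j | ⟨j, r'⟩) hne
        · exact absurd rfl hne
        · exact Set.disjoint_singleton_left.2 (hpM j)
        · exact Set.disjoint_singleton_left.2 (hpD j r')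
        · exact Set.disjoint_singleton_right.2 (hpM i)
        · exact (hd fun h => hne (by rw [h])).mono (hM i) (hM j)
        · exact hMD i j r'
        · exact Set.disjoint_singleton_right.2 (hpD i r)
        · exact (hMD j i r).symm
        · rcases eq_or_ne i j with rfl | hij
          · exact hDd i fun h => hne (by rw [h])
          · exact (hd hij).mono (hD i r).1 (hD j r').1
      · rintro (_ | i | ⟨i, r⟩)
        · simpa using hp
        · exact (hM i).trans ((hf i).2.trans hY)
        · exact (hD i r).1.trans ((hf i).2.trans hY))
  refine ⟨Z, hZ, hZc, ?_⟩
  rintro ⟨M, D, hM, hMc, hD, hd⟩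
  refine hZh (M ∪ ⋃ r, D r) ⟨hMc.union_iUnion D (fun r => (hD r).2.1)
    fun r => (hD r).2.2.2.1.symm, M, D, Set.subset_union_left, hMc, fun r =>
      ⟨(Set.subset_iUnion D r).trans Set.subset_union_right, (hD r).2⟩, hd⟩
    (Set.union_subset hM (Set.iUnion_subset fun r => (hD r).1))

theorem exists_hitting_links [Finite V] {t k : ℕ} (hG : ∀ U β, ¬ Haven G U t β) {Y : Set V}
    {p q : V} (h : ¬ HasLinks G k p q Y) :
    ∃ Z ⊆ Y, Z.ncard ≤ hitBound t k ∧
      ∀ K, Conn G K → Touch G K {p} → Touch G K {q} → ¬ K ⊆ Y \ Z := by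
  obtain ⟨Z, hZ, hZc, hZh⟩ := exists_hitting_set hG
    (fun K => Conn G K ∧ Touch G K {p} ∧ Touch G K {q}) (fun K h => h.1) k Y (by
      rintro ⟨f, hf, hd⟩
      exact h ⟨f, fun r => ⟨(hf r).2, (hf r).1⟩, hd⟩)
  exact ⟨Z, hZ, hZc, fun K h1 h2 h3 => hZh K ⟨h1, h2, h3⟩⟩

/-- The number of vertices of a set hitting the stars and links at a set of `s` vertices,
together with one further vertex. -/
def preBound (t k s : ℕ) : ℕ :=
  s * hitBound t k + s * (s * hitBound t k) + 1

/-- The clustering of the colouring in `exists_extension`. -/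
def clusterBound (t a k : ℕ) : ℕ :=
  preBound t k (2 * t + a) + reduceBound t a (2 * t + a + preBound t k (2 * t + a))

theorem exists_ne_fin_four (c₁ c₂ c₃ : Fin 4) : ∃ c : Fin 4, c ≠ c₁ ∧ c ≠ c₂ ∧ c ≠ c₃ := by
  revert c₁ c₂ c₃
  decide

/-- `Y` has a colouring with bounded monochromatic connected sets that avoids a prescribed colour
on the neighbours of each of three sets. -/
theorem exists_extension [Finite V] {t a k : ℕ} (hG : ∀ U β, ¬ Haven G U t β)
    (hKa : ¬ HasBipartiteModel G a) {U : Set V}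
    (hU : ¬ ∃ X, FatModel G k X ∧ ∀ a, X a ⊆ U) (m : ℕ) (Y : Set V) (hYm : Y.ncard ≤ m)
    (hY : Y ⊆ U) (P₁ P₂ P₃ : Set V) (c₁ c₂ c₃ : Fin 4)
    (hPU : P₁ ∪ P₂ ∪ P₃ ⊆ U \ Y) (hbd : boundary G U Y ⊆ P₁ ∪ P₂ ∪ P₃)
    (hcard : (P₁ ∪ P₂ ∪ P₃).ncard ≤ 2 * t + a)
    (hstar : ∀ p ∈ P₁ ∪ P₂, ¬ HasStar G k p Y)
    (hlink : ∀ p ∈ P₁, ∀ q ∈ P₃, ¬ HasLinks G k p q Y) :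
    ∃ f : V → Fin 4, (∀ y ∈ Y, ∀ x, G.Adj x y →
        (x ∈ P₁ → f y ≠ c₁) ∧ (x ∈ P₂ → f y ≠ c₂) ∧ (x ∈ P₃ → f y ≠ c₃)) ∧
      ∀ D ⊆ Y, Conn G D → (∀ x ∈ D, ∀ y ∈ D, f x = f y) → D.ncard ≤ clusterBound t a k := by
  classical
  induction m generalizing Y P₁ P₂ P₃ c₁ c₂ c₃ with
  | zero =>
    have hY0 : Y = ∅ := (Set.ncard_eq_zero Y.toFinite).1 (by omega)
    subst hY0
    refine ⟨fun _ => 0, fun y hy => absurd hy (Set.notMem_empty y), fun D hD hDc => ?_⟩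
    exact absurd (hDc.1.mono hD) Set.not_nonempty_empty
  | succ m ih =>
  rcases Y.eq_empty_or_nonempty with rfl | ⟨y₀, hy₀⟩
  · refine ⟨fun _ => 0, fun y hy => absurd hy (Set.notMem_empty y), fun D hD hDc => ?_⟩
    exact absurd (hDc.1.mono hD) Set.not_nonempty_empty
  have hP₁ : P₁ ⊆ P₁ ∪ P₂ ∪ P₃ := Set.subset_union_left.trans Set.subset_union_left
  have hP₂ : P₂ ⊆ P₁ ∪ P₂ ∪ P₃ := Set.subset_union_right.trans Set.subset_union_left
  have hP₃ : P₃ ⊆ P₁ ∪ P₂ ∪ P₃ := Set.subset_union_right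
  have hS : ∀ p ∈ P₃, ∃ Z ⊆ Y, Z.ncard ≤ hitBound t k ∧ ¬ HasStar G k p (Y \ Z) := fun p hp =>
    exists_hitting_stars hG hU hY (hPU (hP₃ hp)).1 (hPU (hP₃ hp)).2
  choose! ZS hZSY hZSc hZS using hS
  have hL : ∀ p ∈ P₁, ∀ q ∈ P₃, ∃ Z ⊆ Y, Z.ncard ≤ hitBound t k ∧
      ∀ K, Conn G K → Touch G K {p} → Touch G K {q} → ¬ K ⊆ Y \ Z := fun p hp q hq =>
    exists_hitting_links hG (hlink p hp q hq)
  choose! ZL hZLY hZLc hZL using hL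
  obtain ⟨c₄, hc₁, hc₂, hc₃⟩ := exists_ne_fin_four c₁ c₂ c₃
  let Q₀ : Set V := ((⋃ p ∈ P₃, ZS p) ∪ ⋃ p ∈ P₁, ⋃ q ∈ P₃, ZL p q) ∪ {y₀}
  have hQ₀Y : Q₀ ⊆ Y := Set.union_subset (Set.union_subset
    (Set.iUnion₂_subset hZSY) (Set.iUnion₂_subset fun p hp => Set.iUnion₂_subset (hZLY p hp)))
    (by simpa using hy₀)
  have hQ₀c : Q₀.ncard ≤ preBound t k (2 * t + a) := by
    have h1 : P₁.ncard ≤ 2 * t + a := (Set.ncard_le_ncard hP₁).trans hcard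
    have h3 : P₃.ncard ≤ 2 * t + a := (Set.ncard_le_ncard hP₃).trans hcard
    refine (Set.ncard_union_le _ _).trans (add_le_add ((Set.ncard_union_le _ _).trans
      (add_le_add ?_ ?_)) (Set.ncard_singleton y₀).le)
    · exact (ncard_biUnion_le_mul P₃ ZS hZSc).trans (Nat.mul_le_mul_right _ h3)
    · refine (ncard_biUnion_le_mul P₁ _ fun p hp => ?_).trans (Nat.mul_le_mul_right _ h1)
      exact (ncard_biUnion_le_mul P₃ _ (hZLc p hp)).trans (Nat.mul_le_mul_right _ h3)
  obtain ⟨Q₁, hQ₁Y, hQ₁c, hQ₁⟩ := exists_boundary_reduction hG hKa U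
    (2 * t + a + preBound t k (2 * t + a)) (Y \ Q₀) ((P₁ ∪ P₂ ∪ P₃) ∪ Q₀)
    (Set.sdiff_subset.trans hY) (by
      rintro x ⟨hxU, hx, y, hy, e⟩
      by_cases hxY : x ∈ Y
      · exact .inr (by_contra fun h => hx ⟨hxY, h⟩)
      · exact .inl (hbd ⟨hxU, hxY, y, hy.1, e⟩))
    ((Set.ncard_union_le _ _).trans (add_le_add hcard hQ₀c))
  let Q : Set V := Q₀ ∪ Q₁
  have hQY : Q ⊆ Y := Set.union_subset hQ₀Y (hQ₁Y.trans Set.sdiff_subset)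
  have hQc : Q.ncard ≤ clusterBound t a k :=
    (Set.ncard_union_le _ _).trans (add_le_add hQ₀c hQ₁c)
  have hbdC : ∀ C, IsComp G (Y \ Q) C → boundary G U C ⊆ P₁ ∪ P₂ ∪ P₃ ∪ Q := by
    rintro C hC x ⟨hxU, hxC, y, hy, e⟩
    by_cases hxY : x ∈ Y
    · exact .inr (by_contra fun h => hxC (hC.2.2 y hy x ⟨hxY, h⟩ e))
    · exact .inl (hbd ⟨hxU, hxY, y, (hC.1 hy).1, e⟩)
  have hcomp : ∀ C, IsComp G (Y \ Q) C → ∃ f : V → Fin 4, (∀ y ∈ C, ∀ x, G.Adj x y →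
        (x ∈ P₁ → f y ≠ c₁) ∧ (x ∈ P₂ → f y ≠ c₂) ∧ (x ∈ P₃ → f y ≠ c₃) ∧ (x ∈ Q → f y ≠ c₄)) ∧
      ∀ D ⊆ C, Conn G D → (∀ x ∈ D, ∀ y ∈ D, f x = f y) → D.ncard ≤ clusterBound t a k := by
    intro C hC
    have hCY : C ⊆ Y := hC.1.trans Set.sdiff_subset
    have hCm : C.ncard ≤ m := by
      have : C.ncard < Y.ncard := Set.ncard_lt_ncard
        ⟨hCY, fun h => (hC.1 (h hy₀)).2 (.inl (.inr rfl))⟩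
      omega
    have hbc : (boundary G U C).ncard ≤ 2 * t + a := hQ₁ C (by rwa [Set.sdiff_sdiff])
    have hmem : ∀ y ∈ C, ∀ x, G.Adj x y → x ∈ P₁ ∪ P₂ ∪ P₃ ∪ Q → x ∈ boundary G U C := by
      rintro y hy x e (hx | hx)
      · exact ⟨(hPU hx).1, fun h => (hPU hx).2 (hCY h), y, hy, e.symm⟩
      · exact ⟨hY (hQY hx), fun h => (hC.1 h).2 hx, y, hy, e.symm⟩
    have hQlink : ∀ p ∈ P₁ ∪ P₂, ∀ q ∈ Q, ¬ HasLinks G k p q C := fun p hp q hq h =>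
      hstar p hp (h.hasStar hCY (hQY hq) fun h => (hC.1 h).2 hq)
    by_cases h1 : (P₁ ∩ boundary G U C).Nonempty
    · have h3 : P₃ ∩ boundary G U C = ∅ := by
        rw [Set.eq_empty_iff_forall_notMem]
        rintro q ⟨hq, -, -, z, hz, ez⟩
        obtain ⟨p, hp, -, -, y, hy, ey⟩ := h1
        refine hZL p hp q hq C hC.2.1 ⟨y, hy, p, rfl, ey⟩ ⟨z, hz, q, rfl, ez⟩ fun x hx =>
          ⟨hCY hx, fun h => (hC.1 hx).2 (.inl (.inl (.inr ?_)))⟩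
        exact Set.mem_iUnion₂.2 ⟨p, hp, Set.mem_iUnion₂.2 ⟨q, hq, h⟩⟩
      obtain ⟨f, hf, hfD⟩ := ih C hCm (hCY.trans hY) (P₁ ∩ boundary G U C)
        (P₂ ∩ boundary G U C) (Q ∩ boundary G U C) c₁ c₂ c₄
        (by rintro x ((h | h) | h) <;> exact ⟨h.2.1, h.2.2.1⟩)
        (by
          intro x hx
          rcases hbdC C hC hx with ((h | h) | h) | h
          · exact .inl (.inl ⟨h, hx⟩)
          · exact .inl (.inr ⟨h, hx⟩)
          · exact absurd (h3 ▸ ⟨h, hx⟩ : x ∈ (∅ : Set V)) (Set.notMem_empty x)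
          · exact .inr ⟨h, hx⟩)
        ((Set.ncard_le_ncard (by rintro x ((h | h) | h) <;> exact h.2)).trans hbc)
        (by
          rintro p (h | h) hs
          · exact hstar p (.inl h.1) (hs.mono hCY)
          · exact hstar p (.inr h.1) (hs.mono hCY))
        (fun p hp q hq => hQlink p (.inl hp.1) q hq.1)
      refine ⟨f, fun y hy x e => ?_, hfD⟩
      obtain ⟨g1, g2, g3⟩ := hf y hy x e
      refine ⟨fun h => g1 ⟨h, hmem y hy x e (.inl (hP₁ h))⟩,
        fun h => g2 ⟨h, hmem y hy x e (.inl (hP₂ h))⟩, fun h => ?_,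
        fun h => g3 ⟨h, hmem y hy x e (.inr h)⟩⟩
      exact absurd (h3 ▸ ⟨h, hmem y hy x e (.inl (hP₃ h))⟩ : x ∈ (∅ : Set V)) (Set.notMem_empty x)
    · obtain ⟨f, hf, hfD⟩ := ih C hCm (hCY.trans hY) (P₂ ∩ boundary G U C)
        (P₃ ∩ boundary G U C) (Q ∩ boundary G U C) c₂ c₃ c₄
        (by rintro x ((h | h) | h) <;> exact ⟨h.2.1, h.2.2.1⟩)
        (by
          intro x hx
          rcases hbdC C hC hx with ((h | h) | h) | h
          · exact absurd ⟨x, h, hx⟩ h1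
          · exact .inl (.inl ⟨h, hx⟩)
          · exact .inl (.inr ⟨h, hx⟩)
          · exact .inr ⟨h, hx⟩)
        ((Set.ncard_le_ncard (by rintro x ((h | h) | h) <;> exact h.2)).trans hbc)
        (by
          rintro p (h | h) hs
          · exact hstar p (.inr h.1) (hs.mono hCY)
          · refine hZS p h.1 (hs.mono fun x hx =>
              ⟨hCY hx, fun h' => (hC.1 hx).2 (.inl (.inl (.inl ?_)))⟩)
            exact Set.mem_iUnion₂.2 ⟨p, h.1, h'⟩)
        (fun p hp q hq => hQlink p (.inr hp.1) q hq.1)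
      refine ⟨f, fun y hy x e => ?_, hfD⟩
      obtain ⟨g1, g2, g3⟩ := hf y hy x e
      exact ⟨fun h => absurd ⟨x, h, hmem y hy x e (.inl (hP₁ h))⟩ h1,
        fun h => g1 ⟨h, hmem y hy x e (.inl (hP₂ h))⟩,
        fun h => g2 ⟨h, hmem y hy x e (.inl (hP₃ h))⟩,
        fun h => g3 ⟨h, hmem y hy x e (.inr h)⟩⟩
  choose! F hF hFD using hcomp
  let f : V → Fin 4 := fun y => if y ∈ Q then c₄ else F (compOf G (Y \ Q) y) y
  have hfQ : ∀ y ∈ Q, f y = c₄ := fun y hy => if_pos hy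
  have hfC : ∀ y, y ∉ Q → f y = F (compOf G (Y \ Q) y) y := fun y hy => if_neg hy
  refine ⟨f, fun y hy x e => ?_, fun D hD hDc hDf => ?_⟩
  · by_cases hyQ : y ∈ Q
    · rw [hfQ y hyQ]
      exact ⟨fun _ => hc₁, fun _ => hc₂, fun _ => hc₃⟩
    · rw [hfC y hyQ]
      have := hF _ (isComp_compOf ⟨hy, hyQ⟩) y (mem_compOf ⟨hy, hyQ⟩) x e
      exact ⟨this.1, this.2.1, this.2.2.1⟩
  · by_cases hDQ : (D ∩ Q).Nonempty
    · refine (Set.ncard_le_ncard ?_).trans hQc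
      by_contra hn
      obtain ⟨z, hz, hzQ⟩ := Set.not_subset.1 hn
      obtain ⟨x, hx, y, hy, e⟩ := hDc.2 Q hDQ ⟨z, hz, hzQ⟩
      have hyY : y ∈ Y \ Q := ⟨hD hy.1, hy.2⟩
      apply (hF _ (isComp_compOf hyY) y (mem_compOf hyY) x e).2.2.2 hx.2
      rw [← hfC y hy.2, ← hfQ x hx.2]
      exact hDf y hy.1 x hx.1
    · have hDY : D ⊆ Y \ Q := fun x hx => ⟨hD hx, fun h => hDQ ⟨x, hx, h⟩⟩
      obtain ⟨C, hC, hDC⟩ := hDc.exists_isComp hDY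
      refine hFD C hC D hDC hDc fun x hx y hy => ?_
      have := hDf x hx y hy
      rwa [hfC x (hDY hx).2, hfC y (hDY hy).2, ← hC.eq_compOf (hDC hx),
        ← hC.eq_compOf (hDC hy)] at this

/-- The union of a fat model is connected. -/
theorem FatModel.conn_iUnion {k : ℕ} (hk : 0 < k) {X : Node k → Set V} (hX : FatModel G k X) :
    Conn G (⋃ a, X a) := by
  have := (hX.1 .root).union_iUnion (fun ir : Fin k × Fin k => X (.leaf ir.1 ir.2) ∪ X (.mid ir.1))
    (fun ir => (hX.1 _).union (hX.1 _) (.inr (hX.2.2 _ _).2))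
    (fun ir => (hX.2.2 ir.1 ir.2).1.symm.mono subset_rfl Set.subset_union_left)
  convert this using 1
  apply Set.Subset.antisymm
  · refine Set.iUnion_subset ?_
    rintro (_ | i | ⟨i, r⟩) x hx
    · exact .inl hx
    · exact .inr (Set.mem_iUnion.2 ⟨(i, ⟨0, hk⟩), .inr hx⟩)
    · exact .inr (Set.mem_iUnion.2 ⟨(i, r), .inl hx⟩)
  · refine Set.union_subset (Set.subset_iUnion X _) (Set.iUnion_subset fun ir =>
      Set.union_subset (Set.subset_iUnion X _) (Set.subset_iUnion X _))

/-- A colouring with bounded monochromatic connected sets is a clustered colouring. -/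
theorem clusteredColourable_of_conn [Finite V] {k c : ℕ} (f : V → Fin k)
    (h : ∀ D, Conn G D → (∀ x ∈ D, ∀ y ∈ D, f x = f y) → D.ncard ≤ c) :
    ClusteredColourable G k c := by
  refine ⟨f, fun v => ?_⟩
  have hv : v ∈ {u | f u = f v} := rfl
  have hC := isComp_compOf (G := G) hv
  rw [← Set.ncard_image_of_injective _ Subtype.val_injective]
  refine (Set.ncard_le_ncard ?_).trans (h _ hC.2.1 fun x hx y hy =>
    (hC.1 hx).trans (hC.1 hy).symm)
  rintro _ ⟨w, hw, rfl⟩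
  rw [SimpleGraph.ConnectedComponent.mem_supp_iff, SimpleGraph.ConnectedComponent.eq] at hw
  obtain ⟨p⟩ := hw.symm
  by_contra hn
  obtain ⟨d, -, h1, h2⟩ := p.exists_boundary_dart
    {u | u.1 ∈ compOf G {u | f u = f v} v} (mem_compOf hv) hn
  exact h2 (hC.2.2 _ h1 _ d.snd.2 (by simpa using d.adj))

end FatMinor

open FatMinor in
/-- For every graph `H` of tree-depth at most 3 there is an integer
`c = c(H)` such that every `H`-minor-free graph is 5-colourable with clustering `c`. -/
theorem five_colourable_treeDepth_three
    {U : Type} [Finite U] (H : SimpleGraph U) (htd : treeDepth H ≤ 3) :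
    ∃ c : ℕ, ∀ (V : Type) [Finite V] (G : SimpleGraph V),
      ¬ IsMinor H G → ClusteredColourable G 5 c := by
  classical
  obtain ⟨n, k, hk, hnk⟩ := exists_isMinor_of_fatModels H htd
  let t := (Nat.card U + 1) * connectorBound n k
  refine ⟨max (hitBound t n) (clusterBound t (Nat.card U) k), fun V _ G hH => ?_⟩
  have hG : ∀ A β, ¬ Haven G A t β := fun A β hβ => hH (hβ.isMinor H hk (hnk V G))
  have hKa : ¬ HasBipartiteModel G (Nat.card U) := fun h => hH (h.isMinor H)
  obtain ⟨Z, -, hZc, hZ⟩ := exists_hitting_set hG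
    (fun K => Conn G K ∧ ∃ X, FatModel G k X ∧ ∀ a, X a ⊆ K) (fun K h => h.1) n Set.univ (by
      rintro ⟨f, hf, hd⟩
      choose X hX hXf using fun i => (hf i).1.2
      exact hH (hnk V G X hX fun j j' hj a b => (hd hj).mono (hXf j a) (hXf j' b)))
  obtain ⟨f, -, hf⟩ := exists_extension hG hKa (U := Set.univ \ Z) (k := k) (by
      rintro ⟨X, hX, hXZ⟩
      exact hZ _ ⟨hX.conn_iUnion hk, X, hX, Set.subset_iUnion X⟩ (Set.iUnion_subset hXZ))
    _ (Set.univ \ Z) le_rfl subset_rfl ∅ ∅ ∅ 0 0 0 (by simp)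
    (by rintro x ⟨h1, h2, -⟩; exact absurd h1 h2) (by simp) (by simp) (by simp)
  let g : V → Fin 5 := fun v => if v ∈ Z then Fin.last 4 else (f v).castSucc
  have hgZ : ∀ v ∈ Z, g v = Fin.last 4 := fun v hv => if_pos hv
  have hgf : ∀ v, v ∉ Z → g v = (f v).castSucc := fun v hv => if_neg hv
  refine clusteredColourable_of_conn g fun D hD hDg => ?_
  by_cases hDZ : (D ∩ Z).Nonempty
  · obtain ⟨z, hzD, hz⟩ := hDZ
    refine ((Set.ncard_le_ncard fun x hx => ?_).trans hZc).trans (le_max_left _ _)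
    by_contra hxZ
    have := hDg x hx z hzD
    rw [hgZ z hz, hgf x hxZ] at this
    exact Fin.castSucc_ne_last _ this
  · have hDs : D ⊆ Set.univ \ Z := fun x hx => ⟨trivial, fun h => hDZ ⟨x, hx, h⟩⟩
    refine (hf D hDs hD fun x hx y hy => ?_).trans (le_max_right _ _)
    have := hDg x hx y hy
    rw [hgf x (hDs hx).2, hgf y (hDs hy).2] at this
    exact Fin.castSucc_injective _ this
end
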